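/- The abstract algebra 𝒮 over F = ℂ(q) with generators s_ij^{(r)} (1 ≤ i,j ≤ 2n, r ≥ 0) and (s_{ii′}^{(0)})^{−1} (i = 1,3,…,2n−1), and defining relations: s_ij^{(0)} = 0 for i < j with j ≠ i′; s_{i′i′}^{(0)} s_ii^{(0)} − q² s_{i′i}^{(0)} s_{ii′}^{(0)} = q³ and s_{ii′}^{(0)} (s_{ii′}^{(0)})^{−1} = (s_{ii′}^{(0)})^{−1} s_{ii′}^{(0)} = 1 for odd i; and the affine reflection equation R(u,v) S₁(u) Rᵗ(u⁻¹,v) S₂(v) = S₂(v) Rᵗ(u⁻¹,v) S₁(u) R(u,v) for S(u) = Σ s_ij(u)⊗E_ij with s_ij(u) = Σ_{r≥0} s_ij^{(r)} u^{−r}, is isomorphic to the twisted q-Yangian Y^tw_q(sp_2n). -/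

import Mathlib

noncomputable section

open scoped TensorProduct

abbrev FF : Type := RatFunc ℂ

def qq : FF := RatFunc.X

/-! Constant R-matrices acting in `ℂ^N ⊗ ℂ^N`, written as matrices indexed by pairs. -/

def Rc (F : Type) [Field F] (q : F) (N : ℕ) :
    Matrix (Fin N × Fin N) (Fin N × Fin N) F := Matrix.of fun p r =>
  (if p = r then (if p.1 = p.2 then q else 1) else 0)
  + (if p.1 = r.2 ∧ p.2 = r.1 ∧ p.1 < p.2 then q - q⁻¹ else 0)

/-- `R` transposed in the first tensor factor. -/
def Rct (F : Type) [Field F] (q : F) (N : ℕ) :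
    Matrix (Fin N × Fin N) (Fin N × Fin N) F :=
  Matrix.of fun p r => Rc F q N (r.1, p.2) (p.1, r.2)

def Rtil (F : Type) [Field F] (q : F) (N : ℕ) :
    Matrix (Fin N × Fin N) (Fin N × Fin N) F := Matrix.of fun p r =>
  (if p = r then (if p.1 = p.2 then q⁻¹ else 1) else 0)
  + (if p.1 = r.2 ∧ p.2 = r.1 ∧ p.2 < p.1 then q⁻¹ - q else 0)

def Rtilt (F : Type) [Field F] (q : F) (N : ℕ) :
    Matrix (Fin N × Fin N) (Fin N × Fin N) F :=
  Matrix.of fun p r => Rtil F q N (r.1, p.2) (p.1, r.2)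

/-- `S ↦ S ⊗ 1` (action in the first copy of `End ℂ^N`). -/
def amp1 {A : Type} [Ring A] {N : ℕ} (M : Matrix (Fin N) (Fin N) A) :
    Matrix (Fin N × Fin N) (Fin N × Fin N) A :=
  Matrix.of fun p r => if p.2 = r.2 then M p.1 r.1 else 0

/-- `S ↦ 1 ⊗ S` (action in the second copy of `End ℂ^N`). -/
def amp2 {A : Type} [Ring A] {N : ℕ} (M : Matrix (Fin N) (Fin N) A) :
    Matrix (Fin N × Fin N) (Fin N × Fin N) A :=
  Matrix.of fun p r => if p.1 = r.1 then M p.2 r.2 else 0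

/-- A scalar matrix viewed as a matrix over an `F`-algebra `A`. -/
def liftF (F : Type) [Field F] {A : Type} [Ring A] [Algebra F A] {m : Type}
    (M : Matrix m m F) : Matrix m m A := M.map (algebraMap F A)

/-- Left hand side `R S₁ Rᵗ S₂` of the reflection equation. -/
def reflLHS (F : Type) [Field F] (q : F) {N : ℕ} {A : Type} [Ring A] [Algebra F A]
    (S : Matrix (Fin N) (Fin N) A) : Matrix (Fin N × Fin N) (Fin N × Fin N) A :=
  liftF F (Rc F q N) * amp1 S * liftF F (Rct F q N) * amp2 S

/-- Right hand side `S₂ Rᵗ S₁ R` of the reflection equation. -/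
def reflRHS (F : Type) [Field F] (q : F) {N : ℕ} {A : Type} [Ring A] [Algebra F A]
    (S : Matrix (Fin N) (Fin N) A) : Matrix (Fin N × Fin N) (Fin N × Fin N) A :=
  amp2 S * liftF F (Rct F q N) * amp1 S * liftF F (Rc F q N)

/-- The list of index pairs `(i,j)` in lexicographic order. -/
def lexPairs (N : ℕ) : List (Fin N × Fin N) :=
  (List.finRange N).flatMap fun i => (List.finRange N).map fun j => (i, j)

/-! The generic matrix of generators. -/

def Sfree (F : Type) [Field F] (N : ℕ) :
    Matrix (Fin N) (Fin N) (FreeAlgebra F (Fin N × Fin N)) :=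
  Matrix.of fun i j => FreeAlgebra.ι F (i, j)

/-- Defining relations: only the reflection equation. -/
inductive Rel0 (F : Type) [Field F] (q : F) (N : ℕ) :
    FreeAlgebra F (Fin N × Fin N) → FreeAlgebra F (Fin N × Fin N) → Prop
  | refl (p r : Fin N × Fin N) :
      Rel0 F q N (reflLHS F q (Sfree F N) p r) (reflRHS F q (Sfree F N) p r)

/-- The algebra with generators `s_ij` and the reflection equation as defining relations. -/
abbrev Alg0 (F : Type) [Field F] (q : F) (N : ℕ) := RingQuot (Rel0 F q N)

def s0 (F : Type) [Field F] (q : F) (N : ℕ) (i j : Fin N) : Alg0 F q N :=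
  RingQuot.mkAlgHom F (Rel0 F q N) (FreeAlgebra.ι F (i, j))

/-- Defining relations of the presented algebra `𝒮` of the orthogonal case. -/
inductive OSRel (F : Type) [Field F] (q : F) (N : ℕ) :
    FreeAlgebra F (Fin N × Fin N) → FreeAlgebra F (Fin N × Fin N) → Prop
  | tri (i j : Fin N) (h : i < j) : OSRel F q N (FreeAlgebra.ι F (i, j)) 0
  | diag (i : Fin N) : OSRel F q N (FreeAlgebra.ι F (i, i)) 1
  | refl (p r : Fin N × Fin N) :
      OSRel F q N (reflLHS F q (Sfree F N) p r) (reflRHS F q (Sfree F N) p r)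

abbrev AlgOS (F : Type) [Field F] (q : F) (N : ℕ) := RingQuot (OSRel F q N)

def sOS (F : Type) [Field F] (q : F) (N : ℕ) (i j : Fin N) : AlgOS F q N :=
  RingQuot.mkAlgHom F (OSRel F q N) (FreeAlgebra.ι F (i, j))

/-! The quantized enveloping algebra `U_q(gl_N)` by its RTT presentation. -/

abbrev GlGen (N : ℕ) := (Fin N × Fin N) ⊕ (Fin N × Fin N)

def Tfree (F : Type) [Field F] (N : ℕ) :
    Matrix (Fin N) (Fin N) (FreeAlgebra F (GlGen N)) :=
  Matrix.of fun i j => FreeAlgebra.ι F (Sum.inl (i, j))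

def Tbfree (F : Type) [Field F] (N : ℕ) :
    Matrix (Fin N) (Fin N) (FreeAlgebra F (GlGen N)) :=
  Matrix.of fun i j => FreeAlgebra.ι F (Sum.inr (i, j))

/-- `R X₁ Y₂` -/
def rttLHS (F : Type) [Field F] (q : F) {N : ℕ} {A : Type} [Ring A] [Algebra F A]
    (X Y : Matrix (Fin N) (Fin N) A) : Matrix (Fin N × Fin N) (Fin N × Fin N) A :=
  liftF F (Rc F q N) * amp1 X * amp2 Y

/-- `Y₂ X₁ R` -/
def rttRHS (F : Type) [Field F] (q : F) {N : ℕ} {A : Type} [Ring A] [Algebra F A]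
    (X Y : Matrix (Fin N) (Fin N) A) : Matrix (Fin N × Fin N) (Fin N × Fin N) A :=
  amp2 Y * amp1 X * liftF F (Rc F q N)

inductive GlRel (F : Type) [Field F] (q : F) (N : ℕ) :
    FreeAlgebra F (GlGen N) → FreeAlgebra F (GlGen N) → Prop
  | t_zero (i j : Fin N) (h : i < j) : GlRel F q N (Tfree F N i j) 0
  | tb_zero (i j : Fin N) (h : j < i) : GlRel F q N (Tbfree F N i j) 0
  | t_tb (i : Fin N) : GlRel F q N (Tfree F N i i * Tbfree F N i i) 1
  | tb_t (i : Fin N) : GlRel F q N (Tbfree F N i i * Tfree F N i i) 1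
  | rtt (p r : Fin N × Fin N) :
      GlRel F q N (rttLHS F q (Tfree F N) (Tfree F N) p r)
        (rttRHS F q (Tfree F N) (Tfree F N) p r)
  | rtbtb (p r : Fin N × Fin N) :
      GlRel F q N (rttLHS F q (Tbfree F N) (Tbfree F N) p r)
        (rttRHS F q (Tbfree F N) (Tbfree F N) p r)
  | rtbt (p r : Fin N × Fin N) :
      GlRel F q N (rttLHS F q (Tbfree F N) (Tfree F N) p r)
        (rttRHS F q (Tbfree F N) (Tfree F N) p r)

/-- The quantized enveloping algebra `U_q(gl_N)`. -/
abbrev UqGl (F : Type) [Field F] (q : F) (N : ℕ) := RingQuot (GlRel F q N)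

def tE (F : Type) [Field F] (q : F) (N : ℕ) (i j : Fin N) : UqGl F q N :=
  RingQuot.mkAlgHom F (GlRel F q N) (FreeAlgebra.ι F (Sum.inl (i, j)))

def tbE (F : Type) [Field F] (q : F) (N : ℕ) (i j : Fin N) : UqGl F q N :=
  RingQuot.mkAlgHom F (GlRel F q N) (FreeAlgebra.ι F (Sum.inr (i, j)))

/-- The entries `s_ij = Σ_a t_ia t̄_ja` of `S = T T̄ᵗ`. -/
def sE (F : Type) [Field F] (q : F) (N : ℕ) (i j : Fin N) : UqGl F q N :=
  ∑ a : Fin N, tE F q N i a * tbE F q N j a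

/-- The twisted quantized enveloping algebra `U^tw_q(o_N)` as a subalgebra of `U_q(gl_N)`. -/
def UtwO (F : Type) [Field F] (q : F) (N : ℕ) : Subalgebra F (UqGl F q N) :=
  Algebra.adjoin F {x | ∃ i j, x = sE F q N i j}

/-! Symplectic (finite) case. -/

/-- `2k` as an element of `Fin (2n)` (the 0-based version of the odd index `2k-1`). -/
def fe (n : ℕ) (k : Fin n) : Fin (2 * n) := ⟨2 * k.val, by have := k.isLt; omega⟩

/-- `2k+1` as an element of `Fin (2n)` (the 0-based version of the even index `2k`). -/
def fo (n : ℕ) (k : Fin n) : Fin (2 * n) := ⟨2 * k.val + 1, by have := k.isLt; omega⟩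

/-- The entries `s_ij` of `S = T G T̄ᵗ` in `U_q(gl_2n)`. -/
def sSp (F : Type) [Field F] (q : F) (n : ℕ) (i j : Fin (2 * n)) : UqGl F q (2 * n) :=
  algebraMap F _ q * ∑ a : Fin n, tE F q (2 * n) i (fe n a) * tbE F q (2 * n) j (fo n a)
    - ∑ a : Fin n, tE F q (2 * n) i (fo n a) * tbE F q (2 * n) j (fe n a)

abbrev SpGen (n : ℕ) := (Fin (2 * n) × Fin (2 * n)) ⊕ Fin n

def SpFreeS (F : Type) [Field F] (n : ℕ) :
    Matrix (Fin (2 * n)) (Fin (2 * n)) (FreeAlgebra F (SpGen n)) :=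
  Matrix.of fun i j => FreeAlgebra.ι F (Sum.inl (i, j))

/-- Defining relations of the presented algebra `𝒮` of the symplectic case. -/
inductive SpRel (F : Type) [Field F] (q : F) (n : ℕ) :
    FreeAlgebra F (SpGen n) → FreeAlgebra F (SpGen n) → Prop
  | tri (i j : Fin (2 * n)) (h : i < j) (h' : ¬(i.val % 2 = 0 ∧ j.val = i.val + 1)) :
      SpRel F q n (FreeAlgebra.ι F (Sum.inl (i, j))) 0
  | quad (k : Fin n) :
      SpRel F q n
        (FreeAlgebra.ι F (Sum.inl (fo n k, fo n k)) * FreeAlgebra.ι F (Sum.inl (fe n k, fe n k)))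
        (algebraMap F _ (q ^ 2) *
            (FreeAlgebra.ι F (Sum.inl (fo n k, fe n k)) *
              FreeAlgebra.ι F (Sum.inl (fe n k, fo n k)))
          + algebraMap F _ (q ^ 3))
  | invR (k : Fin n) :
      SpRel F q n
        (FreeAlgebra.ι F (Sum.inl (fe n k, fo n k)) * FreeAlgebra.ι F (Sum.inr k)) 1
  | invL (k : Fin n) :
      SpRel F q n
        (FreeAlgebra.ι F (Sum.inr k) * FreeAlgebra.ι F (Sum.inl (fe n k, fo n k))) 1
  | refl (p r : Fin (2 * n) × Fin (2 * n)) :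
      SpRel F q n (reflLHS F q (SpFreeS F n) p r) (reflRHS F q (SpFreeS F n) p r)

abbrev AlgSp (F : Type) [Field F] (q : F) (n : ℕ) := RingQuot (SpRel F q n)

def sSpP (F : Type) [Field F] (q : F) (n : ℕ) (i j : Fin (2 * n)) : AlgSp F q n :=
  RingQuot.mkAlgHom F (SpRel F q n) (FreeAlgebra.ι F (Sum.inl (i, j)))

def sInvP (F : Type) [Field F] (q : F) (n : ℕ) (k : Fin n) : AlgSp F q n :=
  RingQuot.mkAlgHom F (SpRel F q n) (FreeAlgebra.ι F (Sum.inr k))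

/-- row `i = 2k` of the symplectic ordered monomial: positions `(i,0),…,(i,2k)`. -/
def rowA (n : ℕ) (k : Fin n) : List (Fin (2 * n) × Fin (2 * n)) :=
  ((List.finRange (2 * n)).filter fun j => j.val ≤ 2 * k.val).map fun j => (fe n k, j)

/-- row `i' = 2k+1` of the symplectic ordered monomial: positions `(i',0),…,(i',2k-1)`. -/
def rowB (n : ℕ) (k : Fin n) : List (Fin (2 * n) × Fin (2 * n)) :=
  ((List.finRange (2 * n)).filter fun j => j.val + 2 ≤ 2 * k.val + 1).map fun j => (fo n k, j)

/-- The ordered monomials of the symplectic case, with an arbitrary integer exponent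
on each `s_{i i'}` and nonnegative exponents elsewhere. -/
def monomSp {A : Type} [Ring A] (n : ℕ) (s : Fin (2 * n) × Fin (2 * n) → A) (sI : Fin n → A)
    (kN : Fin (2 * n) × Fin (2 * n) → ℕ) (kZ : Fin n → ℤ) : A :=
  ((List.finRange n).map fun k =>
    ((rowA n k).map fun p => s p ^ kN p).prod *
      (if 0 ≤ kZ k then s (fe n k, fo n k) ^ (kZ k).toNat else sI k ^ (-(kZ k)).toNat) *
      s (fo n k, fo n k) ^ kN (fo n k, fo n k) *
      ((rowB n k).map fun p => s p ^ kN p).prod).prod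

/-! Affine (twisted q-Yangian) machinery.  Series are treated coefficientwise. -/

/-- `z1 S r` is the coefficient matrix (in the first copy) of a series indexed by
nonnegative integers, extended by zero to `ℤ`. -/
def z1 {A : Type} [Ring A] {N : ℕ} (S : ℕ → Matrix (Fin N) (Fin N) A) (r : ℤ) :
    Matrix (Fin N × Fin N) (Fin N × Fin N) A :=
  if 0 ≤ r then amp1 (S r.toNat) else 0

def z2 {A : Type} [Ring A] {N : ℕ} (S : ℕ → Matrix (Fin N) (Fin N) A) (r : ℤ) :
    Matrix (Fin N × Fin N) (Fin N × Fin N) A :=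
  if 0 ≤ r then amp2 (S r.toNat) else 0

/-- Coefficient of `u^a v^b` in `R(u,v) S₁(u) Rᵗ(u⁻¹,v) S₂(v)`,
using `R(u,v) = u R̃ - v R` and `Rᵗ(u⁻¹,v) = u⁻¹ R̃ᵗ - v Rᵗ`. -/
def affLHS (F : Type) [Field F] (q : F) {N : ℕ} {A : Type} [Ring A] [Algebra F A]
    (S : ℕ → Matrix (Fin N) (Fin N) A) (a b : ℤ) :
    Matrix (Fin N × Fin N) (Fin N × Fin N) A :=
  liftF F (Rtil F q N) * z1 S (-a) * liftF F (Rtilt F q N) * z2 S (-b)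
    - liftF F (Rtil F q N) * z1 S (1 - a) * liftF F (Rct F q N) * z2 S (1 - b)
    - liftF F (Rc F q N) * z1 S (-1 - a) * liftF F (Rtilt F q N) * z2 S (1 - b)
    + liftF F (Rc F q N) * z1 S (-a) * liftF F (Rct F q N) * z2 S (2 - b)

/-- Coefficient of `u^a v^b` in `S₂(v) Rᵗ(u⁻¹,v) S₁(u) R(u,v)`. -/
def affRHS (F : Type) [Field F] (q : F) {N : ℕ} {A : Type} [Ring A] [Algebra F A]
    (S : ℕ → Matrix (Fin N) (Fin N) A) (a b : ℤ) :
    Matrix (Fin N × Fin N) (Fin N × Fin N) A :=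
  z2 S (-b) * liftF F (Rtilt F q N) * z1 S (-a) * liftF F (Rtil F q N)
    - z2 S (1 - b) * liftF F (Rtilt F q N) * z1 S (-1 - a) * liftF F (Rc F q N)
    - z2 S (1 - b) * liftF F (Rct F q N) * z1 S (1 - a) * liftF F (Rtil F q N)
    + z2 S (2 - b) * liftF F (Rct F q N) * z1 S (-a) * liftF F (Rc F q N)

def SfreeA (F : Type) [Field F] (N : ℕ) (r : ℕ) :
    Matrix (Fin N) (Fin N) (FreeAlgebra F (ℕ × Fin N × Fin N)) :=
  Matrix.of fun i j => FreeAlgebra.ι F (r, i, j)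

/-- Defining relations: only the affine reflection equation (coefficientwise). -/
inductive Rel9 (F : Type) [Field F] (q : F) (N : ℕ) :
    FreeAlgebra F (ℕ × Fin N × Fin N) → FreeAlgebra F (ℕ × Fin N × Fin N) → Prop
  | refl (a b : ℤ) (p r : Fin N × Fin N) :
      Rel9 F q N (affLHS F q (SfreeA F N) a b p r) (affRHS F q (SfreeA F N) a b p r)

abbrev Alg9 (F : Type) [Field F] (q : F) (N : ℕ) := RingQuot (Rel9 F q N)

def s9 (F : Type) [Field F] (q : F) (N : ℕ) (r : ℕ) (i j : Fin N) : Alg9 F q N :=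
  RingQuot.mkAlgHom F (Rel9 F q N) (FreeAlgebra.ι F (r, i, j))

/-- Defining relations of the presented twisted q-Yangian (orthogonal case). -/
inductive AORel (F : Type) [Field F] (q : F) (N : ℕ) :
    FreeAlgebra F (ℕ × Fin N × Fin N) → FreeAlgebra F (ℕ × Fin N × Fin N) → Prop
  | tri (i j : Fin N) (h : i < j) : AORel F q N (FreeAlgebra.ι F (0, i, j)) 0
  | diag (i : Fin N) : AORel F q N (FreeAlgebra.ι F (0, i, i)) 1
  | refl (a b : ℤ) (p r : Fin N × Fin N) :
      AORel F q N (affLHS F q (SfreeA F N) a b p r) (affRHS F q (SfreeA F N) a b p r)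

abbrev AlgAO (F : Type) [Field F] (q : F) (N : ℕ) := RingQuot (AORel F q N)

def sAO (F : Type) [Field F] (q : F) (N : ℕ) (r : ℕ) (i j : Fin N) : AlgAO F q N :=
  RingQuot.mkAlgHom F (AORel F q N) (FreeAlgebra.ι F (r, i, j))

/-- Lexicographic (non-strict) comparison of triples. -/
def tripLe (x y : ℕ × ℕ × ℕ) : Prop :=
  x.1 < y.1 ∨ (x.1 = y.1 ∧ (x.2.1 < y.2.1 ∨ (x.2.1 = y.2.1 ∧ x.2.2 ≤ y.2.2)))

/-- A list of generator indices `(r,i,j)` is ordered if it is weakly increasing with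
respect to the lexicographic order on `(r,i,j)`. -/
def sortedGens {N : ℕ} (l : List (ℕ × Fin N × Fin N)) : Prop :=
  l.Chain' fun x y => tripLe (x.1, x.2.1.val, x.2.2.val) (y.1, y.2.1.val, y.2.2.val)

/-! The quantum affine algebra `U_q(ĝl_N)` by its RTT presentation, coefficientwise. -/

abbrev AffGen (N : ℕ) := (ℕ × Fin N × Fin N) ⊕ (ℕ × Fin N × Fin N)

def TfA (F : Type) [Field F] (N : ℕ) (r : ℕ) :
    Matrix (Fin N) (Fin N) (FreeAlgebra F (AffGen N)) :=
  Matrix.of fun i j => FreeAlgebra.ι F (Sum.inl (r, i, j))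

def TbfA (F : Type) [Field F] (N : ℕ) (r : ℕ) :
    Matrix (Fin N) (Fin N) (FreeAlgebra F (AffGen N)) :=
  Matrix.of fun i j => FreeAlgebra.ι F (Sum.inr (r, i, j))

/-- Coefficient of `u^a v^b` in `R(u,v) X₁ Y₂` with prescribed coefficient extractions. -/
def affRttL (F : Type) [Field F] (q : F) {N : ℕ} {A : Type} [Ring A] [Algebra F A]
    (X Y : ℕ → Matrix (Fin N) (Fin N) A) (a b a' b' : ℤ) :
    Matrix (Fin N × Fin N) (Fin N × Fin N) A :=
  liftF F (Rtil F q N) * z1 X a * z2 Y b - liftF F (Rc F q N) * z1 X a' * z2 Y b'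

def affRttR (F : Type) [Field F] (q : F) {N : ℕ} {A : Type} [Ring A] [Algebra F A]
    (X Y : ℕ → Matrix (Fin N) (Fin N) A) (a b a' b' : ℤ) :
    Matrix (Fin N × Fin N) (Fin N × Fin N) A :=
  z2 Y b * z1 X a * liftF F (Rtil F q N) - z2 Y b' * z1 X a' * liftF F (Rc F q N)

inductive AffGlRel (F : Type) [Field F] (q : F) (N : ℕ) :
    FreeAlgebra F (AffGen N) → FreeAlgebra F (AffGen N) → Prop
  | t0_tri (i j : Fin N) (h : i < j) : AffGlRel F q N (TfA F N 0 i j) 0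
  | tb0_tri (i j : Fin N) (h : j < i) : AffGlRel F q N (TbfA F N 0 i j) 0
  | t_tb (i : Fin N) : AffGlRel F q N (TfA F N 0 i i * TbfA F N 0 i i) 1
  | tb_t (i : Fin N) : AffGlRel F q N (TbfA F N 0 i i * TfA F N 0 i i) 1
  | rtt (a b : ℤ) (p r : Fin N × Fin N) :
      AffGlRel F q N
        (affRttL F q (TfA F N) (TfA F N) (1 - a) (-b) (-a) (1 - b) p r)
        (affRttR F q (TfA F N) (TfA F N) (1 - a) (-b) (-a) (1 - b) p r)
  | rtbtb (a b : ℤ) (p r : Fin N × Fin N) :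
      AffGlRel F q N
        (affRttL F q (TbfA F N) (TbfA F N) (a - 1) b a (b - 1) p r)
        (affRttR F q (TbfA F N) (TbfA F N) (a - 1) b a (b - 1) p r)
  | rtbt (a b : ℤ) (p r : Fin N × Fin N) :
      AffGlRel F q N
        (affRttL F q (TbfA F N) (TfA F N) (a - 1) (-b) a (1 - b) p r)
        (affRttR F q (TbfA F N) (TfA F N) (a - 1) (-b) a (1 - b) p r)

/-- The quantum affine algebra `U_q(ĝl_N)`. -/
abbrev UqAff (F : Type) [Field F] (q : F) (N : ℕ) := RingQuot (AffGlRel F q N)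

def tA (F : Type) [Field F] (q : F) (N : ℕ) (r : ℕ) (i j : Fin N) : UqAff F q N :=
  RingQuot.mkAlgHom F (AffGlRel F q N) (FreeAlgebra.ι F (Sum.inl (r, i, j)))

def tbA (F : Type) [Field F] (q : F) (N : ℕ) (r : ℕ) (i j : Fin N) : UqAff F q N :=
  RingQuot.mkAlgHom F (AffGlRel F q N) (FreeAlgebra.ι F (Sum.inr (r, i, j)))

/-- Coefficient of `u^{-r}` in `s_ij(u) = Σ_a t_ia(u) t̄_ja(u⁻¹)`. -/
def Scoef (F : Type) [Field F] (q : F) (N : ℕ) (r : ℕ) (i j : Fin N) : UqAff F q N :=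
  ∑ a : Fin N, ∑ p ∈ Finset.range (r + 1), tA F q N p i a * tbA F q N (r - p) j a

/-- The twisted q-Yangian `Y^tw_q(o_N)` as a subalgebra of `U_q(ĝl_N)`. -/
def YtwO (F : Type) [Field F] (q : F) (N : ℕ) : Subalgebra F (UqAff F q N) :=
  Algebra.adjoin F {x | ∃ r i j, x = Scoef F q N r i j}

/-- Coefficient of `u^{-r}` in `s_ij(u)`, the `(i,j)` entry of `S(u) = T(u) G T̄(u⁻¹)ᵗ`
in the symplectic case. -/
def ScoefSp (F : Type) [Field F] (q : F) (n : ℕ) (r : ℕ) (i j : Fin (2 * n)) :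
    UqAff F q (2 * n) :=
  ∑ a : Fin n, ∑ p ∈ Finset.range (r + 1),
    (algebraMap F _ q * (tA F q (2 * n) p i (fe n a) * tbA F q (2 * n) (r - p) j (fo n a))
      - tA F q (2 * n) p i (fo n a) * tbA F q (2 * n) (r - p) j (fe n a))

/-- The twisted q-Yangian `Y^tw_q(sp_2n)` as a subalgebra of `U_q(ĝl_2n)`,
with a prescribed family of inverses of `s^{(0)}_{ii'}`. -/
def YtwSp (F : Type) [Field F] (q : F) (n : ℕ) (inv : Fin n → UqAff F q (2 * n)) :
    Subalgebra F (UqAff F q (2 * n)) :=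
  Algebra.adjoin F ({x | ∃ r i j, x = ScoefSp F q n r i j} ∪ Set.range inv)

abbrev ASpGen (n : ℕ) := (ℕ × Fin (2 * n) × Fin (2 * n)) ⊕ Fin n

def SfreeASp (F : Type) [Field F] (n : ℕ) (r : ℕ) :
    Matrix (Fin (2 * n)) (Fin (2 * n)) (FreeAlgebra F (ASpGen n)) :=
  Matrix.of fun i j => FreeAlgebra.ι F (Sum.inl (r, i, j))

/-- Defining relations of the presented twisted q-Yangian (symplectic case). -/
inductive ASpRel (F : Type) [Field F] (q : F) (n : ℕ) :
    FreeAlgebra F (ASpGen n) → FreeAlgebra F (ASpGen n) → Prop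
  | tri (i j : Fin (2 * n)) (h : i < j) (h' : ¬(i.val % 2 = 0 ∧ j.val = i.val + 1)) :
      ASpRel F q n (FreeAlgebra.ι F (Sum.inl (0, i, j))) 0
  | quad (k : Fin n) :
      ASpRel F q n
        (FreeAlgebra.ι F (Sum.inl (0, fo n k, fo n k)) *
          FreeAlgebra.ι F (Sum.inl (0, fe n k, fe n k)))
        (algebraMap F _ (q ^ 2) *
            (FreeAlgebra.ι F (Sum.inl (0, fo n k, fe n k)) *
              FreeAlgebra.ι F (Sum.inl (0, fe n k, fo n k)))
          + algebraMap F _ (q ^ 3))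
  | invR (k : Fin n) :
      ASpRel F q n
        (FreeAlgebra.ι F (Sum.inl (0, fe n k, fo n k)) * FreeAlgebra.ι F (Sum.inr k)) 1
  | invL (k : Fin n) :
      ASpRel F q n
        (FreeAlgebra.ι F (Sum.inr k) * FreeAlgebra.ι F (Sum.inl (0, fe n k, fo n k))) 1
  | refl (a b : ℤ) (p r : Fin (2 * n) × Fin (2 * n)) :
      ASpRel F q n (affLHS F q (SfreeASp F n) a b p r) (affRHS F q (SfreeASp F n) a b p r)

abbrev AlgASp (F : Type) [Field F] (q : F) (n : ℕ) := RingQuot (ASpRel F q n)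

def sASp (F : Type) [Field F] (q : F) (n : ℕ) (r : ℕ) (i j : Fin (2 * n)) : AlgASp F q n :=
  RingQuot.mkAlgHom F (ASpRel F q n) (FreeAlgebra.ι F (Sum.inl (r, i, j)))

def sInvASp (F : Type) [Field F] (q : F) (n : ℕ) (k : Fin n) : AlgASp F q n :=
  RingQuot.mkAlgHom F (ASpRel F q n) (FreeAlgebra.ι F (Sum.inr k))

/-! q-antisymmetrizer and Sklyanin/quantum determinant machinery. -/

/-- The trigonometric R-matrix `R(u,v)`. -/
def Rtrig (F : Type) [Field F] (q : F) (N : ℕ) (u v : F) :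
    Matrix (Fin N × Fin N) (Fin N × Fin N) F := Matrix.of fun p r =>
  (if p = r then (if p.1 = p.2 then q⁻¹ * u - q * v else u - v) else 0)
  + (if p.1 = r.2 ∧ p.2 = r.1 ∧ p.1 ≠ p.2 then
      (q⁻¹ - q) * (if p.2 < p.1 then u else v) else 0)

/-- An operator on `ℂ^N ⊗ ℂ^N` acting in the `i`-th and `j`-th factors of `(ℂ^N)^{⊗ r}`. -/
def big2 (F : Type) [Field F] {N r : ℕ} (i j : Fin r)
    (M : Matrix (Fin N × Fin N) (Fin N × Fin N) F) :
    Matrix (Fin r → Fin N) (Fin r → Fin N) F :=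
  Matrix.of fun f g =>
    if ∀ k, k ≠ i → k ≠ j → f k = g k then M (f i, f j) (g i, g j) else 0

/-- The list of the pairs `(i,j)`, `i < j`, in lexicographic order. -/
def pairsLex (r : ℕ) : List (Fin r × Fin r) :=
  (List.finRange r).flatMap fun i =>
    ((List.finRange r).filter fun j => i < j).map fun j => (i, j)

/-- The number of inversions (the Coxeter length) of a permutation. -/
def invCount {r : ℕ} (σ : Equiv.Perm (Fin r)) : ℕ :=
  (Finset.univ.filter fun p : Fin r × Fin r => p.1 < p.2 ∧ σ p.2 < σ p.1).card

/-- The q-permutation operator `P^q` on `ℂ^N ⊗ ℂ^N`. -/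
def PqSmall (F : Type) [Field F] (q : F) (N : ℕ) :
    Matrix (Fin N × Fin N) (Fin N × Fin N) F := Matrix.of fun p r =>
  if r.1 = p.2 ∧ r.2 = p.1 then (if p.1 = p.2 then 1 else if p.2 < p.1 then q else q⁻¹)
  else 0

/-- The hypothesis that `Pq` is the extension of the q-permutation operators along
reduced decompositions: `P^q_{σ s_i} = P^q_σ P^q_{s_i}` whenever the length grows. -/
def PqExt (F : Type) [Field F] (q : F) (N r : ℕ)
    (Pq : Equiv.Perm (Fin r) → Matrix (Fin r → Fin N) (Fin r → Fin N) F) : Prop :=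
  Pq 1 = 1 ∧
    ∀ (σ : Equiv.Perm (Fin r)) (i : ℕ) (h : i + 1 < r),
      invCount (σ * Equiv.swap ⟨i, Nat.lt_of_succ_lt h⟩ ⟨i + 1, h⟩) = invCount σ + 1 →
        Pq (σ * Equiv.swap ⟨i, Nat.lt_of_succ_lt h⟩ ⟨i + 1, h⟩) =
          Pq σ * big2 F ⟨i, Nat.lt_of_succ_lt h⟩ ⟨i + 1, h⟩ (PqSmall F q N)

/-- The q-antisymmetrizer `A^q_r = Σ_σ sgn(σ) P^q_σ`. -/
def AqM (F : Type) [Field F] {N r : ℕ}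
    (Pq : Equiv.Perm (Fin r) → Matrix (Fin r → Fin N) (Fin r → Fin N) F) :
    Matrix (Fin r → Fin N) (Fin r → Fin N) F :=
  ∑ σ : Equiv.Perm (Fin r), ((Equiv.Perm.sign σ : ℤ) : F) • Pq σ

/-- A matrix acting in the `k`-th factor of `(ℂ^N)^{⊗ N}`, with entries in `A`. -/
def ampAt {A : Type} [Ring A] {N : ℕ} (k : Fin N) (M : Matrix (Fin N) (Fin N) A) :
    Matrix (Fin N → Fin N) (Fin N → Fin N) A :=
  Matrix.of fun f g => if ∀ l, l ≠ k → f l = g l then M (f k) (g k) else 0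

/-- A scalar two-site operator viewed over `A`, acting at sites `i`, `j`. -/
def big2A (F : Type) [Field F] {A : Type} [Ring A] [Algebra F A] {N : ℕ} (i j : Fin N)
    (M : Matrix (Fin N × Fin N) (Fin N × Fin N) F) :
    Matrix (Fin N → Fin N) (Fin N → Fin N) A :=
  (big2 F i j M).map (algebraMap F A)

/-- Coefficient of `u^m` in a product of formal series, each of which is supported in
degrees `≤ 1`; the series are given by their coefficient functions `ℤ → M`. -/
def seriesProdCoeff {M : Type} [Ring M] : List (ℤ → M) → ℤ → M
  | [], m => if m = 0 then 1 else 0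
  | c :: t, m => ∑ k ∈ Finset.Icc (m - t.length) 1, c k * seriesProdCoeff t (m - k)

/-! Series factors entering the Sklyanin determinant. -/

/-- The matrix `S^{(r)}` of the coefficients of `S(u)` (orthogonal case). -/
def SmatA (F : Type) [Field F] (q : F) (N : ℕ) (r : ℕ) :
    Matrix (Fin N) (Fin N) (UqAff F q N) :=
  Matrix.of fun i j => Scoef F q N r i j

/-- The series `S_k(q^{-2k+2} u)` acting at site `k` (0-based `k`), coefficientwise. -/
def SfacO (F : Type) [Field F] (q : F) (N : ℕ) (k : Fin N) (m : ℤ) :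
    Matrix (Fin N → Fin N) (Fin N → Fin N) (UqAff F q N) :=
  if m ≤ 0 then q ^ (2 * (k.val : ℤ) * (-m)) • ampAt k (SmatA F q N (-m).toNat) else 0

/-- The series `R_{ij}ᵗ((q^{-2i+2}u)⁻¹, q^{-2j+2}u)` (0-based `i`, `j`), coefficientwise. -/
def RtfacO (F : Type) [Field F] (q : F) (N : ℕ) (i j : Fin N) (m : ℤ) :
    Matrix (Fin N → Fin N) (Fin N → Fin N) (UqAff F q N) :=
  if m = -1 then q ^ (2 * (i.val : ℤ)) • big2A F i j (Rtilt F q N)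
  else if m = 1 then (-(q ^ (-2 * (j.val : ℤ)))) • big2A F i j (Rct F q N)
  else 0

/-- The ordered list of factors `S₁(u) R₁₂ᵗ ⋯ R₁Nᵗ S₂(q⁻²u) ⋯ S_N(q^{-2N+2}u)`. -/
def sdetFacsO (F : Type) [Field F] (q : F) (N : ℕ) :
    List (ℤ → Matrix (Fin N → Fin N) (Fin N → Fin N) (UqAff F q N)) :=
  (List.finRange N).flatMap fun i =>
    SfacO F q N i :: (((List.finRange N).filter fun j => i < j).map fun j => RtfacO F q N i j)

/-- The matrix `S^{(r)}` of the coefficients of `S(u)` (symplectic case). -/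
def SmatASp (F : Type) [Field F] (q : F) (n : ℕ) (r : ℕ) :
    Matrix (Fin (2 * n)) (Fin (2 * n)) (UqAff F q (2 * n)) :=
  Matrix.of fun i j => ScoefSp F q n r i j

def SfacSp (F : Type) [Field F] (q : F) (n : ℕ) (k : Fin (2 * n)) (m : ℤ) :
    Matrix (Fin (2 * n) → Fin (2 * n)) (Fin (2 * n) → Fin (2 * n)) (UqAff F q (2 * n)) :=
  if m ≤ 0 then q ^ (2 * (k.val : ℤ) * (-m)) • ampAt k (SmatASp F q n (-m).toNat) else 0

def sdetFacsSp (F : Type) [Field F] (q : F) (n : ℕ) :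
    List (ℤ → Matrix (Fin (2 * n) → Fin (2 * n)) (Fin (2 * n) → Fin (2 * n))
      (UqAff F q (2 * n))) :=
  (List.finRange (2 * n)).flatMap fun i =>
    SfacSp F q n i ::
      (((List.finRange (2 * n)).filter fun j => i < j).map fun j => RtfacO F q (2 * n) i j)

/-- Coefficientwise quantum determinant `qdet T(u)`:
the coefficient of `u^m` (nonzero only for `m ≤ 0`). -/
def qdetTc (F : Type) [Field F] (q : F) (N : ℕ) (m : ℤ) : UqAff F q N :=
  if m ≤ 0 then
    ∑ σ : Equiv.Perm (Fin N), ∑ rv ∈ Finset.Nat.antidiagonalTuple N (-m).toNat,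
      (((-q)⁻¹ ^ invCount σ) * ∏ k : Fin N, q ^ (2 * (k.val : ℤ) * (rv k : ℤ))) •
        ((List.finRange N).map fun k => tA F q N (rv k) (σ k) k).prod
  else 0

/-- Coefficientwise quantum determinant `qdet T̄(q^{2N-2} u⁻¹)`:
the coefficient of `u^m` (nonzero only for `m ≤ 0`). -/
def qdetTbc (F : Type) [Field F] (q : F) (N : ℕ) (m : ℤ) : UqAff F q N :=
  if m ≤ 0 then
    ∑ σ : Equiv.Perm (Fin N), ∑ rv ∈ Finset.Nat.antidiagonalTuple N (-m).toNat,
      (((-q)⁻¹ ^ invCount σ) *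
          ∏ k : Fin N, q ^ ((2 * (N : ℤ) - 2 - 2 * (k.val : ℤ)) * (rv k : ℤ))) •
        ((List.finRange N).map fun k => tbA F q N (rv k) (σ k) k).prod
  else 0

/-- The linear factor `q^{2i-2}u⁻¹ - q^{-2j+2}u` of `γ_N(u)` (0-based `i`, `j`),
viewed as an `A`-valued series. -/
def gamFac (F : Type) [Field F] (q : F) (N : ℕ) (p : Fin N × Fin N) (m : ℤ) : UqAff F q N :=
  if m = -1 then algebraMap F _ (q ^ (2 * (p.1.val : ℤ)))
  else if m = 1 then algebraMap F _ (-(q ^ (-2 * (p.2.val : ℤ)))) else 0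

/-- The list of series whose product is `γ_N(u) qdet T(u) qdet T̄(q^{2N-2}u⁻¹)`
in the orthogonal case. -/
def rhsO (F : Type) [Field F] (q : F) (N : ℕ) : List (ℤ → UqAff F q N) :=
  ((pairsLex N).map fun p => gamFac F q N p) ++ [qdetTc F q N, qdetTbc F q N]

namespace TwistedYangian

section Collapse

variable {F : Type} [Field F] {N : ℕ}

/-- Diagonal coefficient of a constant R-matrix. -/
def dg (d : F) (i j : Fin N) : F := if i = j then d else 1

/-- Flip coefficient of `R`. -/
def wP (q : F) (i j : Fin N) : F := if i < j then q - q⁻¹ else 0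

/-- Flip coefficient of `R̃`. -/
def wM (q : F) (i j : Fin N) : F := if j < i then q⁻¹ - q else 0

/-- The matrix with diagonal coefficients `dg d` and flip coefficients `w`. -/
def Rg (d : F) (w : Fin N → Fin N → F) : Matrix (Fin N × Fin N) (Fin N × Fin N) F :=
  Matrix.of fun p r => (if p = r then dg d p.1 p.2 else 0) + (if p = r.swap then w p.1 p.2 else 0)

/-- The transpose of `Rg d w` in the first tensor factor. -/
def Rgt (d : F) (w : Fin N → Fin N → F) : Matrix (Fin N × Fin N) (Fin N × Fin N) F :=
  Matrix.of fun p r => Rg d w (r.1, p.2) (p.1, r.2)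

theorem Rc_eq (q : F) : Rc F q N = Rg q (wP q) := by
  ext ⟨i, j⟩ ⟨l, b⟩
  simp only [Rc, Rg, Matrix.of_apply, dg, wP, Prod.swap, Prod.mk.injEq, ← ite_and, and_assoc]

theorem Rtil_eq (q : F) : Rtil F q N = Rg q⁻¹ (wM q) := by
  ext ⟨i, j⟩ ⟨l, b⟩
  simp only [Rtil, Rg, Matrix.of_apply, dg, wM, Prod.swap, Prod.mk.injEq, ← ite_and, and_assoc]

theorem Rct_eq (q : F) : Rct F q N = Rgt q (wP q) := by
  simp only [Rct, Rgt, Rc_eq]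

theorem Rtilt_eq (q : F) : Rtilt F q N = Rgt q⁻¹ (wM q) := by
  simp only [Rtilt, Rgt, Rtil_eq]

variable {A : Type} [Ring A] [Algebra F A]

theorem liftF_Rg_mul (d : F) (w : Fin N → Fin N → F)
    (Y : Matrix (Fin N × Fin N) (Fin N × Fin N) A) (p r : Fin N × Fin N) :
    (liftF F (A := A) (Rg d w) * Y) p r = dg d p.1 p.2 • Y p r + w p.1 p.2 • Y p.swap r := by
  have h : ∀ x : Fin N × Fin N, (p = x.swap) = (p.swap = x) := fun x => by
    apply propext; constructor <;> rintro rfl <;> simp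
  simp only [Matrix.mul_apply, liftF, Matrix.map_apply, Rg, Matrix.of_apply, map_add, add_mul,
    Finset.sum_add_distrib, ← Algebra.smul_def, ite_smul, zero_smul, h,
    Finset.sum_ite_eq, Finset.mem_univ, if_true]

theorem mul_liftF_Rg (d : F) (w : Fin N → Fin N → F)
    (Y : Matrix (Fin N × Fin N) (Fin N × Fin N) A) (p r : Fin N × Fin N) :
    (Y * liftF F (A := A) (Rg d w)) p r = dg d r.1 r.2 • Y p r + w r.2 r.1 • Y p r.swap := by
  simp only [Matrix.mul_apply, liftF, Matrix.map_apply, Rg, Matrix.of_apply, map_add, mul_add,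
    Finset.sum_add_distrib, ← Algebra.commutes, ← Algebra.smul_def, ite_smul, zero_smul,
    Finset.sum_ite_eq', Finset.mem_univ, if_true, Prod.fst_swap, Prod.snd_swap]

theorem amp1_mul_apply (X : Matrix (Fin N) (Fin N) A)
    (Y : Matrix (Fin N × Fin N) (Fin N × Fin N) A) (i j : Fin N) (r : Fin N × Fin N) :
    (amp1 X * Y) (i, j) r = ∑ m, X i m * Y (m, j) r := by
  simp [Matrix.mul_apply, amp1, Fintype.sum_prod_type]

theorem amp2_mul_apply (X : Matrix (Fin N) (Fin N) A)
    (Y : Matrix (Fin N × Fin N) (Fin N × Fin N) A) (i j : Fin N) (r : Fin N × Fin N) :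
    (amp2 X * Y) (i, j) r = ∑ m, X j m * Y (i, m) r := by
  simp [Matrix.mul_apply, amp2, Fintype.sum_prod_type]

theorem mul_amp1_apply (X : Matrix (Fin N) (Fin N) A)
    (Y : Matrix (Fin N × Fin N) (Fin N × Fin N) A) (p : Fin N × Fin N) (l b : Fin N) :
    (Y * amp1 X) p (l, b) = ∑ m, Y p (m, b) * X m l := by
  simp [Matrix.mul_apply, amp1, Fintype.sum_prod_type]

theorem mul_amp2_apply (X : Matrix (Fin N) (Fin N) A)
    (Y : Matrix (Fin N × Fin N) (Fin N × Fin N) A) (p : Fin N × Fin N) (l b : Fin N) :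
    (Y * amp2 X) p (l, b) = ∑ m, Y p (l, m) * X m b := by
  simp [Matrix.mul_apply, amp2, Fintype.sum_prod_type]

theorem amp1_mul_amp2 (X Y : Matrix (Fin N) (Fin N) A) (i j l b : Fin N) :
    (amp1 X * amp2 Y) (i, j) (l, b) = X i l * Y j b := by
  simp [amp1_mul_apply, amp2]

theorem amp2_mul_amp1 (X Y : Matrix (Fin N) (Fin N) A) (i j l b : Fin N) :
    (amp2 Y * amp1 X) (i, j) (l, b) = Y j b * X i l := by
  simp [amp2_mul_apply, amp1]

theorem amp1_Rgt_amp2 (d : F) (w : Fin N → Fin N → F) (X Y : Matrix (Fin N) (Fin N) A)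
    (i j l b : Fin N) :
    (amp1 X * liftF F (A := A) (Rgt d w) * amp2 Y) (i, j) (l, b) =
      dg d l j • (X i l * Y j b) + w l j • (X i j * Y l b) := by
  have h : ∀ x y : Fin N, ((l, j) = ((x, y) : Fin N × Fin N).swap) = (y = l ∧ x = j) := by
    intro x y; simp [Prod.swap, eq_comm]
  simp only [mul_amp2_apply, amp1_mul_apply, liftF, Matrix.map_apply, Rgt, Rg, Matrix.of_apply, h]
  simp only [Prod.mk.injEq, Finset.sum_mul, map_add, add_mul, mul_add, Finset.sum_add_distrib,
    ite_and, apply_ite (algebraMap F A), map_zero, mul_ite, ite_mul, mul_zero, zero_mul]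
  simp [← Algebra.commutes, ← Algebra.smul_def]

theorem amp2_Rgt_amp1 (d : F) (w : Fin N → Fin N → F) (X Y : Matrix (Fin N) (Fin N) A)
    (i j l b : Fin N) :
    (amp2 Y * liftF F (A := A) (Rgt d w) * amp1 X) (i, j) (l, b) =
      dg d i b • (Y j b * X i l) + w b i • (Y j i * X b l) := by
  simp only [mul_amp1_apply, amp2_mul_apply, liftF, Matrix.map_apply, Rgt, Rg, Matrix.of_apply]
  simp only [Prod.mk.injEq, Finset.sum_mul, map_add, add_mul, mul_add, Finset.sum_add_distrib,
    ite_and, apply_ite (algebraMap F A), map_zero, mul_ite, ite_mul, mul_zero, zero_mul, Prod.swap]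
  simp [← Algebra.commutes, ← Algebra.smul_def, dg, eq_comm]

end Collapse

section FormMatrix

variable {F : Type} [Field F] {n : ℕ}

theorem fe_or_fo (i : Fin (2 * n)) : (∃ k, i = fe n k) ∨ ∃ k, i = fo n k := by
  have hi := i.isLt
  rcases Nat.even_or_odd' i.val with ⟨c, h | h⟩
  · exact Or.inl ⟨⟨c, by omega⟩, Fin.ext h⟩
  · exact Or.inr ⟨⟨c, by omega⟩, Fin.ext h⟩

theorem fe_inj {k m : Fin n} : fe n k = fe n m ↔ k = m := by
  simp only [fe, Fin.ext_iff]; omega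

theorem fo_inj {k m : Fin n} : fo n k = fo n m ↔ k = m := by
  simp only [fo, Fin.ext_iff]; omega

theorem fe_ne_fo (k m : Fin n) : fe n k ≠ fo n m := by
  simp only [fe, fo, ne_eq, Fin.ext_iff]; omega

theorem fo_ne_fe (k m : Fin n) : fo n k ≠ fe n m := (fe_ne_fo m k).symm

theorem fe_lt_fe {k m : Fin n} : fe n k < fe n m ↔ k < m := by
  simp only [fe, Fin.lt_def]; omega

theorem fo_lt_fo {k m : Fin n} : fo n k < fo n m ↔ k < m := by
  simp only [fo, Fin.lt_def]; omega

theorem fe_lt_fo {k m : Fin n} : fe n k < fo n m ↔ k ≤ m := by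
  simp only [fe, fo, Fin.lt_def, Fin.le_def]; omega

theorem fo_lt_fe {k m : Fin n} : fo n k < fe n m ↔ k < m := by
  simp only [fe, fo, Fin.lt_def]; omega

/-- The involution `i ↦ i'`. -/
def pr (i : Fin (2 * n)) : Fin (2 * n) :=
  if h : i.val % 2 = 0 then ⟨i.val + 1, by have := i.isLt; omega⟩
  else ⟨i.val - 1, by have := i.isLt; omega⟩

@[simp]
theorem pr_fe (k : Fin n) : pr (fe n k) = fo n k := by
  simp [pr, fe, fo]

@[simp]
theorem pr_fo (k : Fin n) : pr (fo n k) = fe n k := by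
  have h : (2 * k.val + 1) % 2 ≠ 0 := by omega
  simp [pr, fe, fo]

@[simp]
theorem pr_pr (i : Fin (2 * n)) : pr (pr i) = i := by
  rcases fe_or_fo i with ⟨k, rfl⟩ | ⟨k, rfl⟩ <;> simp

theorem pr_ne (i : Fin (2 * n)) : pr i ≠ i := by
  rcases fe_or_fo i with ⟨k, rfl⟩ | ⟨k, rfl⟩ <;> simp [fe_ne_fo, fo_ne_fe]

/-- The nonzero entry of `G` in row `i`. -/
def ge (q : F) (i : Fin (2 * n)) : F := if i.val % 2 = 0 then q else -1

@[simp]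
theorem ge_fe (q : F) (k : Fin n) : ge q (fe n k) = q := by simp [ge, fe]

@[simp]
theorem ge_fo (q : F) (k : Fin n) : ge q (fo n k) = -1 := by
  have h : (2 * k.val + 1) % 2 ≠ 0 := by omega
  simp [ge, fo]

/-- The matrix `G`. -/
def Gm (q : F) : Matrix (Fin (2 * n)) (Fin (2 * n)) F :=
  Matrix.of fun i j => if j = pr i then ge q i else 0

theorem Gm_apply (q : F) (i j : Fin (2 * n)) :
    Gm q i j = if j = pr i then ge q i else 0 := rfl

theorem pr_eq_comm {i j : Fin (2 * n)} : j = pr i ↔ i = pr j := by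
  constructor <;> rintro rfl <;> simp

/-- The diagonal and flip coefficients of `R` or of `R̃`. -/
def IsRPair (q d : F) (w : Fin (2 * n) → Fin (2 * n) → F) : Prop :=
  (d = q ∧ w = wP q) ∨ (d = q⁻¹ ∧ w = wM q)

theorem form_reflection_entry {q : F} (hq : q ≠ 0) {d d' : F}
    {w w' : Fin (2 * n) → Fin (2 * n) → F} (h : IsRPair q d w) (h' : IsRPair q d' w')
    (i j l b : Fin (2 * n)) :
    dg d i j * (dg d' l j * (Gm q i l * Gm q j b) + w' l j * (Gm q i j * Gm q l b))
      + w i j * (dg d' l i * (Gm q j l * Gm q i b) + w' l i * (Gm q j i * Gm q l b))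
    = dg d l b * (dg d' i b * (Gm q j b * Gm q i l) + w' b i * (Gm q j i * Gm q b l))
      + w b l * (dg d' i l * (Gm q j l * Gm q i b) + w' l i * (Gm q j i * Gm q l b)) := by
  simp only [Gm_apply]
  by_cases h1 : l = pr i ∧ b = pr j
  · obtain ⟨rfl, rfl⟩ := h1
    rcases h with ⟨rfl, rfl⟩ | ⟨rfl, rfl⟩ <;> rcases h' with ⟨rfl, rfl⟩ | ⟨rfl, rfl⟩ <;>
    rcases fe_or_fo i with ⟨k, rfl⟩ | ⟨k, rfl⟩ <;> rcases fe_or_fo j with ⟨m, rfl⟩ | ⟨m, rfl⟩ <;>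
    rcases lt_trichotomy k m with hkm | hkm | hkm <;>
    (try subst hkm) <;>
    (try have a1 := hkm.ne) <;> (try have a2 := hkm.ne') <;> (try have a3 := hkm.le) <;>
    (try have a4 := hkm.not_gt) <;> (try have a5 := hkm.not_ge) <;>
    simp [dg, wP, wM, fe_inj, fo_inj, fe_ne_fo, fo_ne_fe, fe_lt_fe, fo_lt_fo, fe_lt_fo,
      fo_lt_fe, *]
  · by_cases h2 : j = pr i ∧ b = pr l
    · obtain ⟨rfl, rfl⟩ := h2
      rcases h with ⟨rfl, rfl⟩ | ⟨rfl, rfl⟩ <;> rcases h' with ⟨rfl, rfl⟩ | ⟨rfl, rfl⟩ <;>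
      rcases fe_or_fo i with ⟨k, rfl⟩ | ⟨k, rfl⟩ <;> rcases fe_or_fo l with ⟨m, rfl⟩ | ⟨m, rfl⟩ <;>
      rcases lt_trichotomy k m with hkm | hkm | hkm <;>
      (try subst hkm) <;>
      (try have a1 := hkm.ne) <;> (try have a2 := hkm.ne') <;> (try have a3 := hkm.le) <;>
      (try have a4 := hkm.not_gt) <;> (try have a5 := hkm.not_ge) <;>
      simp [dg, wP, wM, fe_inj, fo_inj, fe_ne_fo, fo_ne_fe, fe_lt_fe, fo_lt_fo, fe_lt_fo,
        fo_lt_fe, *] <;> (try field_simp) <;> (try ring)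
    · by_cases h3 : l = pr j ∧ b = pr i
      · obtain ⟨rfl, rfl⟩ := h3
        rcases h with ⟨rfl, rfl⟩ | ⟨rfl, rfl⟩ <;> rcases h' with ⟨rfl, rfl⟩ | ⟨rfl, rfl⟩ <;>
        rcases fe_or_fo i with ⟨k, rfl⟩ | ⟨k, rfl⟩ <;>
        rcases fe_or_fo j with ⟨m, rfl⟩ | ⟨m, rfl⟩ <;>
        rcases lt_trichotomy k m with hkm | hkm | hkm <;>
        (try subst hkm) <;>
        (try have a1 := hkm.ne) <;> (try have a2 := hkm.ne') <;> (try have a3 := hkm.le) <;>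
        (try have a4 := hkm.not_gt) <;> (try have a5 := hkm.not_ge) <;>
        simp [dg, wP, wM, fe_inj, fo_inj, fe_ne_fo, fo_ne_fe, fe_lt_fe, fo_lt_fo, fe_lt_fo,
          fo_lt_fe, *] <;> (try field_simp) <;> (try ring)
      · have e1 : ∀ x y : F, (if l = pr i then x else 0) * (if b = pr j then y else 0) = 0 := by
          intro x y; split_ifs <;> simp_all
        have e2 : ∀ x y : F, (if j = pr i then x else 0) * (if b = pr l then y else 0) = 0 := by
          intro x y; split_ifs <;> simp_all
        have e3 : ∀ x y : F, (if l = pr j then x else 0) * (if b = pr i then y else 0) = 0 := by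
          intro x y; split_ifs <;> simp_all
        have e1' : ∀ x y : F, (if b = pr j then x else 0) * (if l = pr i then y else 0) = 0 := by
          intro x y; split_ifs <;> simp_all
        simp only [pr_eq_comm (i := j) (j := i), pr_eq_comm (i := b) (j := l), e1, e2, e3, e1',
          mul_zero, add_zero]

/-- The matrix `G` over an `F`-algebra. -/
def GA (q : F) (A : Type) [Ring A] [Algebra F A] : Matrix (Fin (2 * n)) (Fin (2 * n)) A :=
  (Gm q).map (algebraMap F A)

theorem form_reflection {A : Type} [Ring A] [Algebra F A] {q : F} (hq : q ≠ 0) {d d' : F}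
    {w w' : Fin (2 * n) → Fin (2 * n) → F} (h : IsRPair q d w) (h' : IsRPair q d' w') :
    liftF F (A := A) (Rg d w) * amp1 (GA q A) * liftF F (Rgt d' w') * amp2 (GA q A) =
      amp2 (GA q A) * liftF F (Rgt d' w') * amp1 (GA q A) * liftF F (Rg d w) := by
  ext ⟨i, j⟩ ⟨l, b⟩
  have e := congrArg (algebraMap F A) (form_reflection_entry hq h h' i j l b)
  rw [mul_assoc (liftF F (A := A) (Rg d w)), mul_assoc (liftF F (A := A) (Rg d w)),
    liftF_Rg_mul, mul_liftF_Rg]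
  simp only [Prod.swap, amp1_Rgt_amp2, amp2_Rgt_amp1]
  simp only [Algebra.smul_def, GA, Matrix.map_apply, ← map_mul, ← map_add]
  exact e

end FormMatrix

section YangBaxter

variable {F : Type} [Field F] {N : ℕ}

/-- Pairs consisting of diagonal and flip coefficients. -/
abbrev Co (F : Type) (N : ℕ) := (Fin N → Fin N → F) × (Fin N → Fin N → F)

/-- The matrix with prescribed diagonal and flip coefficients. -/
def coMat (v : Co F N) : Matrix (Fin N × Fin N) (Fin N × Fin N) F :=
  Matrix.of fun p r => (if p = r then v.1 p.1 p.2 else 0) + (if p = r.swap then v.2 p.1 p.2 else 0)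

def coR (q : F) : Co F N := (dg q, wP q)

def coRt (q : F) : Co F N := (dg q⁻¹, wM q)

/-- The operator with coefficients `v`, acting on functions of three indices in slots 1, 2. -/
def op12 (v : Co F N) (f : Fin N → Fin N → Fin N → F) (i j p : Fin N) : F :=
  v.1 i j * f i j p + v.2 i j * f j i p

def op13 (v : Co F N) (f : Fin N → Fin N → Fin N → F) (i j p : Fin N) : F :=
  v.1 i p * f i j p + v.2 i p * f p j i

def op23 (v : Co F N) (f : Fin N → Fin N → Fin N → F) (i j p : Fin N) : F :=
  v.1 j p * f i j p + v.2 j p * f i p j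

/-- The defect in the Yang–Baxter equation. -/
def ybd (m x y : Co F N) (f : Fin N → Fin N → Fin N → F) (i j p : Fin N) : F :=
  op12 m (op13 x (op23 y f)) i j p - op23 y (op13 x (op12 m f)) i j p

theorem ybd_sub_mid (m x x' y : Co F N) (f : Fin N → Fin N → Fin N → F) (i j p : Fin N) :
    ybd m (x - x') y f i j p = ybd m x y f i j p - ybd m x' y f i j p := by
  simp only [ybd, op12, op13, op23, Prod.fst_sub, Prod.snd_sub, Pi.sub_apply]; ring

theorem ybd_sub_right (m x y y' : Co F N) (f : Fin N → Fin N → Fin N → F) (i j p : Fin N) :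
    ybd m x (y - y') f i j p = ybd m x y f i j p - ybd m x y' f i j p := by
  simp only [ybd, op12, op13, op23, Prod.fst_sub, Prod.snd_sub, Pi.sub_apply]; ring

theorem forall_triple_of_order (P : Fin N → Fin N → Fin N → Prop)
    (h3 : ∀ a b c, a < b → b < c → a < c →
      P a b c ∧ P a c b ∧ P b a c ∧ P b c a ∧ P c a b ∧ P c b a)
    (h2 : ∀ a b, a < b → P a a b ∧ P a b a ∧ P b a a ∧ P b b a ∧ P b a b ∧ P a b b)
    (h1 : ∀ a, P a a a) (i j p : Fin N) : P i j p := by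
  rcases lt_trichotomy i j with u | u | u
  · rcases lt_trichotomy j p with v | v | v
    · exact (h3 i j p u v (u.trans v)).1
    · subst v; exact (h2 i j u).2.2.2.2.2
    · rcases lt_trichotomy i p with w | w | w
      · exact (h3 i p j w v u).2.1
      · subst w; exact (h2 i j u).2.1
      · exact (h3 p i j w u v).2.2.2.1
  · subst u
    rcases lt_trichotomy i p with v | v | v
    · exact (h2 i p v).1
    · subst v; exact h1 i
    · exact (h2 p i v).2.2.2.1
  · rcases lt_trichotomy i p with v | v | v
    · exact (h3 j i p u v (u.trans v)).2.2.1
    · subst v; exact (h2 j i u).2.2.2.2.1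
    · rcases lt_trichotomy j p with w | w | w
      · exact (h3 j p i w v u).2.2.2.2.1
      · subst w; exact (h2 j i u).2.2.1
      · exact (h3 p j i w u v).2.2.2.2.2

theorem ybd_consistent {q : F} (hq : q ≠ 0) (m x y : Co F N)
    (h : (m = coR q ∧ x = coR q ∧ y = coR q) ∨ (m = coRt q ∧ x = coR q ∧ y = coR q) ∨
      (m = coR q ∧ x = coR q ∧ y = coRt q) ∨ (m = coRt q ∧ x = coRt q ∧ y = coRt q) ∨
      (m = coR q ∧ x = coRt q ∧ y = coRt q) ∨ (m = coRt q ∧ x = coRt q ∧ y = coR q))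
    (f : Fin N → Fin N → Fin N → F) (i j p : Fin N) : ybd m x y f i j p = 0 := by
  rcases h with ⟨rfl, rfl, rfl⟩ | ⟨rfl, rfl, rfl⟩ | ⟨rfl, rfl, rfl⟩ | ⟨rfl, rfl, rfl⟩ |
    ⟨rfl, rfl, rfl⟩ | ⟨rfl, rfl, rfl⟩
  all_goals
    revert i j p
    refine forall_triple_of_order _ ?_ ?_ ?_
    · intro a b c h1 h2 h3
      refine ⟨?_, ?_, ?_, ?_, ?_, ?_⟩ <;>
      simp only [ybd, op12, op13, op23, coR, coRt, dg, wP, wM, h1.ne, h1.ne', h2.ne, h2.ne', h3.ne,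
        h3.ne', h1, h2, h3, h1.not_gt, h2.not_gt, h3.not_gt, if_true, if_false] <;>
      ring
    · intro a b h1
      refine ⟨?_, ?_, ?_, ?_, ?_, ?_⟩ <;>
      simp only [ybd, op12, op13, op23, coR, coRt, dg, wP, wM, h1.ne, h1.ne', h1, h1.not_gt,
        if_true, if_false, lt_irrefl] <;>
      field_simp <;> ring
    · intro a
      simp only [ybd, op12, op13, op23, coR, coRt, dg, wP, wM, if_true, if_false, lt_irrefl]
      ring

theorem ybd_mixed {q : F} (hq : q ≠ 0)
    (f : Fin N → Fin N → Fin N → F) (i j p : Fin N) :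
    ybd (coR q) (coRt q) (coR q) f i j p = ybd (coRt q) (coR q) (coRt q) f i j p := by
  revert i j p
  refine forall_triple_of_order _ ?_ ?_ ?_
  · intro a b c h1 h2 h3
    refine ⟨?_, ?_, ?_, ?_, ?_, ?_⟩ <;>
    simp only [ybd, op12, op13, op23, coR, coRt, dg, wP, wM, h1.ne, h1.ne', h2.ne, h2.ne', h3.ne,
      h3.ne', h1, h2, h3, h1.not_gt, h2.not_gt, h3.not_gt, if_true, if_false] <;>
    ring
  · intro a b h1
    refine ⟨?_, ?_, ?_, ?_, ?_, ?_⟩ <;>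
    simp only [ybd, op12, op13, op23, coR, coRt, dg, wP, wM, h1.ne, h1.ne', h1, h1.not_gt,
      if_true, if_false, lt_irrefl] <;>
    field_simp <;> ring
  · intro a
    simp only [ybd, op12, op13, op23, coR, coRt, dg, wP, wM, if_true, if_false, lt_irrefl]
    ring

end YangBaxter

section Evaluation

variable {F : Type} [Field F] {N : ℕ}

/-- A matrix on two tensor factors, viewed as a matrix of matrices. -/
def blk (v : Co F N) (i m : Fin N) : Matrix (Fin N) (Fin N) F :=
  Matrix.of fun p r => coMat v (i, p) (m, r)

/-- Kronecker delta. -/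
def dl (a b : Fin N) : F := if a = b then 1 else 0

/-- Indicator function of a triple. -/
def ind3 (l b r x y z : Fin N) : F := dl x l * dl y b * dl z r

theorem blk_apply (v : Co F N) (i l p r : Fin N) :
    blk v i l p r = v.1 i p * (dl i l * dl p r) + v.2 i p * (dl p l * dl i r) := by
  simp [blk, coMat, dl, ← ite_and, and_comm]

theorem blk_mul_apply (v : Co F N) (i l p : Fin N) (f : Fin N → F) :
    ∑ m, blk v i l p m * f m = v.1 i p * (dl i l * f p) + v.2 i p * (dl p l * f i) := by
  simp only [blk_apply, add_mul, Finset.sum_add_distrib]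
  congr 1 <;> simp [dl]

theorem blk_mul_blk_eq (m x y : Co F N) (i j l b p r : Fin N) :
    (m.1 i j • (blk x i l * blk y j b) + m.2 i j • (blk x j l * blk y i b)) p r =
      op12 m (op13 x (op23 y (ind3 l b r))) i j p := by
  simp only [Matrix.add_apply, Matrix.smul_apply, Matrix.mul_apply, blk_mul_apply, smul_eq_mul]
  simp only [blk_apply, op12, op13, op23, ind3]
  ring

theorem blk_mul_blk_eq_rev (m x y : Co F N) (i j l b p r : Fin N) :
    (m.1 l b • (blk y j b * blk x i l) + m.2 b l • (blk y j l * blk x i b)) p r =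
      op23 y (op13 x (op12 m (ind3 l b r))) i j p := by
  have k1 : ∀ x y z, m.1 x y * ind3 l b r x y z = m.1 l b * ind3 l b r x y z := by
    intro x y z
    by_cases h : x = l
    · by_cases h' : y = b
      · rw [h, h']
      · simp [ind3, dl, h']
    · simp [ind3, dl, h]
  have k2 : ∀ x y z, m.2 x y * ind3 l b r y x z = m.2 b l * ind3 l b r y x z := by
    intro x y z
    by_cases h : y = l
    · by_cases h' : x = b
      · rw [h, h']
      · simp [ind3, dl, h']
    · simp [ind3, dl, h]
  simp only [op12, op13, op23, k1, k2]
  simp only [Matrix.add_apply, Matrix.smul_apply, Matrix.mul_apply, blk_mul_apply, smul_eq_mul]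
  simp only [blk_apply, ind3]
  ring

/-- The RTT combination `M X₁ Y₂ - Y₂ X₁ M` of the evaluation blocks, entrywise. -/
def blkDefect (m x y : Co F N) (i j l b : Fin N) : Matrix (Fin N) (Fin N) F :=
  (m.1 i j • (blk x i l * blk y j b) + m.2 i j • (blk x j l * blk y i b)) -
    (m.1 l b • (blk y j b * blk x i l) + m.2 b l • (blk y j l * blk x i b))

theorem blkDefect_apply (m x y : Co F N) (i j l b p r : Fin N) :
    blkDefect m x y i j l b p r = ybd m x y (ind3 l b r) i j p := by
  rw [blkDefect, Matrix.sub_apply, blk_mul_blk_eq, blk_mul_blk_eq_rev, ybd]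

/-- Coefficients of the evaluation of `T(u)`, without the spectral parameter. -/
def cT (q : F) (r : ℕ) : Co F N := if r = 0 then coRt q else coRt q - coR q

/-- Coefficients of the evaluation of `T̄(u)`, without the spectral parameter. -/
def cTb (q : F) (r : ℕ) : Co F N := if r = 0 then coR q else coR q - coRt q

variable {q : F} (hq : q ≠ 0)
include hq

theorem blkDefect_of_consistent (m x y : Co F N)
    (h : (m = coR q ∧ x = coR q ∧ y = coR q) ∨ (m = coRt q ∧ x = coR q ∧ y = coR q) ∨
      (m = coR q ∧ x = coR q ∧ y = coRt q) ∨ (m = coRt q ∧ x = coRt q ∧ y = coRt q) ∨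
      (m = coR q ∧ x = coRt q ∧ y = coRt q) ∨ (m = coRt q ∧ x = coRt q ∧ y = coR q))
    (i j l b : Fin N) : blkDefect m x y i j l b = 0 := by
  ext p r; rw [blkDefect_apply, ybd_consistent hq m x y h]; rfl

theorem blkDefect_mixed (i j l b : Fin N) :
    blkDefect (coR q) (coRt q) (coR q) i j l b = blkDefect (coRt q) (coR q) (coRt q) i j l b := by
  ext p r; rw [blkDefect_apply, blkDefect_apply, ybd_mixed hq]

omit hq in
theorem blkDefect_sub_mid (m x x' y : Co F N) (i j l b : Fin N) :
    blkDefect m (x - x') y i j l b = blkDefect m x y i j l b - blkDefect m x' y i j l b := by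
  ext p r; simp only [blkDefect_apply, Matrix.sub_apply, ybd_sub_mid]

omit hq in
theorem blkDefect_sub_right (m x y y' : Co F N) (i j l b : Fin N) :
    blkDefect m x (y - y') i j l b = blkDefect m x y i j l b - blkDefect m x y' i j l b := by
  ext p r; simp only [blkDefect_apply, Matrix.sub_apply, ybd_sub_right]

theorem blkDefect_TT_zero_left (s : ℕ) (i j l b : Fin N) :
    blkDefect (coRt q) (cT q 0) (cT q s) i j l b = 0 := by
  rcases s with _ | s <;> simp [cT, blkDefect_sub_right, blkDefect_of_consistent hq]

theorem blkDefect_TT_zero_right (r : ℕ) (i j l b : Fin N) :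
    blkDefect (coR q) (cT q r) (cT q 0) i j l b = 0 := by
  rcases r with _ | r <;> simp [cT, blkDefect_sub_mid, blkDefect_of_consistent hq]

theorem blkDefect_TT_succ (r s : ℕ) (i j l b : Fin N) :
    blkDefect (coRt q) (cT q (r + 1)) (cT q s) i j l b =
      blkDefect (coR q) (cT q r) (cT q (s + 1)) i j l b := by
  rcases r with _ | r <;> rcases s with _ | s <;>
    simp [cT, blkDefect_sub_mid, blkDefect_sub_right, blkDefect_of_consistent hq,
      blkDefect_mixed hq]

theorem blkDefect_TbTb_zero_left (s : ℕ) (i j l b : Fin N) :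
    blkDefect (coR q) (cTb q 0) (cTb q s) i j l b = 0 := by
  rcases s with _ | s <;> simp [cTb, blkDefect_sub_right, blkDefect_of_consistent hq]

theorem blkDefect_TbTb_zero_right (r : ℕ) (i j l b : Fin N) :
    blkDefect (coRt q) (cTb q r) (cTb q 0) i j l b = 0 := by
  rcases r with _ | r <;> simp [cTb, blkDefect_sub_mid, blkDefect_of_consistent hq]

theorem blkDefect_TbTb_succ (r s : ℕ) (i j l b : Fin N) :
    blkDefect (coRt q) (cTb q r) (cTb q (s + 1)) i j l b =
      blkDefect (coR q) (cTb q (r + 1)) (cTb q s) i j l b := by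
  rcases r with _ | r <;> rcases s with _ | s <;>
    simp [cTb, blkDefect_sub_mid, blkDefect_sub_right, blkDefect_of_consistent hq,
      blkDefect_mixed hq]

theorem blkDefect_TbT_zero_left (s : ℕ) (i j l b : Fin N) :
    blkDefect (coR q) (cTb q 0) (cT q s) i j l b = 0 := by
  rcases s with _ | s <;> simp [cT, cTb, blkDefect_sub_right, blkDefect_of_consistent hq]

theorem blkDefect_TbT_zero_right (r : ℕ) (i j l b : Fin N) :
    blkDefect (coR q) (cTb q r) (cT q 0) i j l b = 0 := by
  rcases r with _ | r <;> simp [cT, cTb, blkDefect_sub_mid, blkDefect_of_consistent hq]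

theorem blkDefect_TbT_succ (r s : ℕ) (i j l b : Fin N) :
    blkDefect (coRt q) (cTb q r) (cT q s) i j l b =
      blkDefect (coR q) (cTb q (r + 1)) (cT q (s + 1)) i j l b := by
  rcases r with _ | r <;> rcases s with _ | s <;>
    simp [cT, cTb, blkDefect_sub_mid, blkDefect_sub_right, blkDefect_of_consistent hq,
      blkDefect_mixed hq]

end Evaluation

section TwoVariableSeries

variable {R : Type} [Ring R]

/-- Series in two central variables with coefficients in a (noncommutative) ring. -/
abbrev W (R : Type) [Ring R] := PowerSeries (PowerSeries R)

/-- Constant series. -/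
def kst (m : R) : W R := PowerSeries.C (PowerSeries.C m)

/-- The first variable. -/
def vx : W R := PowerSeries.X

/-- The second variable. -/
def vy : W R := PowerSeries.C PowerSeries.X

/-- A series in the first variable. -/
def ser1 (f : ℕ → R) : W R := PowerSeries.mk fun r => PowerSeries.C (f r)

/-- A series in the second variable. -/
def ser2 (f : ℕ → R) : W R := PowerSeries.C (PowerSeries.mk f)

/-- Coefficients, extended by zero to integer exponents. -/
def cz (r s : ℤ) (w : W R) : R :=
  if 0 ≤ r ∧ 0 ≤ s then PowerSeries.coeff s.toNat (PowerSeries.coeff r.toNat w) else 0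

theorem ext_cz {w w' : W R} (h : ∀ r s : ℤ, cz r s w = cz r s w') : w = w' := by
  ext r s
  have := h r s
  simpa [cz] using this

theorem cz_sub (r s : ℤ) (w w' : W R) : cz r s (w - w') = cz r s w - cz r s w' := by
  simp only [cz]; split_ifs <;> simp

theorem cz_vx_mul (r s : ℤ) (w : W R) : cz r s (vx * w) = cz (r - 1) s w := by
  simp only [cz, vx]
  rcases r with (_ | r) | r
  · simp
  · have : ((Int.ofNat (r + 1)) : ℤ) - 1 = r := by simp
    rw [this]
    have h0 : (0 : ℤ) ≤ (r : ℤ) + 1 := by omega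
    simp [PowerSeries.coeff_succ_X_mul, h0]
  · have h1 : ¬ (0 ≤ Int.negSucc r ∧ 0 ≤ s) := by omega
    have h2 : ¬ (0 ≤ Int.negSucc r - 1 ∧ 0 ≤ s) := by omega
    rw [if_neg h1, if_neg h2]

theorem cz_vy_mul (r s : ℤ) (w : W R) : cz r s (vy * w) = cz r (s - 1) w := by
  simp only [cz, vy, PowerSeries.coeff_C_mul]
  rcases s with (_ | s) | s
  · simp
  · have : ((Int.ofNat (s + 1)) : ℤ) - 1 = s := by simp
    rw [this]
    have h0 : (0 : ℤ) ≤ (s : ℤ) + 1 := by omega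
    simp [PowerSeries.coeff_succ_X_mul, h0]
  · have h1 : ¬ (0 ≤ r ∧ 0 ≤ Int.negSucc s) := by omega
    have h2 : ¬ (0 ≤ r ∧ 0 ≤ Int.negSucc s - 1) := by omega
    rw [if_neg h1, if_neg h2]

theorem vx_comm (w : W R) : w * vx = vx * w := (PowerSeries.commute_X w).eq

theorem vy_comm (w : W R) : w * vy = vy * w := by
  ext r s
  simp only [vy, PowerSeries.coeff_C_mul, PowerSeries.coeff_mul_C, (PowerSeries.commute_X _).eq]

theorem kst_mul_kst (m m' : R) : kst m * kst m' = kst (m * m') := by simp [kst]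

theorem kst_mul_ser1 (m : R) (f : ℕ → R) : kst m * ser1 f = ser1 fun r => m * f r := by
  ext r s; simp [kst, ser1, PowerSeries.coeff_C_mul, ← map_mul]

theorem ser1_mul_kst (m : R) (f : ℕ → R) : ser1 f * kst m = ser1 fun r => f r * m := by
  ext r s; simp [kst, ser1, PowerSeries.coeff_mul_C, ← map_mul]

theorem kst_mul_ser2 (m : R) (f : ℕ → R) : kst m * ser2 f = ser2 fun r => m * f r := by
  ext r s; simp [kst, ser2, ← map_mul, PowerSeries.coeff_C]; split_ifs <;> simp

theorem ser2_mul_kst (m : R) (f : ℕ → R) : ser2 f * kst m = ser2 fun r => f r * m := by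
  ext r s; simp [kst, ser2, ← map_mul, PowerSeries.coeff_C]; split_ifs <;> simp

theorem coeff_ser1_mul_ser2 (f g : ℕ → R) (r s : ℕ) :
    PowerSeries.coeff s (PowerSeries.coeff r (ser1 f * ser2 g)) = f r * g s := by
  simp [ser1, ser2, PowerSeries.coeff_mul_C]

theorem coeff_ser2_mul_ser1 (f g : ℕ → R) (r s : ℕ) :
    PowerSeries.coeff s (PowerSeries.coeff r (ser2 g * ser1 f)) = g s * f r := by
  simp [ser1, ser2]

/-- Cauchy product of coefficient sequences. -/
def cauchy (f g : ℕ → R) (r : ℕ) : R := ∑ p ∈ Finset.range (r + 1), f p * g (r - p)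

theorem coeff_mk_mul_mk (f g : ℕ → R) (r : ℕ) :
    PowerSeries.coeff r (PowerSeries.mk f * PowerSeries.mk g) = cauchy f g r := by
  rw [PowerSeries.coeff_mul, Finset.Nat.sum_antidiagonal_eq_sum_range_succ_mk]
  simp [cauchy]

theorem ser1_mul_ser1 (f g : ℕ → R) : ser1 f * ser1 g = ser1 (cauchy f g) := by
  ext r s
  rw [ser1, ser1, PowerSeries.coeff_mul, Finset.Nat.sum_antidiagonal_eq_sum_range_succ_mk]
  simp [cauchy, ser1, ← map_mul, ← map_sum]

theorem ser2_mul_ser2 (f g : ℕ → R) : ser2 f * ser2 g = ser2 (cauchy f g) := by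
  rw [ser2, ser2, ser2, ← map_mul]
  congr 1
  ext r
  rw [coeff_mk_mul_mk, PowerSeries.coeff_mk]

end TwoVariableSeries

section SeriesCoefficients

variable {R : Type} [Ring R]

/-- Extension of a sequence by zero to integer indices. -/
def ez (f : ℕ → R) (r : ℤ) : R := if 0 ≤ r then f r.toNat else 0

theorem ez_natCast (f : ℕ → R) (r : ℕ) : ez f r = f r := by simp [ez]

theorem ez_of_neg (f : ℕ → R) {r : ℤ} (h : r < 0) : ez f r = 0 := by
  simp [ez, not_le.2 h]

theorem cz_kst_mul (m : R) (w : W R) (r s : ℤ) : cz r s (kst m * w) = m * cz r s w := by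
  simp only [cz, kst]; split_ifs <;> simp

theorem cz_mul_kst (m : R) (w : W R) (r s : ℤ) : cz r s (w * kst m) = cz r s w * m := by
  simp only [cz, kst]; split_ifs <;> simp

theorem cz_ser1_mul_ser2 (f g : ℕ → R) (r s : ℤ) :
    cz r s (ser1 f * ser2 g) = ez f r * ez g s := by
  simp only [cz, ez, coeff_ser1_mul_ser2]; split_ifs <;> simp_all

theorem cz_ser2_mul_ser1 (f g : ℕ → R) (r s : ℤ) :
    cz r s (ser2 g * ser1 f) = ez g s * ez f r := by
  simp only [cz, ez, coeff_ser2_mul_ser1]; split_ifs <;> simp_all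

end SeriesCoefficients

section RttRelations

variable {F : Type} [Field F] {N : ℕ} {A : Type} [Ring A] [Algebra F A]

theorem amp1_mul (X Y : Matrix (Fin N) (Fin N) A) : amp1 (X * Y) = amp1 X * amp1 Y := by
  ext ⟨i, j⟩ ⟨l, b⟩
  rw [amp1_mul_apply]
  by_cases h : j = b <;> simp [amp1, Matrix.mul_apply, h]

theorem amp2_mul (X Y : Matrix (Fin N) (Fin N) A) : amp2 (X * Y) = amp2 X * amp2 Y := by
  ext ⟨i, j⟩ ⟨l, b⟩
  rw [amp2_mul_apply]
  by_cases h : i = l <;> simp [amp2, Matrix.mul_apply, h]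

theorem amp1_sum {ι : Type} (s : Finset ι) (X : ι → Matrix (Fin N) (Fin N) A) :
    amp1 (∑ k ∈ s, X k) = ∑ k ∈ s, amp1 (X k) := by
  ext ⟨i, j⟩ ⟨l, b⟩
  by_cases h : j = b <;> simp [amp1, Matrix.sum_apply, h]

theorem amp2_sum {ι : Type} (s : Finset ι) (X : ι → Matrix (Fin N) (Fin N) A) :
    amp2 (∑ k ∈ s, X k) = ∑ k ∈ s, amp2 (X k) := by
  ext ⟨i, j⟩ ⟨l, b⟩
  by_cases h : i = l <;> simp [amp2, Matrix.sum_apply, h]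

/-- `X(u)` in the first tensor slot. -/
def g1 (X : ℕ → Matrix (Fin N) (Fin N) A) : W (Matrix (Fin N × Fin N) (Fin N × Fin N) A) :=
  ser1 fun r => amp1 (X r)

/-- `Y(v)` in the second tensor slot. -/
def g2 (Y : ℕ → Matrix (Fin N) (Fin N) A) : W (Matrix (Fin N × Fin N) (Fin N × Fin N) A) :=
  ser2 fun r => amp2 (Y r)

theorem g1_cauchy (X Y : ℕ → Matrix (Fin N) (Fin N) A) : g1 (cauchy X Y) = g1 X * g1 Y := by
  simp only [g1, ser1_mul_ser1, cauchy, amp1_sum, amp1_mul]; rfl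

theorem g2_cauchy (X Y : ℕ → Matrix (Fin N) (Fin N) A) : g2 (cauchy X Y) = g2 X * g2 Y := by
  simp only [g2, ser2_mul_ser2, cauchy, amp2_sum, amp2_mul]; rfl

theorem g1_comm_g2 (X Y : ℕ → Matrix (Fin N) (Fin N) A)
    (h : ∀ r s i j k l, Commute (X r i j) (Y s k l)) : g1 X * g2 Y = g2 Y * g1 X := by
  refine ext_cz fun r s => ?_
  rw [g1, g2, cz_ser1_mul_ser2, cz_ser2_mul_ser1]
  simp only [ez]
  split_ifs
  · ext ⟨i, j⟩ ⟨l, b⟩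
    rw [amp1_mul_amp2, amp2_mul_amp1, h]
  all_goals simp

/-- The R-matrix `α R̃ - β R` with series coefficients. -/
def RW (q : F) (N : ℕ) (A : Type) [Ring A] [Algebra F A]
    (α β : W (Matrix (Fin N × Fin N) (Fin N × Fin N) A)) :
    W (Matrix (Fin N × Fin N) (Fin N × Fin N) A) :=
  α * kst (liftF F (Rtil F q N)) - β * kst (liftF F (Rc F q N))

/-- The RTT relation for two families. -/
def Rtt (q : F) (α β : W (Matrix (Fin N × Fin N) (Fin N × Fin N) A))
    (X Y : ℕ → Matrix (Fin N) (Fin N) A) : Prop :=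
  RW q N A α β * (g1 X * g2 Y) = g2 Y * g1 X * RW q N A α β

theorem Rtt.mul {q : F} {α β : W (Matrix (Fin N × Fin N) (Fin N × Fin N) A)}
    {X Y X' Y' : ℕ → Matrix (Fin N) (Fin N) A} (h : Rtt q α β X Y) (h' : Rtt q α β X' Y')
    (hc : ∀ r s i j k l, Commute (X r i j) (Y' s k l))
    (hc' : ∀ r s i j k l, Commute (X' r i j) (Y s k l)) :
    Rtt q α β (cauchy X X') (cauchy Y Y') := by
  have e := g1_comm_g2 X Y' hc
  have e' := g1_comm_g2 X' Y hc'
  unfold Rtt at h h' ⊢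
  rw [g1_cauchy, g2_cauchy]
  calc RW q N A α β * (g1 X * g1 X' * (g2 Y * g2 Y'))
      = RW q N A α β * (g1 X * (g1 X' * g2 Y) * g2 Y') := by simp only [mul_assoc]
    _ = RW q N A α β * (g1 X * g2 Y) * (g1 X' * g2 Y') := by rw [e']; simp only [mul_assoc]
    _ = g2 Y * g1 X * (RW q N A α β * (g1 X' * g2 Y')) := by rw [h]; simp only [mul_assoc]
    _ = g2 Y * (g1 X * g2 Y') * g1 X' * RW q N A α β := by rw [h']; simp only [mul_assoc]
    _ = g2 Y * g2 Y' * (g1 X * g1 X') * RW q N A α β := by rw [e]; simp only [mul_assoc]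

theorem z1_eq (X : ℕ → Matrix (Fin N) (Fin N) A) (r : ℤ) :
    z1 X r = ez (fun r => amp1 (X r)) r := rfl

theorem z2_eq (X : ℕ → Matrix (Fin N) (Fin N) A) (r : ℤ) :
    z2 X r = ez (fun r => amp2 (X r)) r := rfl

/-- Monomial coefficients: `α` shifts exponents by `(r₀, s₀)`. -/
def Shifts (α : W (Matrix (Fin N × Fin N) (Fin N × Fin N) A)) (r₀ s₀ : ℤ) : Prop :=
  ∀ w, w * α = α * w ∧ ∀ r s, cz r s (α * w) = cz (r - r₀) (s - s₀) w

theorem shifts_vx : Shifts (vx : W (Matrix (Fin N × Fin N) (Fin N × Fin N) A)) 1 0 :=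
  fun w => ⟨vx_comm w, fun r s => by rw [cz_vx_mul, sub_zero]⟩

theorem shifts_vy : Shifts (vy : W (Matrix (Fin N × Fin N) (Fin N × Fin N) A)) 0 1 :=
  fun w => ⟨vy_comm w, fun r s => by rw [cz_vy_mul, sub_zero]⟩

theorem shifts_one : Shifts (1 : W (Matrix (Fin N × Fin N) (Fin N × Fin N) A)) 0 0 :=
  fun w => ⟨by simp, fun r s => by simp⟩

theorem shifts_vx_mul_vy :
    Shifts (vx * vy : W (Matrix (Fin N × Fin N) (Fin N × Fin N) A)) 1 1 :=
  fun w => ⟨by rw [← mul_assoc, vx_comm, mul_assoc, vy_comm, mul_assoc],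
    fun r s => by rw [mul_assoc, cz_vx_mul, cz_vy_mul]⟩

theorem cz_RW_mul (q : F) {α β : W (Matrix (Fin N × Fin N) (Fin N × Fin N) A)} {a b a' b' : ℤ}
    (hα : Shifts α a b) (hβ : Shifts β a' b') (w) (r s : ℤ) :
    cz r s (RW q N A α β * w) =
      liftF F (Rtil F q N) * cz (r - a) (s - b) w -
        liftF F (Rc F q N) * cz (r - a') (s - b') w := by
  rw [RW, sub_mul, cz_sub, mul_assoc, mul_assoc, (hα _).2, (hβ _).2, cz_kst_mul, cz_kst_mul]

theorem cz_mul_RW (q : F) {α β : W (Matrix (Fin N × Fin N) (Fin N × Fin N) A)} {a b a' b' : ℤ}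
    (hα : Shifts α a b) (hβ : Shifts β a' b') (w) (r s : ℤ) :
    cz r s (w * RW q N A α β) =
      cz (r - a) (s - b) w * liftF F (Rtil F q N) -
        cz (r - a') (s - b') w * liftF F (Rc F q N) := by
  rw [RW, mul_sub, cz_sub, ← mul_assoc, ← mul_assoc, (hα _).1, (hβ _).1, mul_assoc, mul_assoc,
    (hα _).2, (hβ _).2, cz_mul_kst, cz_mul_kst]

theorem rtt_iff (q : F) {α β : W (Matrix (Fin N × Fin N) (Fin N × Fin N) A)} {a b a' b' : ℤ}
    (hα : Shifts α a b) (hβ : Shifts β a' b') (X Y : ℕ → Matrix (Fin N) (Fin N) A) :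
    Rtt q α β X Y ↔ ∀ r s : ℤ, affRttL F q X Y (r - a) (s - b) (r - a') (s - b') =
      affRttR F q X Y (r - a) (s - b) (r - a') (s - b') := by
  have e1 : ∀ r s, cz r s (RW q N A α β * (g1 X * g2 Y)) =
      affRttL F q X Y (r - a) (s - b) (r - a') (s - b') := fun r s => by
    rw [cz_RW_mul q hα hβ, g1, g2, cz_ser1_mul_ser2, cz_ser1_mul_ser2]
    simp only [affRttL, z1_eq, z2_eq, mul_assoc]
  have e2 : ∀ r s, cz r s (g2 Y * g1 X * RW q N A α β) =
      affRttR F q X Y (r - a) (s - b) (r - a') (s - b') := fun r s => by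
    rw [cz_mul_RW q hα hβ, g1, g2, cz_ser2_mul_ser1, cz_ser2_mul_ser1]
    simp only [affRttR, z1_eq, z2_eq, mul_assoc]
  constructor
  · intro h r s; rw [← e1, ← e2, h]
  · intro h; exact ext_cz fun r s => by rw [e1, e2, h]

theorem rtt_TT_iff (q : F) (X Y : ℕ → Matrix (Fin N) (Fin N) A) :
    Rtt q vy vx X Y ↔ ∀ a b : ℤ, affRttL F q X Y (1 - a) (-b) (-a) (1 - b) =
      affRttR F q X Y (1 - a) (-b) (-a) (1 - b) := by
  rw [rtt_iff q shifts_vy shifts_vx]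
  constructor
  · intro h a b
    have := h (1 - a) (1 - b)
    rwa [show 1 - a - 0 = 1 - a by ring, show 1 - b - 1 = -b by ring, show 1 - a - 1 = -a by ring,
      show 1 - b - 0 = 1 - b by ring] at this
  · intro h r s
    have := h (1 - r) (1 - s)
    rwa [show 1 - (1 - r) = r - 0 by ring, show -(1 - s) = s - 1 by ring,
      show -(1 - r) = r - 1 by ring, show 1 - (1 - s) = s - 0 by ring] at this

theorem rtt_TbTb_iff (q : F) (X Y : ℕ → Matrix (Fin N) (Fin N) A) :
    Rtt q vx vy X Y ↔ ∀ a b : ℤ, affRttL F q X Y (a - 1) b a (b - 1) =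
      affRttR F q X Y (a - 1) b a (b - 1) := by
  rw [rtt_iff q shifts_vx shifts_vy]
  simp only [sub_zero]

theorem rtt_TbT_iff (q : F) (X Y : ℕ → Matrix (Fin N) (Fin N) A) :
    Rtt q (vx * vy) 1 X Y ↔ ∀ a b : ℤ, affRttL F q X Y (a - 1) (-b) a (1 - b) =
      affRttR F q X Y (a - 1) (-b) a (1 - b) := by
  rw [rtt_iff q shifts_vx_mul_vy shifts_one]
  constructor
  · intro h a b
    have := h a (1 - b)
    rwa [sub_zero, sub_zero, show 1 - b - 1 = -b by ring] at this
  · intro h r s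
    have := h r (1 - s)
    rwa [show -(1 - s) = s - 1 by ring, show 1 - (1 - s) = s - 0 by ring,
      show r = r - 0 by ring, show r - 0 - 1 = r - 1 by ring] at this

variable {B : Type} [Ring B] [Algebra F B]

theorem map_liftF (f : A →ₐ[F] B) {m : Type} (M : Matrix m m F) :
    (liftF F (A := A) M).map f = liftF F (A := B) M := by
  ext; simp [liftF]

theorem map_z1 (f : A →ₐ[F] B) (X : ℕ → Matrix (Fin N) (Fin N) A) (r : ℤ) :
    (z1 X r).map f = z1 (fun r => (X r).map f) r := by
  ext; simp only [z1]; split_ifs <;> simp [amp1, apply_ite f]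

theorem map_z2 (f : A →ₐ[F] B) (X : ℕ → Matrix (Fin N) (Fin N) A) (r : ℤ) :
    (z2 X r).map f = z2 (fun r => (X r).map f) r := by
  ext; simp only [z2]; split_ifs <;> simp [amp2, apply_ite f]

theorem map_affRttL (f : A →ₐ[F] B) (q : F) (X Y : ℕ → Matrix (Fin N) (Fin N) A)
    (a b a' b' : ℤ) : (affRttL F q X Y a b a' b').map f =
      affRttL F q (fun r => (X r).map f) (fun r => (Y r).map f) a b a' b' := by
  simp only [affRttL, Matrix.map_sub f (map_sub f), Matrix.map_mul, map_liftF, map_z1, map_z2]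

theorem map_affRttR (f : A →ₐ[F] B) (q : F) (X Y : ℕ → Matrix (Fin N) (Fin N) A)
    (a b a' b' : ℤ) : (affRttR F q X Y a b a' b').map f =
      affRttR F q (fun r => (X r).map f) (fun r => (Y r).map f) a b a' b' := by
  simp only [affRttR, Matrix.map_sub f (map_sub f), Matrix.map_mul, map_liftF, map_z1, map_z2]

theorem map_affLHS (f : A →ₐ[F] B) (q : F) (X : ℕ → Matrix (Fin N) (Fin N) A)
    (a b : ℤ) : (affLHS F q X a b).map f = affLHS F q (fun r => (X r).map f) a b := by
  simp only [affLHS, Matrix.map_add f (map_add f), Matrix.map_sub f (map_sub f), Matrix.map_mul,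
    map_liftF, map_z1, map_z2]

theorem map_affRHS (f : A →ₐ[F] B) (q : F) (X : ℕ → Matrix (Fin N) (Fin N) A)
    (a b : ℤ) : (affRHS F q X a b).map f = affRHS F q (fun r => (X r).map f) a b := by
  simp only [affRHS, Matrix.map_add f (map_add f), Matrix.map_sub f (map_sub f), Matrix.map_mul,
    map_liftF, map_z1, map_z2]

end RttRelations

section AffineRepresentations

variable {F : Type} [Field F] {N : ℕ} {A : Type} [Ring A] [Algebra F A]

/-- Two families satisfying the defining relations of `U_q(ĝl_N)`. -/
structure AffRep (q : F) (T Tb : ℕ → Matrix (Fin N) (Fin N) A) : Prop where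
  t0 : ∀ i j : Fin N, i < j → T 0 i j = 0
  tb0 : ∀ i j : Fin N, j < i → Tb 0 i j = 0
  t_tb : ∀ i : Fin N, T 0 i i * Tb 0 i i = 1
  tb_t : ∀ i : Fin N, Tb 0 i i * T 0 i i = 1
  TT : Rtt q vy vx T T
  TbTb : Rtt q vx vy Tb Tb
  TbT : Rtt q (vx * vy) 1 Tb T

theorem liftAlgHom_relations {q : F} {T Tb : ℕ → Matrix (Fin N) (Fin N) A} (h : AffRep q T Tb)
    ⦃x y : FreeAlgebra F (AffGen N)⦄ (hxy : AffGlRel F q N x y) :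
    FreeAlgebra.lift F (Sum.elim (fun g : ℕ × Fin N × Fin N => T g.1 g.2.1 g.2.2)
      fun g : ℕ × Fin N × Fin N => Tb g.1 g.2.1 g.2.2) x =
      FreeAlgebra.lift F (Sum.elim (fun g : ℕ × Fin N × Fin N => T g.1 g.2.1 g.2.2)
      fun g : ℕ × Fin N × Fin N => Tb g.1 g.2.1 g.2.2) y := by
  set f := FreeAlgebra.lift F
    (Sum.elim (fun g : ℕ × Fin N × Fin N => T g.1 g.2.1 g.2.2)
      fun g : ℕ × Fin N × Fin N => Tb g.1 g.2.1 g.2.2)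
    with hf
  have hT : (fun r => (TfA F N r).map f) = T := by
    ext r i j; simp [TfA, hf]
  have hTb : (fun r => (TbfA F N r).map f) = Tb := by
    ext r i j; simp [TbfA, hf]
  have hL : ∀ (X Y : ℕ → Matrix (Fin N) (Fin N) (FreeAlgebra F (AffGen N))) (a b a' b' : ℤ) p r,
      f (affRttL F q X Y a b a' b' p r) =
        affRttL F q (fun r => (X r).map f) (fun r => (Y r).map f) a b a' b' p r := by
    intro X Y a b a' b' p r; rw [← map_affRttL, Matrix.map_apply]
  have hR : ∀ (X Y : ℕ → Matrix (Fin N) (Fin N) (FreeAlgebra F (AffGen N))) (a b a' b' : ℤ) p r,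
      f (affRttR F q X Y a b a' b' p r) =
        affRttR F q (fun r => (X r).map f) (fun r => (Y r).map f) a b a' b' p r := by
    intro X Y a b a' b' p r; rw [← map_affRttR, Matrix.map_apply]
  cases hxy with
  | t0_tri i j hij => simpa [TfA, hf] using h.t0 i j hij
  | tb0_tri i j hij => simpa [TbfA, hf] using h.tb0 i j hij
  | t_tb i => simpa [TfA, TbfA, hf] using h.t_tb i
  | tb_t i => simpa [TfA, TbfA, hf] using h.tb_t i
  | rtt a b p r => rw [hL, hR, hT, (rtt_TT_iff q T T).1 h.TT]
  | rtbtb a b p r => rw [hL, hR, hTb, (rtt_TbTb_iff q Tb Tb).1 h.TbTb]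
  | rtbt a b p r => rw [hL, hR, hTb, hT, (rtt_TbT_iff q Tb T).1 h.TbT]

/-- The homomorphism from the quantum affine algebra given by a representation. -/
def AffRep.lift {q : F} {T Tb : ℕ → Matrix (Fin N) (Fin N) A} (h : AffRep q T Tb) :
    UqAff F q N →ₐ[F] A :=
  RingQuot.liftAlgHom F ⟨_, liftAlgHom_relations h⟩

theorem AffRep.lift_tA {q : F} {T Tb : ℕ → Matrix (Fin N) (Fin N) A} (h : AffRep q T Tb)
    (r : ℕ) (i j : Fin N) : h.lift (tA F q N r i j) = T r i j := by
  simp [AffRep.lift, tA]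

theorem AffRep.lift_tbA {q : F} {T Tb : ℕ → Matrix (Fin N) (Fin N) A} (h : AffRep q T Tb)
    (r : ℕ) (i j : Fin N) : h.lift (tbA F q N r i j) = Tb r i j := by
  simp [AffRep.lift, tbA]

/-- The generator matrices of `U_q(ĝl_N)`. -/
def TU (F : Type) [Field F] (q : F) (N r : ℕ) : Matrix (Fin N) (Fin N) (UqAff F q N) :=
  Matrix.of (tA F q N r)

/-- The generator matrices of `U_q(ĝl_N)`. -/
def TbU (F : Type) [Field F] (q : F) (N r : ℕ) : Matrix (Fin N) (Fin N) (UqAff F q N) :=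
  Matrix.of (tbA F q N r)

theorem affRep_univ (F : Type) [Field F] (q : F) (N : ℕ) :
    AffRep q (TU F q N) (TbU F q N) := by
  have key : ∀ {x y}, AffGlRel F q N x y → RingQuot.mkAlgHom F (AffGlRel F q N) x =
      RingQuot.mkAlgHom F (AffGlRel F q N) y := fun h => RingQuot.mkAlgHom_rel F h
  have hT : (fun r => (TfA F N r).map (RingQuot.mkAlgHom F (AffGlRel F q N))) = TU F q N := rfl
  have hTb : (fun r => (TbfA F N r).map (RingQuot.mkAlgHom F (AffGlRel F q N))) = TbU F q N := rfl
  constructor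
  · intro i j h; exact (key (.t0_tri i j h)).trans (map_zero _)
  · intro i j h; exact (key (.tb0_tri i j h)).trans (map_zero _)
  · intro i; exact (map_mul _ _ _).symm.trans ((key (.t_tb i)).trans (map_one _))
  · intro i; exact (map_mul _ _ _).symm.trans ((key (.tb_t i)).trans (map_one _))
  · rw [rtt_TT_iff, ← hT]
    intro a b
    rw [← map_affRttL, ← map_affRttR]
    ext p r
    exact key (.rtt a b p r)
  · rw [rtt_TbTb_iff, ← hTb]
    intro a b
    rw [← map_affRttL, ← map_affRttR]
    ext p r
    exact key (.rtbtb a b p r)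
  · rw [rtt_TbT_iff, ← hT, ← hTb]
    intro a b
    rw [← map_affRttL, ← map_affRttR]
    ext p r
    exact key (.rtbt a b p r)

theorem AffRep.map {B : Type} [Ring B] [Algebra F B] {q : F}
    {T Tb : ℕ → Matrix (Fin N) (Fin N) A} (h : AffRep q T Tb) (f : A →ₐ[F] B) :
    AffRep q (fun r => (T r).map f) fun r => (Tb r).map f := by
  constructor
  · intro i j hij; simp [h.t0 i j hij]
  · intro i j hij; simp [h.tb0 i j hij]
  · intro i; simp [← map_mul, h.t_tb]
  · intro i; simp [← map_mul, h.tb_t]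
  · rw [rtt_TT_iff]; intro a b
    rw [← map_affRttL, ← map_affRttR, (rtt_TT_iff q T T).1 h.TT]
  · rw [rtt_TbTb_iff]; intro a b
    rw [← map_affRttL, ← map_affRttR, (rtt_TbTb_iff q Tb Tb).1 h.TbTb]
  · rw [rtt_TbT_iff]; intro a b
    rw [← map_affRttL, ← map_affRttR, (rtt_TbT_iff q Tb T).1 h.TbT]

theorem cauchy_zero {R : Type} [Ring R] (f g : ℕ → R) : cauchy f g 0 = f 0 * g 0 := by
  simp [cauchy]

theorem AffRep.mul {q : F} {T Tb T' Tb' : ℕ → Matrix (Fin N) (Fin N) A} (h : AffRep q T Tb)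
    (h' : AffRep q T' Tb') (hTT : ∀ r s i j k l, Commute (T r i j) (T' s k l))
    (hTTb : ∀ r s i j k l, Commute (T r i j) (Tb' s k l))
    (hTbT : ∀ r s i j k l, Commute (Tb r i j) (T' s k l))
    (hTbTb : ∀ r s i j k l, Commute (Tb r i j) (Tb' s k l)) :
    AffRep q (cauchy T T') (cauchy Tb Tb') := by
  have low : ∀ {X Y : Matrix (Fin N) (Fin N) A}, (∀ i j, i < j → X i j = 0) →
      (∀ i j, i < j → Y i j = 0) → (∀ i j, i < j → (X * Y) i j = 0) ∧
        ∀ i, (X * Y) i i = X i i * Y i i := by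
    intro X Y hX hY
    refine ⟨fun i j hij => ?_, fun i => ?_⟩
    · rw [Matrix.mul_apply]
      refine Finset.sum_eq_zero fun m _ => ?_
      rcases lt_or_ge i m with hm | hm
      · rw [hX i m hm, zero_mul]
      · rw [hY m j (hm.trans_lt hij), mul_zero]
    · rw [Matrix.mul_apply]
      refine Finset.sum_eq_single_of_mem i (Finset.mem_univ _) fun m _ hm => ?_
      rcases lt_or_gt_of_ne hm with hm | hm
      · rw [hY m i hm, mul_zero]
      · rw [hX i m hm, zero_mul]
  have up : ∀ {X Y : Matrix (Fin N) (Fin N) A}, (∀ i j, j < i → X i j = 0) →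
      (∀ i j, j < i → Y i j = 0) → (∀ i j, j < i → (X * Y) i j = 0) ∧
        ∀ i, (X * Y) i i = X i i * Y i i := by
    intro X Y hX hY
    refine ⟨fun i j hij => ?_, fun i => ?_⟩
    · rw [Matrix.mul_apply]
      refine Finset.sum_eq_zero fun m _ => ?_
      rcases lt_or_ge m i with hm | hm
      · rw [hX i m hm, zero_mul]
      · rw [hY m j (hij.trans_le hm), mul_zero]
    · rw [Matrix.mul_apply]
      refine Finset.sum_eq_single_of_mem i (Finset.mem_univ _) fun m _ hm => ?_
      rcases lt_or_gt_of_ne hm with hm | hm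
      · rw [hX i m hm, zero_mul]
      · rw [hY m i hm, mul_zero]
  obtain ⟨l1, l2⟩ := low h.t0 h'.t0
  obtain ⟨u1, u2⟩ := up h.tb0 h'.tb0
  constructor
  · intro i j hij; rw [cauchy_zero, l1 i j hij]
  · intro i j hij; rw [cauchy_zero, u1 i j hij]
  · intro i
    rw [cauchy_zero, cauchy_zero, l2, u2, mul_assoc, ← mul_assoc (T' 0 i i),
      ← (hTbT 0 0 i i i i).eq, mul_assoc, h'.t_tb, mul_one, h.t_tb]
  · intro i
    rw [cauchy_zero, cauchy_zero, l2, u2, mul_assoc, ← mul_assoc (Tb' 0 i i),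
      ← (hTTb 0 0 i i i i).eq, mul_assoc, h'.tb_t, mul_one, h.tb_t]
  · exact h.TT.mul h'.TT hTT fun r s i j k l => (hTT s r k l i j).symm
  · exact h.TbTb.mul h'.TbTb hTbTb fun r s i j k l => (hTbTb s r k l i j).symm
  · exact h.TbT.mul h'.TbT hTbT fun r s i j k l => (hTTb s r k l i j).symm

/-- The trivial representation. -/
theorem affRep_trivial (q : F) :
    AffRep (A := A) q (fun r => if r = 0 then (1 : Matrix (Fin N) (Fin N) A) else 0)
      (fun r => if r = 0 then 1 else 0) := by
  have e1 : g1 (fun r => if r = 0 then (1 : Matrix (Fin N) (Fin N) A) else 0) = 1 := by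
    have : (fun r => amp1 (if r = 0 then (1 : Matrix (Fin N) (Fin N) A) else 0)) =
        fun r => if r = 0 then 1 else 0 := by
      ext r ⟨i, j⟩ ⟨l, b⟩
      by_cases hr : r = 0 <;> simp [hr, amp1, Matrix.one_apply, ← ite_and, and_comm]
    rw [g1, this, ser1]
    ext r : 1
    by_cases hr : r = 0 <;> simp [PowerSeries.coeff_one, hr]
  have e2 : g2 (fun r => if r = 0 then (1 : Matrix (Fin N) (Fin N) A) else 0) = 1 := by
    have : (fun r => amp2 (if r = 0 then (1 : Matrix (Fin N) (Fin N) A) else 0)) =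
        fun r => if r = 0 then 1 else 0 := by
      ext r ⟨i, j⟩ ⟨l, b⟩
      by_cases hr : r = 0 <;> simp [hr, amp2, Matrix.one_apply, ← ite_and]
    rw [g2, this, ser2]
    have : (PowerSeries.mk fun r => if r = 0 then 1 else 0 :
        PowerSeries (Matrix (Fin N × Fin N) (Fin N × Fin N) A)) = 1 := by
      ext r : 1
      simp [PowerSeries.coeff_one]
    rw [this, map_one]
  constructor
  · intro i j h; simp [h.ne]
  · intro i j h; simp [h.ne']
  · intro i; simp
  · intro i; simp
  all_goals rw [Rtt, e1, e2]; simp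

/-- The entry of `M X₁ Y₂ - Y₂ X₁ M` for an R-matrix `M` with coefficients `(d, w)`. -/
def rttD (d : F) (w : Fin N → Fin N → F) (X Y : Matrix (Fin N) (Fin N) A) (i j l b : Fin N) : A :=
  (dg d i j • (X i l * Y j b) + w i j • (X j l * Y i b)) -
    (dg d l b • (Y j b * X i l) + w b l • (Y j l * X i b))

theorem z1_eq_amp1 (X : ℕ → Matrix (Fin N) (Fin N) A) (r : ℤ) : z1 X r = amp1 (ez X r) := by
  simp only [z1, ez]; split_ifs <;> ext <;> simp [amp1]

theorem z2_eq_amp2 (X : ℕ → Matrix (Fin N) (Fin N) A) (r : ℤ) : z2 X r = amp2 (ez X r) := by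
  simp only [z2, ez]; split_ifs <;> ext <;> simp [amp2]

theorem affRtt_sub (q : F) (X Y : ℕ → Matrix (Fin N) (Fin N) A) (r s r' s' : ℤ)
    (i j l b : Fin N) : affRttL F q X Y r s r' s' (i, j) (l, b) -
      affRttR F q X Y r s r' s' (i, j) (l, b) =
      rttD q⁻¹ (wM q) (ez X r) (ez Y s) i j l b - rttD q (wP q) (ez X r') (ez Y s') i j l b := by
  simp only [affRttL, affRttR, z1_eq_amp1, z2_eq_amp2, Matrix.sub_apply, Rtil_eq, Rc_eq, mul_assoc,
    liftF_Rg_mul, amp1_mul_amp2]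
  simp only [← mul_assoc, mul_liftF_Rg, Prod.swap, amp1_mul_amp2, amp2_mul_amp1, rttD]
  abel

theorem rtt_iff_rttD (q : F) {α β : W (Matrix (Fin N × Fin N) (Fin N × Fin N) A)}
    {a b a' b' : ℤ} (hα : Shifts α a b) (hβ : Shifts β a' b')
    (X Y : ℕ → Matrix (Fin N) (Fin N) A) :
    Rtt q α β X Y ↔ ∀ (r s : ℤ) (i j l m : Fin N),
      rttD q⁻¹ (wM q) (ez X (r - a)) (ez Y (s - b)) i j l m =
        rttD q (wP q) (ez X (r - a')) (ez Y (s - b')) i j l m := by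
  rw [rtt_iff q hα hβ]
  constructor
  · intro h r s i j l m
    rw [← sub_eq_zero, ← affRtt_sub, h, sub_self]
  · intro h r s
    ext ⟨i, j⟩ ⟨l, m⟩
    rw [← sub_eq_zero, affRtt_sub, h, sub_self]

@[simp]
theorem rttD_zero_left (d : F) (w : Fin N → Fin N → F) (Y : Matrix (Fin N) (Fin N) A)
    (i j l b : Fin N) : rttD d w 0 Y i j l b = 0 := by simp [rttD]

@[simp]
theorem rttD_zero_right (d : F) (w : Fin N → Fin N → F) (Y : Matrix (Fin N) (Fin N) A)
    (i j l b : Fin N) : rttD d w Y 0 i j l b = 0 := by simp [rttD]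

/-- Evaluation of `T(u)` at the spectral parameter `a`. -/
def evT (q a : F) (r : ℕ) : Matrix (Fin N) (Fin N) (Matrix (Fin N) (Fin N) F) :=
  Matrix.of fun i j => a ^ r • blk (cT q r) i j

/-- Evaluation of `T̄(u)` at the spectral parameter `a`. -/
def evTb (q a : F) (r : ℕ) : Matrix (Fin N) (Fin N) (Matrix (Fin N) (Fin N) F) :=
  Matrix.of fun i j => a⁻¹ ^ r • blk (cTb q r) i j

theorem rttD_smul_blk (m x y : Co F N) (d : F) (hd : m.1 = dg d) (c c' : F) (i j l b : Fin N) :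
    rttD d m.2 (Matrix.of fun i j => c • blk x i j) (Matrix.of fun i j => c' • blk y i j) i j l b =
      (c * c') • blkDefect m x y i j l b := by
  simp only [rttD, blkDefect, Matrix.of_apply, smul_mul_assoc, mul_smul_comm, hd, smul_sub,
    smul_add, smul_smul]
  simp only [mul_comm]

theorem ez_sub_one_zero {R : Type} [Ring R] (f : ℕ → R) : ez f (((0 : ℕ) : ℤ) - 1) = 0 := by
  simp [ez]

theorem ez_sub_one_succ {R : Type} [Ring R] (f : ℕ → R) (r : ℕ) :
    ez f (((r + 1 : ℕ) : ℤ) - 1) = f r := by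
  simp [ez]

/-- Integer-indexed identities from natural ones. -/
theorem forall_int_of_nat {P : ℤ → ℤ → Prop} (h0 : ∀ r s, (r < 0 ∨ s < 0) → P r s)
    (h : ∀ r s : ℕ, P r s) (r s : ℤ) : P r s := by
  rcases lt_or_ge r 0 with hr | hr
  · exact h0 r s (Or.inl hr)
  rcases lt_or_ge s 0 with hs | hs
  · exact h0 r s (Or.inr hs)
  lift r to ℕ using hr
  lift s to ℕ using hs
  exact h r s

theorem affRep_eval {q a : F} (hq : q ≠ 0) (ha : a ≠ 0) :
    AffRep (N := N) q (evT q a) (evTb q a) := by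
  have e : ∀ (c c' : F) (x y : Co F N) (i j l b : Fin N),
      rttD q⁻¹ (wM q) (Matrix.of fun i j => c • blk x i j) (Matrix.of fun i j => c' • blk y i j)
        i j l b = (c * c') • blkDefect (coRt q) x y i j l b :=
    fun c c' x y => rttD_smul_blk (coRt q) x y q⁻¹ rfl c c'
  have e' : ∀ (c c' : F) (x y : Co F N) (i j l b : Fin N),
      rttD q (wP q) (Matrix.of fun i j => c • blk x i j) (Matrix.of fun i j => c' • blk y i j)
        i j l b = (c * c') • blkDefect (coR q) x y i j l b :=
    fun c c' x y => rttD_smul_blk (coR q) x y q rfl c c'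
  constructor
  · intro i j h
    ext p r
    by_cases hp : p = j
    · simp [evT, blk_apply, cT, coRt, dl, h.ne, wM, hp, h.not_gt]
    · simp [evT, blk_apply, cT, coRt, dl, h.ne, hp]
  · intro i j h
    ext p r
    by_cases hp : p = j
    · simp [evTb, blk_apply, cTb, coR, dl, h.ne', wP, hp, h.not_gt]
    · simp [evTb, blk_apply, cTb, coR, dl, h.ne', hp]
  · intro i
    ext p r
    simp only [evT, evTb, Matrix.of_apply, pow_zero, one_smul, Matrix.mul_apply, blk_mul_apply]
    simp only [blk_apply, cT, cTb, coR, coRt, dl, if_true, wM, wP, dg, Matrix.one_apply]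
    by_cases hp : i = p <;> by_cases hr : p = r <;> simp [hp, hr, hq] <;> aesop
  · intro i
    ext p r
    simp only [evT, evTb, Matrix.of_apply, pow_zero, one_smul, Matrix.mul_apply, blk_mul_apply]
    simp only [blk_apply, cT, cTb, coR, coRt, dl, if_true, wM, wP, dg, Matrix.one_apply]
    by_cases hp : i = p <;> by_cases hr : p = r <;> simp [hp, hr, hq] <;> aesop
  · rw [rtt_iff_rttD q shifts_vy shifts_vx]
    refine forall_int_of_nat (fun r s h i j l b => ?_) fun r s i j l b => ?_
    · rcases h with h | h
      · simp [ez_of_neg _ h, ez_of_neg _ (show r - 1 < 0 by omega)]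
      · simp [ez_of_neg _ h, ez_of_neg _ (show s - 1 < 0 by omega)]
    · rcases r with _ | r <;> rcases s with _ | s <;>
        simp only [sub_zero, ez_natCast, ez_sub_one_zero, ez_sub_one_succ, rttD_zero_left,
          rttD_zero_right, evT, e, e', blkDefect_TT_zero_left hq, blkDefect_TT_zero_right hq,
          blkDefect_TT_succ hq, smul_zero]
      congr 1; ring
  · rw [rtt_iff_rttD q shifts_vx shifts_vy]
    refine forall_int_of_nat (fun r s h i j l b => ?_) fun r s i j l b => ?_
    · rcases h with h | h
      · simp [ez_of_neg _ h, ez_of_neg _ (show r - 1 < 0 by omega)]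
      · simp [ez_of_neg _ h, ez_of_neg _ (show s - 1 < 0 by omega)]
    · rcases r with _ | r <;> rcases s with _ | s <;>
        simp only [sub_zero, ez_natCast, ez_sub_one_zero, ez_sub_one_succ, rttD_zero_left,
          rttD_zero_right, evTb, e, e', blkDefect_TbTb_zero_left hq, blkDefect_TbTb_zero_right hq,
          blkDefect_TbTb_succ hq, smul_zero]
      congr 1; ring
  · rw [rtt_iff_rttD q shifts_vx_mul_vy shifts_one]
    refine forall_int_of_nat (fun r s h i j l b => ?_) fun r s i j l b => ?_
    · rcases h with h | h
      · simp [ez_of_neg _ h, ez_of_neg _ (show r - 1 < 0 by omega)]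
      · simp [ez_of_neg _ h, ez_of_neg _ (show s - 1 < 0 by omega)]
    · rcases r with _ | r <;> rcases s with _ | s <;>
        simp only [sub_zero, ez_natCast, ez_sub_one_zero, ez_sub_one_succ, rttD_zero_left,
          rttD_zero_right, evT, evTb, e, e', blkDefect_TbT_zero_left hq,
          blkDefect_TbT_zero_right hq, blkDefect_TbT_succ hq, smul_zero]
      congr 1; rw [inv_pow, inv_pow, pow_succ, pow_succ]; field_simp

end AffineRepresentations

section ReflectionFromRtt

variable {F : Type} [Field F] {N n : ℕ} {A : Type} [Ring A] [Algebra F A]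

/-- The transposed R-matrix `u v R̃ᵗ - Rᵗ`. -/
def KW (q : F) (N : ℕ) (A : Type) [Ring A] [Algebra F A] :
    W (Matrix (Fin N × Fin N) (Fin N × Fin N) A) :=
  (vx * vy) * kst (liftF F (Rtilt F q N)) - 1 * kst (liftF F (Rct F q N))

theorem cz_mul_KW_mul (q : F) (f g : ℕ → Matrix (Fin N × Fin N) (Fin N × Fin N) A) (r s : ℤ) :
    cz r s (ser1 f * (KW q N A * ser2 g)) =
      ez f (r - 1) * (liftF F (Rtilt F q N) * ez g (s - 1)) -
        ez f r * (liftF F (Rct F q N) * ez g s) := by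
  rw [KW, sub_mul, mul_sub, cz_sub, mul_assoc (vx * vy), ← mul_assoc (ser1 f),
    (shifts_vx_mul_vy (ser1 f)).1, mul_assoc, (shifts_vx_mul_vy _).2, one_mul,
    kst_mul_ser2, kst_mul_ser2, cz_ser1_mul_ser2, cz_ser1_mul_ser2]
  simp only [ez]; split_ifs <;> simp

theorem cz_mul_KW_mul_rev (q : F) (f g : ℕ → Matrix (Fin N × Fin N) (Fin N × Fin N) A) (r s : ℤ) :
    cz r s (ser2 g * (KW q N A * ser1 f)) =
      ez g (s - 1) * (liftF F (Rtilt F q N) * ez f (r - 1)) -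
        ez g s * (liftF F (Rct F q N) * ez f r) := by
  rw [KW, sub_mul, mul_sub, cz_sub, mul_assoc (vx * vy), ← mul_assoc (ser2 g),
    (shifts_vx_mul_vy (ser2 g)).1, mul_assoc, (shifts_vx_mul_vy _).2, one_mul,
    kst_mul_ser1, kst_mul_ser1, cz_ser2_mul_ser1, cz_ser2_mul_ser1]
  simp only [ez]; split_ifs <;> simp

/-- The affine reflection equation for a family. -/
def Refl (q : F) (S : ℕ → Matrix (Fin N) (Fin N) A) : Prop :=
  RW q N A vy vx * (g1 S * (KW q N A * g2 S)) = g2 S * (KW q N A * g1 S) * RW q N A vy vx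

theorem refl_iff (q : F) (S : ℕ → Matrix (Fin N) (Fin N) A) :
    Refl q S ↔ ∀ a b : ℤ, affLHS F q S a b = affRHS F q S a b := by
  have e1 : ∀ a b : ℤ, cz (1 - a) (2 - b) (RW q N A vy vx * (g1 S * (KW q N A * g2 S))) =
      affLHS F q S a b := fun a b => by
    rw [cz_RW_mul q shifts_vy shifts_vx, g1, g2, cz_mul_KW_mul, cz_mul_KW_mul]
    simp only [affLHS, z1_eq, z2_eq, mul_assoc, mul_sub]
    rw [show 1 - a - 0 - 1 = -a by ring, show 2 - b - 1 - 1 = -b by ring,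
      show 1 - a - 0 = 1 - a by ring, show 2 - b - 1 = 1 - b by ring,
      show 1 - a - 1 - 1 = -1 - a by ring, show 2 - b - 0 - 1 = 1 - b by ring,
      show 1 - a - 1 = -a by ring, show 2 - b - 0 = 2 - b by ring]
    abel
  have e2 : ∀ a b : ℤ, cz (1 - a) (2 - b) (g2 S * (KW q N A * g1 S) * RW q N A vy vx) =
      affRHS F q S a b := fun a b => by
    rw [cz_mul_RW q shifts_vy shifts_vx, g1, g2, cz_mul_KW_mul_rev, cz_mul_KW_mul_rev]
    simp only [affRHS, z1_eq, z2_eq, sub_mul]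
    rw [show 1 - a - 0 - 1 = -a by ring, show 2 - b - 1 - 1 = -b by ring,
      show 1 - a - 0 = 1 - a by ring, show 2 - b - 1 = 1 - b by ring,
      show 1 - a - 1 - 1 = -1 - a by ring, show 2 - b - 0 - 1 = 1 - b by ring,
      show 1 - a - 1 = -a by ring, show 2 - b - 0 = 2 - b by ring]
    simp only [mul_assoc]
    abel
  constructor
  · intro h a b; rw [← e1, ← e2, h]
  · intro h
    refine ext_cz fun r s => ?_
    have := h (1 - r) (2 - s)
    rwa [← e1, ← e2, sub_sub_cancel, sub_sub_cancel] at this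

theorem ez_transpose (X : ℕ → Matrix (Fin N) (Fin N) A) (r : ℤ) :
    ez (fun r => (X r).transpose) r = (ez X r).transpose := by
  simp only [ez]; split_ifs <;> simp

theorem rttD_transpose (d : F) (w : Fin N → Fin N → F) (X Y : Matrix (Fin N) (Fin N) A)
    (i j l b : Fin N) : rttD d w X.transpose Y.transpose i j l b = -rttD d w Y X b l j i := by
  have h : ∀ x y : Fin N, dg d x y = dg d y x := fun x y => by simp [dg, eq_comm]
  simp only [rttD, Matrix.transpose_apply, h b l, h j i]
  abel

/-- Transposing both factors reverses the RTT relation. -/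
theorem Rtt.transpose {q : F} {X : ℕ → Matrix (Fin N) (Fin N) A} (h : Rtt q vx vy X X) :
    Rtt q vy vx (fun r => (X r).transpose) fun r => (X r).transpose := by
  rw [rtt_iff_rttD q shifts_vx shifts_vy] at h
  rw [rtt_iff_rttD q shifts_vy shifts_vx]
  intro r s i j l b
  simp only [ez_transpose, rttD_transpose, h s r b l j i]

theorem amp_Rgt_sub (d : F) (w : Fin N → Fin N → F) (X Y : Matrix (Fin N) (Fin N) A)
    (i j l b : Fin N) :
    (amp1 X.transpose * liftF F (A := A) (Rgt d w) * amp2 Y) (i, j) (l, b) -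
      (amp2 Y * liftF F (A := A) (Rgt d w) * amp1 X.transpose) (i, j) (l, b) =
      rttD d w X Y l j i b := by
  simp only [amp1_Rgt_amp2, amp2_Rgt_amp1, rttD, Matrix.transpose_apply]

theorem amp_Rgt_sub' (d : F) (w : Fin N → Fin N → F) (X Y : Matrix (Fin N) (Fin N) A)
    (i j l b : Fin N) :
    (amp2 X.transpose * liftF F (A := A) (Rgt d w) * amp1 Y) (i, j) (l, b) -
      (amp1 Y * liftF F (A := A) (Rgt d w) * amp2 X.transpose) (i, j) (l, b) =
      rttD d w X Y b i j l := by
  have h : ∀ x y : Fin N, dg d x y = dg d y x := fun x y => by simp [dg, eq_comm]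
  simp only [amp1_Rgt_amp2, amp2_Rgt_amp1, rttD, Matrix.transpose_apply, h b i, h j l]

theorem Rtt.partial_transpose {q : F} {X Y : ℕ → Matrix (Fin N) (Fin N) A}
    (h : Rtt q (vx * vy) 1 X Y) :
    g1 (fun r => (X r).transpose) * (KW q N A * g2 Y) =
      g2 Y * (KW q N A * g1 fun r => (X r).transpose) := by
  rw [rtt_iff_rttD q shifts_vx_mul_vy shifts_one] at h
  refine ext_cz fun r s => ?_
  rw [g1, g2, cz_mul_KW_mul, cz_mul_KW_mul_rev]
  have e1 : ∀ t, ez (fun r => amp1 (X r).transpose) t = amp1 (ez X t).transpose := fun t => by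
    rw [← ez_transpose, ← z1_eq_amp1]; rfl
  have e2 : ∀ t, ez (fun r => amp2 (Y r)) t = amp2 (ez Y t) := fun t => by
    rw [← z2_eq_amp2]; rfl
  simp only [e1, e2, ← mul_assoc, Rtilt_eq, Rct_eq]
  ext ⟨i, j⟩ ⟨l, b⟩
  have := h r s l j i b
  rw [← amp_Rgt_sub, ← amp_Rgt_sub, sub_zero, sub_zero] at this
  simp only [Matrix.sub_apply]
  rw [sub_eq_sub_iff_sub_eq_sub, this]

theorem Rtt.partial_transpose' {q : F} {X Y : ℕ → Matrix (Fin N) (Fin N) A}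
    (h : Rtt q (vx * vy) 1 X Y) :
    g2 (fun r => (X r).transpose) * (KW q N A * g1 Y) =
      g1 Y * (KW q N A * g2 fun r => (X r).transpose) := by
  rw [rtt_iff_rttD q shifts_vx_mul_vy shifts_one] at h
  refine ext_cz fun r s => ?_
  rw [g1, g2, cz_mul_KW_mul, cz_mul_KW_mul_rev]
  have e1 : ∀ t, ez (fun r => amp2 (X r).transpose) t = amp2 (ez X t).transpose := fun t => by
    rw [← ez_transpose, ← z2_eq_amp2]; rfl
  have e2 : ∀ t, ez (fun r => amp1 (Y r)) t = amp1 (ez Y t) := fun t => by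
    rw [← z1_eq_amp1]; rfl
  simp only [e1, e2, ← mul_assoc, Rtilt_eq, Rct_eq]
  ext ⟨i, j⟩ ⟨l, b⟩
  have := h s r b i j l
  rw [← amp_Rgt_sub', ← amp_Rgt_sub', sub_zero, sub_zero] at this
  simp only [Matrix.sub_apply]
  rw [sub_eq_sub_iff_sub_eq_sub, this]

theorem central_mul_rearrange {R : Type} [Ring R] {α γ : R} (hα : ∀ w, w * α = α * w)
    (hγ : ∀ w, w * γ = γ * w) (a x c y : R) :
    α * a * (x * (γ * c * y)) = α * γ * (a * x * c * y) ∧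
      y * (γ * c * x) * (α * a) = α * γ * (y * c * x * a) := by
  constructor
  · rw [mul_assoc γ, ← mul_assoc x γ, hγ, mul_assoc α a, ← mul_assoc a, ← mul_assoc a, hγ]
    simp only [mul_assoc]
  · rw [← mul_assoc _ α a, hα, mul_assoc γ, ← mul_assoc y γ, hγ]
    simp only [mul_assoc]

theorem form_reflection_series {q : F} (hq : q ≠ 0) :
    RW q (2 * n) A vy vx * (kst (amp1 (GA q A)) * (KW q (2 * n) A * kst (amp2 (GA q A)))) =
      kst (amp2 (GA q A)) * (KW q (2 * n) A * kst (amp1 (GA q A))) * RW q (2 * n) A vy vx := by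
  have hx := fun w => (shifts_vx (N := 2 * n) (A := A) w).1
  have hy := fun w => (shifts_vy (N := 2 * n) (A := A) w).1
  have hxy := fun w => (shifts_vx_mul_vy (N := 2 * n) (A := A) w).1
  have h1 := fun w => (shifts_one (N := 2 * n) (A := A) w).1
  have p1 : IsRPair q q (wP (N := 2 * n) q) := by simp [IsRPair]
  have p2 : IsRPair q q⁻¹ (wM (N := 2 * n) q) := by simp [IsRPair]
  simp only [RW, KW, sub_mul, mul_sub, (central_mul_rearrange hy hxy _ _ _ _).1,
    (central_mul_rearrange hy h1 _ _ _ _).1, (central_mul_rearrange hx hxy _ _ _ _).1,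
    (central_mul_rearrange hx h1 _ _ _ _).1, (central_mul_rearrange hy hxy _ _ _ _).2,
    (central_mul_rearrange hy h1 _ _ _ _).2, (central_mul_rearrange hx hxy _ _ _ _).2,
    (central_mul_rearrange hx h1 _ _ _ _).2, kst_mul_kst, Rtil_eq, Rc_eq, Rtilt_eq, Rct_eq,
    form_reflection hq p1 p1, form_reflection hq p1 p2, form_reflection hq p2 p1,
    form_reflection hq p2 p2]
  abel

/-- The family `S(u) = T(u) G T̄(u⁻¹)ᵗ`. -/
def Sfam (q : F) (T Tb : ℕ → Matrix (Fin (2 * n)) (Fin (2 * n)) A) :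
    ℕ → Matrix (Fin (2 * n)) (Fin (2 * n)) A :=
  cauchy (fun r => T r * GA q A) fun r => (Tb r).transpose

theorem GA_comm_left (q : F) (X : ℕ → Matrix (Fin (2 * n)) (Fin (2 * n)) A) :
    kst (amp1 (GA q A)) * g2 X = g2 X * kst (amp1 (GA q A)) := by
  rw [g2, kst_mul_ser2, ser2_mul_kst]
  congr 1
  ext r ⟨i, j⟩ ⟨l, b⟩
  rw [amp1_mul_amp2, amp2_mul_amp1, GA, Matrix.map_apply, Algebra.commutes]

theorem GA_comm_right (q : F) (X : ℕ → Matrix (Fin (2 * n)) (Fin (2 * n)) A) :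
    kst (amp2 (GA q A)) * g1 X = g1 X * kst (amp2 (GA q A)) := by
  rw [g1, kst_mul_ser1, ser1_mul_kst]
  congr 1
  ext r ⟨i, j⟩ ⟨l, b⟩
  rw [amp1_mul_amp2, amp2_mul_amp1, GA, Matrix.map_apply, Algebra.commutes]

theorem g1_Sfam (q : F) (T Tb : ℕ → Matrix (Fin (2 * n)) (Fin (2 * n)) A) :
    g1 (Sfam q T Tb) = g1 T * kst (amp1 (GA q A)) * g1 fun r => (Tb r).transpose := by
  rw [Sfam, g1_cauchy, g1, g1, g1, ser1_mul_kst]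
  simp only [amp1_mul]

theorem g2_Sfam (q : F) (T Tb : ℕ → Matrix (Fin (2 * n)) (Fin (2 * n)) A) :
    g2 (Sfam q T Tb) = g2 T * kst (amp2 (GA q A)) * g2 fun r => (Tb r).transpose := by
  rw [Sfam, g2_cauchy, g2, g2, g2, ser2_mul_kst]
  simp only [amp2_mul]

theorem AffRep.refl {q : F} (hq : q ≠ 0) {T Tb : ℕ → Matrix (Fin (2 * n)) (Fin (2 * n)) A}
    (h : AffRep q T Tb) : Refl q (Sfam q T Tb) := by
  have H1 : RW q (2 * n) A vy vx * (g1 T * g2 T) = _ := h.TT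
  have H2 : RW q (2 * n) A vy vx * _ = _ := h.TbTb.transpose
  have H3 := h.TbT.partial_transpose
  have H3' := h.TbT.partial_transpose'
  have HG := form_reflection_series (n := n) (A := A) hq
  have c1 := GA_comm_left q T
  have c2 := GA_comm_right q fun r => (Tb r).transpose
  have c3 := GA_comm_right q T
  have c4 := GA_comm_left q fun r => (Tb r).transpose
  rw [Refl, g1_Sfam, g2_Sfam]
  generalize RW q (2 * n) A vy vx = M at *
  generalize KW q (2 * n) A = K at *
  generalize (g1 fun r => (Tb r).transpose) = b1 at *
  generalize (g2 fun r => (Tb r).transpose) = b2 at *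
  generalize g1 T = t1 at *
  generalize g2 T = t2 at *
  generalize kst (amp1 (GA q A)) = G1 at *
  generalize kst (amp2 (GA q A)) = G2 at *
  calc M * (t1 * G1 * b1 * (K * (t2 * G2 * b2)))
      = M * t1 * G1 * (b1 * (K * t2)) * G2 * b2 := by simp only [mul_assoc]
    _ = M * t1 * (G1 * t2) * K * b1 * G2 * b2 := by rw [H3]; simp only [mul_assoc]
    _ = M * (t1 * t2) * G1 * K * b1 * G2 * b2 := by rw [c1]; simp only [mul_assoc]
    _ = t2 * t1 * M * G1 * K * (b1 * G2) * b2 := by rw [H1]; simp only [mul_assoc]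
    _ = t2 * t1 * (M * (G1 * (K * G2))) * b1 * b2 := by rw [← c2]; simp only [mul_assoc]
    _ = t2 * t1 * G2 * K * G1 * (M * (b1 * b2)) := by rw [HG]; simp only [mul_assoc]
    _ = t2 * (t1 * G2) * K * (G1 * b2) * b1 * M := by rw [H2]; simp only [mul_assoc]
    _ = t2 * G2 * (t1 * (K * b2)) * G1 * b1 * M := by rw [c4, ← c3]; simp only [mul_assoc]
    _ = t2 * G2 * b2 * (K * (t1 * G1 * b1)) * M := by rw [← H3']; simp only [mul_assoc]

end ReflectionFromRtt

section SymplecticRepresentations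

variable {F : Type} [Field F] {n : ℕ} {A : Type} [Ring A] [Algebra F A]

theorem sum_fin_two_mul {M : Type*} [AddCommMonoid M] (f : Fin (2 * n) → M) :
    ∑ i, f i = ∑ k, (f (fe n k) + f (fo n k)) := by
  have hb : Function.Bijective (Sum.elim (fe n) (fo n)) := by
    constructor
    · rintro (x | x) (y | y) h
      · simpa [fe_inj] using h
      · exact absurd h (fe_ne_fo _ _)
      · exact absurd h (fo_ne_fe _ _)
      · simpa [fo_inj] using h
    · intro i
      rcases fe_or_fo i with ⟨k, rfl⟩ | ⟨k, rfl⟩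
      · exact ⟨Sum.inl k, rfl⟩
      · exact ⟨Sum.inr k, rfl⟩
  rw [← (Equiv.ofBijective _ hb).sum_comp, Fintype.sum_sum_type, Finset.sum_add_distrib]
  rfl

/-- The constant term of `T(u) G T̄(u⁻¹)ᵗ`, the product being taken over two families. -/
def bil (q : F) (X Y : Matrix (Fin (2 * n)) (Fin (2 * n)) A) (i j : Fin (2 * n)) : A :=
  ∑ k, (q • (X i (fe n k) * Y j (fo n k)) - X i (fo n k) * Y j (fe n k))

theorem mul_GA_mul_transpose (q : F) (X Y : Matrix (Fin (2 * n)) (Fin (2 * n)) A)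
    (i j : Fin (2 * n)) :
    (X * (GA q A : Matrix (Fin (2 * n)) (Fin (2 * n)) A) * Y.transpose : Matrix _ _ A) i j =
      bil q X Y i j := by
  have h : ∀ a, (X * GA q A : Matrix _ _ A) i a = ge q (pr a) • X i (pr a) := fun a => by
    rw [Matrix.mul_apply, Finset.sum_eq_single (pr a)]
    · simp only [GA, Matrix.map_apply, Gm_apply, pr_pr, if_true]
      rw [← Algebra.commutes, Algebra.smul_def]
    · intro b _ hb
      have : ¬ a = pr b := fun h => hb (pr_eq_comm.1 h)
      simp [GA, Gm_apply, this]
    · simp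
  rw [Matrix.mul_apply, sum_fin_two_mul]
  refine Finset.sum_congr rfl fun k _ => ?_
  simp only [h, pr_fe, pr_fo, ge_fe, ge_fo, Matrix.transpose_apply, neg_smul, one_smul, neg_mul,
    smul_mul_assoc]
  abel

theorem Sfam_apply (q : F) (T Tb : ℕ → Matrix (Fin (2 * n)) (Fin (2 * n)) A) (r : ℕ)
    (i j : Fin (2 * n)) :
    Sfam q T Tb r i j = ∑ p ∈ Finset.range (r + 1), bil q (T p) (Tb (r - p)) i j := by
  simp only [Sfam, cauchy, Matrix.sum_apply, mul_GA_mul_transpose]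

theorem ScoefSp_eq (q : F) (r : ℕ) (i j : Fin (2 * n)) :
    ScoefSp F q n r i j = Sfam q (TU F q (2 * n)) (TbU F q (2 * n)) r i j := by
  rw [Sfam_apply, ScoefSp, Finset.sum_comm]
  simp only [bil, TU, TbU, Matrix.of_apply, Algebra.smul_def]

/-- A matrix family together with inverses satisfying the defining relations of `𝒮`. -/
structure SpRep (q : F) (S : ℕ → Matrix (Fin (2 * n)) (Fin (2 * n)) A) (c : Fin n → A) :
    Prop where
  tri : ∀ i j : Fin (2 * n), i < j → ¬(i.val % 2 = 0 ∧ j.val = i.val + 1) → S 0 i j = 0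
  quad : ∀ k, S 0 (fo n k) (fo n k) * S 0 (fe n k) (fe n k) =
    q ^ 2 • (S 0 (fo n k) (fe n k) * S 0 (fe n k) (fo n k)) + algebraMap F A (q ^ 3)
  invR : ∀ k, S 0 (fe n k) (fo n k) * c k = 1
  invL : ∀ k, c k * S 0 (fe n k) (fo n k) = 1
  refl : Refl q S

theorem liftAlgHom_spRelations {q : F} {S : ℕ → Matrix (Fin (2 * n)) (Fin (2 * n)) A}
    {c : Fin n → A} (h : SpRep q S c) ⦃x y : FreeAlgebra F (ASpGen n)⦄ (hxy : ASpRel F q n x y) :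
    FreeAlgebra.lift F (Sum.elim (fun g : ℕ × Fin (2 * n) × Fin (2 * n) => S g.1 g.2.1 g.2.2) c) x =
      FreeAlgebra.lift F
        (Sum.elim (fun g : ℕ × Fin (2 * n) × Fin (2 * n) => S g.1 g.2.1 g.2.2) c) y := by
  set f := FreeAlgebra.lift F
    (Sum.elim (fun g : ℕ × Fin (2 * n) × Fin (2 * n) => S g.1 g.2.1 g.2.2) c) with hf
  have hS : (fun r => (SfreeASp F n r).map f) = S := by
    ext r i j; simp [SfreeASp, hf]
  cases hxy with
  | tri i j hij hij' => simpa [hf] using h.tri i j hij hij'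
  | quad k => simpa [hf, Algebra.smul_def] using h.quad k
  | invR k => simpa [hf] using h.invR k
  | invL k => simpa [hf] using h.invL k
  | refl a b p r =>
    have hL : f (affLHS F q (SfreeASp F n) a b p r) = affLHS F q S a b p r := by
      rw [← Matrix.map_apply (f := f), map_affLHS, hS]
    have hR : f (affRHS F q (SfreeASp F n) a b p r) = affRHS F q S a b p r := by
      rw [← Matrix.map_apply (f := f), map_affRHS, hS]
    rw [hL, hR, (refl_iff q S).1 h.refl]

/-- The homomorphism from `𝒮` given by a family satisfying its relations. -/
def SpRep.lift {q : F} {S : ℕ → Matrix (Fin (2 * n)) (Fin (2 * n)) A} {c : Fin n → A}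
    (h : SpRep q S c) : AlgASp F q n →ₐ[F] A :=
  RingQuot.liftAlgHom F ⟨_, liftAlgHom_spRelations h⟩

theorem SpRep.lift_sASp {q : F} {S : ℕ → Matrix (Fin (2 * n)) (Fin (2 * n)) A} {c : Fin n → A}
    (h : SpRep q S c) (r : ℕ) (i j : Fin (2 * n)) : h.lift (sASp F q n r i j) = S r i j := by
  simp [SpRep.lift, sASp]

theorem SpRep.lift_sInvASp {q : F} {S : ℕ → Matrix (Fin (2 * n)) (Fin (2 * n)) A} {c : Fin n → A}
    (h : SpRep q S c) (k : Fin n) : h.lift (sInvASp F q n k) = c k := by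
  simp [SpRep.lift, sInvASp]

/-- The generator matrices of `𝒮`. -/
def SUniv (F : Type) [Field F] (q : F) (n r : ℕ) :
    Matrix (Fin (2 * n)) (Fin (2 * n)) (AlgASp F q n) :=
  Matrix.of (sASp F q n r)

theorem spRep_univ (F : Type) [Field F] (q : F) (n : ℕ) :
    SpRep q (SUniv F q n) (sInvASp F q n) := by
  have key : ∀ {x y}, ASpRel F q n x y → RingQuot.mkAlgHom F (ASpRel F q n) x =
      RingQuot.mkAlgHom F (ASpRel F q n) y := fun h => RingQuot.mkAlgHom_rel F h
  have hS : (fun r => (SfreeASp F n r).map (RingQuot.mkAlgHom F (ASpRel F q n))) = SUniv F q n :=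
    rfl
  constructor
  · intro i j h h'
    simpa [SUniv, sASp] using key (ASpRel.tri i j h h')
  · intro k
    simpa only [SUniv, sASp, Algebra.smul_def, map_mul, map_add, AlgHom.commutes, Matrix.of_apply]
      using key (ASpRel.quad k)
  · intro k
    simpa [SUniv, sASp, sInvASp] using key (ASpRel.invR k)
  · intro k
    simpa [SUniv, sASp, sInvASp] using key (ASpRel.invL k)
  · rw [refl_iff]
    intro a b
    rw [← hS, ← map_affLHS, ← map_affRHS]
    ext p r
    exact key (ASpRel.refl a b p r)

theorem SUniv_adjoin (F : Type) [Field F] (q : F) (n : ℕ) :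
    Algebra.adjoin F ({x | ∃ r i j, x = sASp F q n r i j} ∪ Set.range (sInvASp F q n)) = ⊤ := by
  have h : (RingQuot.mkAlgHom F (ASpRel F q n)).range = ⊤ :=
    (AlgHom.range_eq_top _).2 (RingQuot.mkAlgHom_surjective F _)
  rw [eq_top_iff, ← h, ← Algebra.map_top, ← FreeAlgebra.adjoin_range_ι, AlgHom.map_adjoin]
  refine Algebra.adjoin_mono ?_
  rintro _ ⟨_, ⟨g | k, rfl⟩, rfl⟩
  · exact Or.inl ⟨g.1, g.2.1, g.2.2, rfl⟩
  · exact Or.inr ⟨k, rfl⟩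

section ConstantTerm

variable {q : F} {T Tb : ℕ → Matrix (Fin (2 * n)) (Fin (2 * n)) A} (h : AffRep q T Tb)

include h

theorem AffRep.rttD_TbT (i j l b : Fin (2 * n)) : rttD q (wP q) (Tb 0) (T 0) i j l b = 0 := by
  have := (rtt_iff_rttD q shifts_vx_mul_vy shifts_one Tb T).1 h.TbT 0 0 i j l b
  simpa [ez] using this.symm

theorem AffRep.rttD_TbTb (i j l b : Fin (2 * n)) : rttD q (wP q) (Tb 0) (Tb 0) i j l b = 0 := by
  have := (rtt_iff_rttD q shifts_vx shifts_vy Tb Tb).1 h.TbTb 0 1 i j l b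
  simpa [ez] using this.symm

theorem AffRep.bil_zero_tri (i j : Fin (2 * n)) (hij : i < j)
    (hij' : ¬(i.val % 2 = 0 ∧ j.val = i.val + 1)) : bil q (T 0) (Tb 0) i j = 0 := by
  refine Finset.sum_eq_zero fun k _ => ?_
  have h1 : T 0 i (fe n k) * Tb 0 j (fo n k) = 0 := by
    by_cases h1 : i < fe n k
    · rw [h.t0 _ _ h1, zero_mul]
    by_cases h2 : fo n k < j
    · rw [h.tb0 _ _ h2, mul_zero]
    simp only [fe, fo, Fin.lt_def] at h1 h2 hij
    omega
  have h2 : T 0 i (fo n k) * Tb 0 j (fe n k) = 0 := by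
    by_cases h1 : i < fo n k
    · rw [h.t0 _ _ h1, zero_mul]
    by_cases h2 : fe n k < j
    · rw [h.tb0 _ _ h2, mul_zero]
    simp only [fe, fo, Fin.lt_def] at h1 h2 hij
    omega
  rw [h1, h2, smul_zero, sub_zero]

/-- The constant term of `S(u)` on a diagonal block. -/
theorem AffRep.bil_zero_block (k : Fin n) (i j : Fin (2 * n)) (hi : i = fe n k ∨ i = fo n k)
    (hj : j = fe n k ∨ j = fo n k) : bil q (T 0) (Tb 0) i j =
      q • (T 0 i (fe n k) * Tb 0 j (fo n k)) - T 0 i (fo n k) * Tb 0 j (fe n k) := by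
  rw [bil, Finset.sum_eq_single k]
  · intro m _ hm
    rcases lt_or_gt_of_ne hm with hm | hm
    · have h1 : Tb 0 j (fo n m) = 0 := h.tb0 _ _ (by
        rcases hj with rfl | rfl <;> simp [fo_lt_fe, fo_lt_fo, hm])
      have h2 : Tb 0 j (fe n m) = 0 := h.tb0 _ _ (by
        rcases hj with rfl | rfl <;> simp [fe_lt_fe, fe_lt_fo, hm, hm.le])
      rw [h1, h2]; simp
    · have h1 : T 0 i (fo n m) = 0 := h.t0 _ _ (by
        rcases hi with rfl | rfl <;> simp [fe_lt_fo, fo_lt_fo, hm, hm.le])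
      have h2 : T 0 i (fe n m) = 0 := h.t0 _ _ (by
        rcases hi with rfl | rfl <;> simp [fe_lt_fe, fo_lt_fe, hm])
      rw [h1, h2]; simp
  · simp

theorem AffRep.spRep (hq : q ≠ 0) (c : Fin n → A)
    (hc : ∀ k, Sfam q T Tb 0 (fe n k) (fo n k) * c k = 1 ∧
      c k * Sfam q T Tb 0 (fe n k) (fo n k) = 1) : SpRep q (Sfam q T Tb) c := by
  have h0 : ∀ i j, Sfam q T Tb 0 i j = bil q (T 0) (Tb 0) i j := fun i j => by
    simp [Sfam_apply]
  refine ⟨fun i j hij hij' => ?_, fun k => ?_, fun k => (hc k).1, fun k => (hc k).2, h.refl hq⟩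
  · rw [h0, h.bil_zero_tri i j hij hij']
  · have z1 : T 0 (fe n k) (fo n k) = 0 := h.t0 _ _ (fe_lt_fo.2 le_rfl)
    have z2 : Tb 0 (fo n k) (fe n k) = 0 := h.tb0 _ _ (fe_lt_fo.2 le_rfl)
    rw [h0, h0, h0, h0, h.bil_zero_block k _ _ (Or.inr rfl) (Or.inr rfl),
      h.bil_zero_block k _ _ (Or.inl rfl) (Or.inl rfl),
      h.bil_zero_block k _ _ (Or.inr rfl) (Or.inl rfl),
      h.bil_zero_block k _ _ (Or.inl rfl) (Or.inr rfl), z1, z2]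
    have eo : ¬ fo n k < fe n k := by simp [fo_lt_fe]
    have oe : fe n k < fo n k := fe_lt_fo.2 le_rfl
    have c1 := h.rttD_TbT (fe n k) (fe n k) (fo n k) (fe n k)
    have c2 := h.rttD_TbTb (fo n k) (fe n k) (fo n k) (fo n k)
    have c3 := h.rttD_TbT (fo n k) (fe n k) (fo n k) (fe n k)
    simp only [rttD, dg, wP, lt_irrefl, if_false, if_true, fo_ne_fe, eo, oe, z1, z2,
      zero_smul, add_zero, one_smul, zero_mul, smul_zero, sub_eq_zero] at c1 c2 c3
    have e1 := h.tb_t (fe n k)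
    have e2 := h.t_tb (fo n k)
    generalize T 0 (fe n k) (fe n k) = a at *
    generalize T 0 (fo n k) (fo n k) = d at *
    generalize T 0 (fo n k) (fe n k) = x at *
    generalize Tb 0 (fe n k) (fe n k) = a' at *
    generalize Tb 0 (fo n k) (fo n k) = d' at *
    generalize Tb 0 (fe n k) (fo n k) = y at *
    have e3 : d' * (a * y) = q ^ 2 • (y * (a * d')) := by
      rw [← c1, mul_smul_comm, ← mul_assoc, c2, smul_mul_assoc, mul_assoc, c3, smul_smul, sq]
    have e4 : d * a' * (a * d') = 1 := by
      rw [mul_assoc, ← mul_assoc a', e1, one_mul, e2]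
    simp only [mul_zero, zero_mul, sub_zero, sub_mul, smul_mul_assoc, mul_smul_comm, smul_smul,
      smul_sub, e4, mul_assoc, e3]
    rw [Algebra.algebraMap_eq_smul_one, ← mul_assoc x y]
    simp only [mul_assoc]
    rw [show q * (q * q ^ 2) = q ^ 2 * (q * q) by ring, show q ^ 2 * q = q ^ 3 by ring]
    abel

end ConstantTerm

end SymplecticRepresentations

section ReflectionEntries

variable {F : Type} [Field F] {n N : ℕ} {B : Type} [Ring B] [Algebra F B]

/-- The entries of `R X₁ R'ᵗ Y₂ - Y₂ R'ᵗ X₁ R`. -/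
def refD (d : F) (w : Fin N → Fin N → F) (d' : F) (w' : Fin N → Fin N → F)
    (X Y : Matrix (Fin N) (Fin N) B) (i j l b : Fin N) : B :=
  (dg d i j • (dg d' l j • (X i l * Y j b) + w' l j • (X i j * Y l b)) +
      w i j • (dg d' l i • (X j l * Y i b) + w' l i • (X j i * Y l b))) -
    (dg d l b • (dg d' i b • (Y j b * X i l) + w' b i • (Y j i * X b l)) +
      w b l • (dg d' i l • (Y j l * X i b) + w' l i • (Y j i * X l b)))

theorem refD_eq_sub (d : F) (w : Fin N → Fin N → F) (d' : F) (w' : Fin N → Fin N → F)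
    (X Y : Matrix (Fin N) (Fin N) B) (i j l b : Fin N) :
    (liftF F (A := B) (Rg d w) * amp1 X * liftF F (A := B) (Rgt d' w') * amp2 Y) (i, j) (l, b) -
      (amp2 Y * liftF F (A := B) (Rgt d' w') * amp1 X * liftF F (A := B) (Rg d w)) (i, j) (l, b) =
      refD d w d' w' X Y i j l b := by
  rw [mul_liftF_Rg, mul_assoc, mul_assoc, liftF_Rg_mul, ← mul_assoc]
  simp only [Prod.swap, amp1_Rgt_amp2, amp2_Rgt_amp1, refD]

theorem affRefl_sub (q : F) (S : ℕ → Matrix (Fin N) (Fin N) B) (r s : ℤ) (i j l b : Fin N) :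
    affLHS F q S (-r) (2 - s) (i, j) (l, b) - affRHS F q S (-r) (2 - s) (i, j) (l, b) =
      refD q⁻¹ (wM q) q⁻¹ (wM q) (ez S r) (ez S (s - 2)) i j l b -
      refD q⁻¹ (wM q) q (wP q) (ez S (r + 1)) (ez S (s - 1)) i j l b -
      refD q (wP q) q⁻¹ (wM q) (ez S (r - 1)) (ez S (s - 1)) i j l b +
      refD q (wP q) q (wP q) (ez S r) (ez S s) i j l b := by
  simp only [affLHS, affRHS, z1_eq_amp1, z2_eq_amp2, ← refD_eq_sub, Matrix.sub_apply,
    Matrix.add_apply, Rtil_eq, Rc_eq, Rct_eq, Rtilt_eq]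
  rw [show - -r = r by ring, show -(2 - s) = s - 2 by ring, show 1 - -r = r + 1 by ring,
    show 1 - (2 - s) = s - 1 by ring, show -1 - -r = r - 1 by ring,
    show 2 - (2 - s) = s by ring]
  abel

theorem Refl.recursion {q : F} {S : ℕ → Matrix (Fin N) (Fin N) B} (h : Refl q S) (r s : ℤ)
    (i j l b : Fin N) :
    refD q (wP q) q (wP q) (ez S r) (ez S s) i j l b =
      refD q⁻¹ (wM q) q (wP q) (ez S (r + 1)) (ez S (s - 1)) i j l b +
      refD q (wP q) q⁻¹ (wM q) (ez S (r - 1)) (ez S (s - 1)) i j l b -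
      refD q⁻¹ (wM q) q⁻¹ (wM q) (ez S r) (ez S (s - 2)) i j l b := by
  have h1 := affRefl_sub q S r s i j l b
  rw [(refl_iff q S).1 h, sub_self] at h1
  rw [eq_comm, ← sub_eq_zero, ← neg_eq_zero, h1]
  abel

theorem Refl.zero {q : F} {S : ℕ → Matrix (Fin N) (Fin N) B} (h : Refl q S) (r : ℕ)
    (i j l b : Fin N) : refD q (wP q) q (wP q) (S r) (S 0) i j l b = 0 := by
  have h1 := h.recursion r 0 i j l b
  rw [ez_of_neg _ (by norm_num : (0 : ℤ) - 1 < 0), ez_of_neg _ (by norm_num : (0 : ℤ) - 2 < 0)]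
    at h1
  have h0 : ez S 0 = S 0 := ez_natCast S 0
  rw [h0, ez_natCast] at h1
  rw [h1]
  simp [refD]

theorem refD_form {q : F} (hq : q ≠ 0) {d d' : F} {w w' : Fin (2 * n) → Fin (2 * n) → F}
    (h : IsRPair q d w) (h' : IsRPair q d' w') (i j l b : Fin (2 * n)) :
    refD (B := B) d w d' w' (GA q B) (GA q B) i j l b = 0 := by
  rw [← refD_eq_sub, sub_eq_zero]
  have := congrFun (congrFun (form_reflection (A := B) hq h h') (i, j)) (l, b)
  simpa only [mul_assoc] using this

theorem refD_add_left (d : F) (w : Fin N → Fin N → F) (d' : F) (w' : Fin N → Fin N → F)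
    (X X' Y : Matrix (Fin N) (Fin N) B) (i j l b : Fin N) :
    refD d w d' w' (X + X') Y i j l b =
      refD d w d' w' X Y i j l b + refD d w d' w' X' Y i j l b := by
  simp only [refD, Matrix.add_apply, add_mul, mul_add, smul_add]
  abel

theorem refD_add_right (d : F) (w : Fin N → Fin N → F) (d' : F) (w' : Fin N → Fin N → F)
    (X Y Y' : Matrix (Fin N) (Fin N) B) (i j l b : Fin N) :
    refD d w d' w' X (Y + Y') i j l b =
      refD d w d' w' X Y i j l b + refD d w d' w' X Y' i j l b := by
  simp only [refD, Matrix.add_apply, add_mul, mul_add, smul_add]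
  abel

theorem refD_zero_left (d : F) (w : Fin N → Fin N → F) (d' : F) (w' : Fin N → Fin N → F)
    (Y : Matrix (Fin N) (Fin N) B) (i j l b : Fin N) : refD d w d' w' 0 Y i j l b = 0 := by
  simp [refD]

theorem refD_zero_right (d : F) (w : Fin N → Fin N → F) (d' : F) (w' : Fin N → Fin N → F)
    (X : Matrix (Fin N) (Fin N) B) (i j l b : Fin N) : refD d w d' w' X 0 i j l b = 0 := by
  simp [refD]

end ReflectionEntries

section Deformation

variable {F : Type} [Field F] {n N : ℕ} {B : Type} [Ring B] [Algebra F B]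
variable {A : Type} [CommRing A] [Algebra A F] [Algebra A B] [IsScalarTower A F B]

theorem algebraMap_mul_eq_smul (a : A) (x : B) : algebraMap A B a * x = a • x :=
  (Algebra.smul_def a x).symm

theorem mul_algebraMap_eq_smul (a : A) (x : B) : x * algebraMap A B a = a • x := by
  rw [Algebra.smul_def, Algebra.commutes]

theorem refD_smul_left (c : A) (d : F) (w : Fin N → Fin N → F) (d' : F) (w' : Fin N → Fin N → F)
    (X Y : Matrix (Fin N) (Fin N) B) (i j l b : Fin N) :
    refD d w d' w' (c • X) Y i j l b = c • refD d w d' w' X Y i j l b := by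
  simp only [refD, Matrix.smul_apply, smul_mul_assoc, mul_smul_comm, smul_sub, smul_add,
    smul_comm c]

theorem refD_smul_right (c : A) (d : F) (w : Fin N → Fin N → F) (d' : F) (w' : Fin N → Fin N → F)
    (X Y : Matrix (Fin N) (Fin N) B) (i j l b : Fin N) :
    refD d w d' w' X (c • Y) i j l b = c • refD d w d' w' X Y i j l b := by
  simp only [refD, Matrix.smul_apply, smul_mul_assoc, mul_smul_comm, smul_sub, smul_add,
    smul_comm c]

theorem IsRPair.coeff {u : Aˣ} {q d : F} (hu : algebraMap A F u = q)
    {w : Fin (2 * n) → Fin (2 * n) → F} (h : IsRPair q d w) :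
    (∀ i j : Fin (2 * n), ∃ a : A, dg d i j = algebraMap A F (1 + (u - 1) * a)) ∧
      ∀ i j, ∃ a : A, w i j = algebraMap A F ((u - 1) * a) := by
  have hui : algebraMap A F (u⁻¹ : Aˣ) = q⁻¹ := by
    refine eq_inv_of_mul_eq_one_left ?_
    rw [← hu, ← map_mul, Units.inv_mul, map_one]
  have hq : q ≠ 0 := by
    rw [← hu]; exact (u.isUnit.map (algebraMap A F)).ne_zero
  rcases h with ⟨rfl, rfl⟩ | ⟨rfl, rfl⟩
  · constructor
    · intro i j
      refine ⟨if i = j then 1 else 0, ?_⟩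
      unfold dg; split_ifs <;> simp [hu]
    · intro i j
      refine ⟨if i < j then 1 + (u⁻¹ : Aˣ) else 0, ?_⟩
      unfold wP; split_ifs
      · simp only [map_mul, map_sub, map_add, hu, hui, map_one]; field_simp; ring
      · simp
  · constructor
    · intro i j
      refine ⟨if i = j then -(u⁻¹ : Aˣ) else 0, ?_⟩
      unfold dg; split_ifs
      · simp only [map_mul, map_sub, map_add, map_neg, hu, hui, map_one]; field_simp; ring
      · simp
    · intro i j
      refine ⟨if j < i then -(1 + (u⁻¹ : Aˣ)) else 0, ?_⟩
      unfold wM; split_ifs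
      · simp only [map_mul, map_sub, map_add, map_neg, hu, hui, map_one]; field_simp; ring
      · simp

theorem refD_eq_commutator {u : Aˣ} {q d d' : F} (hu : algebraMap A F u = q)
    {w w' : Fin (2 * n) → Fin (2 * n) → F} (h : IsRPair q d w) (h' : IsRPair q d' w')
    {X Y : Matrix (Fin (2 * n)) (Fin (2 * n)) B} {P : Submodule A B}
    (h1 : ∀ i j k l, X i j * Y k l ∈ P) (h2 : ∀ i j k l, Y i j * X k l ∈ P)
    (i j l b : Fin (2 * n)) :
    ∃ p ∈ P, refD d w d' w' X Y i j l b = X i l * Y j b - Y j b * X i l + ((u : A) - 1) • p := by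
  obtain ⟨a1, e1⟩ := (h.coeff hu).1 i j
  obtain ⟨a2, e2⟩ := (h'.coeff hu).1 l j
  obtain ⟨a3, e3⟩ := (h'.coeff hu).2 l j
  obtain ⟨a4, e4⟩ := (h.coeff hu).2 i j
  obtain ⟨a5, e5⟩ := (h'.coeff hu).1 l i
  obtain ⟨a6, e6⟩ := (h'.coeff hu).2 l i
  obtain ⟨b1, f1⟩ := (h.coeff hu).1 l b
  obtain ⟨b2, f2⟩ := (h'.coeff hu).1 i b
  obtain ⟨b3, f3⟩ := (h'.coeff hu).2 b i
  obtain ⟨b4, f4⟩ := (h.coeff hu).2 b l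
  obtain ⟨b5, f5⟩ := (h'.coeff hu).1 i l
  refine ⟨(a1 + a2 + (u - 1) * a1 * a2) • (X i l * Y j b) +
      ((1 + (u - 1) * a1) * a3) • (X i j * Y l b) + (a4 * (1 + (u - 1) * a5)) • (X j l * Y i b) +
      (a4 * ((u - 1) * a6)) • (X j i * Y l b) -
      ((b1 + b2 + (u - 1) * b1 * b2) • (Y j b * X i l) +
      ((1 + (u - 1) * b1) * b3) • (Y j i * X b l) + (b4 * (1 + (u - 1) * b5)) • (Y j l * X i b) +
      (b4 * ((u - 1) * a6)) • (Y j i * X l b)), ?_, ?_⟩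
  · exact P.sub_mem
      (P.add_mem (P.add_mem (P.add_mem (P.smul_mem _ (h1 _ _ _ _)) (P.smul_mem _ (h1 _ _ _ _)))
        (P.smul_mem _ (h1 _ _ _ _))) (P.smul_mem _ (h1 _ _ _ _)))
      (P.add_mem (P.add_mem (P.add_mem (P.smul_mem _ (h2 _ _ _ _)) (P.smul_mem _ (h2 _ _ _ _)))
        (P.smul_mem _ (h2 _ _ _ _))) (P.smul_mem _ (h2 _ _ _ _)))
  · simp only [refD, e1, e2, e3, e4, e5, e6, f1, f2, f3, f4, f5, algebraMap_smul]
    module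

/-- A word in the alphabet of generators has weight the sum of its series indices. -/
def wt (l : List (ℕ × Fin N × Fin N)) : ℕ := (l.map Prod.fst).sum

/-- The value of a word. -/
def wprod (σ : ℕ → Matrix (Fin N) (Fin N) B) (l : List (ℕ × Fin N × Fin N)) : B :=
  (l.map fun g => σ g.1 g.2.1 g.2.2).prod

theorem wprod_append (σ : ℕ → Matrix (Fin N) (Fin N) B) (l m : List (ℕ × Fin N × Fin N)) :
    wprod σ (l ++ m) = wprod σ l * wprod σ m := by simp [wprod]

theorem wprod_cons (σ : ℕ → Matrix (Fin N) (Fin N) B) (g : ℕ × Fin N × Fin N)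
    (m : List (ℕ × Fin N × Fin N)) :
    wprod σ (g :: m) = σ g.1 g.2.1 g.2.2 * wprod σ m := by simp [wprod]

@[simp]
theorem wprod_nil (σ : ℕ → Matrix (Fin N) (Fin N) B) : wprod σ [] = 1 := rfl

theorem wt_append (l m : List (ℕ × Fin N × Fin N)) : wt (l ++ m) = wt l + wt m := by
  simp [wt]

theorem wt_cons (g : ℕ × Fin N × Fin N) (m : List (ℕ × Fin N × Fin N)) :
    wt (g :: m) = g.1 + wt m := by
  simp [wt]

variable (A) in
/-- The span of the words of length at most `d` and weight at most `w`. -/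
def Zf (σ : ℕ → Matrix (Fin N) (Fin N) B) (d w : ℕ) : Submodule A B :=
  Submodule.span A {x | ∃ l, l.length ≤ d ∧ wt l ≤ w ∧ wprod σ l = x}

variable {σ : ℕ → Matrix (Fin N) (Fin N) B}

theorem Zf_mono {d d' w w' : ℕ} (hd : d ≤ d') (hw : w ≤ w') : Zf A σ d w ≤ Zf A σ d' w' :=
  Submodule.span_mono fun _ ⟨l, h1, h2, h3⟩ => ⟨l, h1.trans hd, h2.trans hw, h3⟩

theorem wprod_mem_Zf (l : List (ℕ × Fin N × Fin N)) {d w : ℕ} (hd : l.length ≤ d)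
    (hw : wt l ≤ w) : wprod σ l ∈ Zf A σ d w :=
  Submodule.subset_span ⟨l, hd, hw, rfl⟩

theorem letter_mem_Zf (r : ℕ) (i j : Fin N) : σ r i j ∈ Zf A σ 1 r := by
  have := wprod_mem_Zf (A := A) (σ := σ) [(r, i, j)] (d := 1) (w := r) (by simp) (by simp [wt])
  simpa [wprod] using this

theorem Zf_mul (d d' w w' : ℕ) : Zf A σ d w * Zf A σ d' w' ≤ Zf A σ (d + d') (w + w') := by
  rw [Zf, Zf, Submodule.span_mul_span]
  refine Submodule.span_le.2 ?_
  rintro _ ⟨_, ⟨l, h1, h2, rfl⟩, _, ⟨m, h3, h4, rfl⟩, rfl⟩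
  refine Submodule.subset_span ⟨l ++ m, ?_, ?_, wprod_append σ l m⟩
  · rw [List.length_append]; omega
  · rw [wt_append]; omega

theorem mul_mem_Zf {d d' w w' : ℕ} {x y : B} (hx : x ∈ Zf A σ d w) (hy : y ∈ Zf A σ d' w') :
    x * y ∈ Zf A σ (d + d') (w + w') := Zf_mul d d' w w' (Submodule.mul_mem_mul hx hy)

end Deformation

section Commutators

variable {F : Type} [Field F] {n : ℕ} {B : Type} [Ring B] [Algebra F B]
variable {A : Type} [CommRing A] [Algebra A F] [Algebra A B] [IsScalarTower A F B]
variable {u : Aˣ} {q : F} {S σ : ℕ → Matrix (Fin (2 * n)) (Fin (2 * n)) B}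

/-- The constant term `G` as a series. -/
def Gser (q : F) (B : Type) [Ring B] [Algebra F B] (r : ℕ) :
    Matrix (Fin (2 * n)) (Fin (2 * n)) B := if r = 0 then GA q B else 0

theorem GA_apply (hu : algebraMap A F u = q) (i j : Fin (2 * n)) :
    ∃ a : A, GA q B i j = algebraMap A B a := by
  refine ⟨if j = pr i then (if i.val % 2 = 0 then (u : A) else -1) else 0, ?_⟩
  rw [IsScalarTower.algebraMap_apply A F B, GA, Matrix.map_apply, Gm_apply, ge]
  split_ifs <;> simp [hu]

theorem Gser_apply (hu : algebraMap A F u = q) (r : ℕ) (i j : Fin (2 * n)) :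
    ∃ a : A, Gser q B r i j = algebraMap A B a := by
  unfold Gser; split_ifs
  · exact GA_apply hu i j
  · exact ⟨0, by simp⟩

theorem refD_shift (hu : algebraMap A F u = q) {d d' : F}
    {w w' : Fin (2 * n) → Fin (2 * n) → F} (h : IsRPair q d w) (h' : IsRPair q d' w')
    (hS : ∀ r, S r = Gser q B r + ((u : A) - 1) • σ r) {I : Ideal A} (hI : (u : A) - 1 ∈ I)
    (r s : ℕ) (i j l b : Fin (2 * n)) :
    ∃ y ∈ Zf A σ 1 (r + s) ⊔ I • Zf A σ 2 (r + s), refD d w d' w' (S r) (S s) i j l b =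
      (((u : A) - 1) * ((u : A) - 1)) • (σ r i l * σ s j b - σ s j b * σ r i l + y) := by
  have hq : q ≠ 0 := by
    rw [← hu]; exact (u.isUnit.map (algebraMap A F)).ne_zero
  have h0 : refD (B := B) d w d' w' (Gser q B r) (Gser q B s) i j l b = 0 := by
    unfold Gser; split_ifs
    · exact refD_form hq h h' i j l b
    · exact refD_zero_right ..
    · exact refD_zero_left ..
    · exact refD_zero_left ..
  have lt : ∀ r r' i j, r ≤ r' → σ r i j ∈ Zf A σ 1 r' := fun r r' i j h =>
    Zf_mono le_rfl h (letter_mem_Zf r i j)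
  obtain ⟨p1, hp1, e1⟩ := refD_eq_commutator hu h h' (X := σ r) (Y := Gser q B s)
    (P := Zf A σ 1 (r + s))
    (fun i j k l => by
      obtain ⟨a, ha⟩ := Gser_apply (B := B) hu s k l
      rw [ha, mul_algebraMap_eq_smul]
      exact Submodule.smul_mem _ _ (lt _ _ _ _ (by omega)))
    (fun i j k l => by
      obtain ⟨a, ha⟩ := Gser_apply (B := B) hu s i j
      rw [ha, algebraMap_mul_eq_smul]
      exact Submodule.smul_mem _ _ (lt _ _ _ _ (by omega))) i j l b
  obtain ⟨p2, hp2, e2⟩ := refD_eq_commutator hu h h' (X := Gser q B r) (Y := σ s)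
    (P := Zf A σ 1 (r + s))
    (fun i j k l => by
      obtain ⟨a, ha⟩ := Gser_apply (B := B) hu r i j
      rw [ha, algebraMap_mul_eq_smul]
      exact Submodule.smul_mem _ _ (lt _ _ _ _ (by omega)))
    (fun i j k l => by
      obtain ⟨a, ha⟩ := Gser_apply (B := B) hu r k l
      rw [ha, mul_algebraMap_eq_smul]
      exact Submodule.smul_mem _ _ (lt _ _ _ _ (by omega))) i j l b
  obtain ⟨p3, hp3, e3⟩ := refD_eq_commutator hu h h' (X := σ r) (Y := σ s)
    (P := Zf A σ 2 (r + s))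
    (fun i j k l => mul_mem_Zf (d := 1) (d' := 1) (letter_mem_Zf r i j) (letter_mem_Zf s k l))
    (fun i j k l => by
      rw [add_comm r s]
      exact mul_mem_Zf (d := 1) (d' := 1) (letter_mem_Zf s i j) (letter_mem_Zf r k l)) i j l b
  refine ⟨p1 + p2 + ((u : A) - 1) • p3, Submodule.add_mem _
    (Submodule.mem_sup_left (Submodule.add_mem _ hp1 hp2))
    (Submodule.mem_sup_right (Submodule.smul_mem_smul hI hp3)), ?_⟩
  obtain ⟨a, ha⟩ := Gser_apply (B := B) hu s j b
  obtain ⟨a', ha'⟩ := Gser_apply (B := B) hu r i l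
  rw [ha, mul_algebraMap_eq_smul, algebraMap_mul_eq_smul, sub_self, zero_add] at e1
  rw [ha', mul_algebraMap_eq_smul, algebraMap_mul_eq_smul, sub_self, zero_add] at e2
  rw [hS r, hS s, refD_add_left, refD_add_right, refD_add_right, h0, refD_smul_right,
    refD_smul_left, refD_smul_right, refD_smul_left, e1, e2, e3]
  module

/-- Commutators of the rescaled generators are small. -/
theorem Refl.commutator_mem (hrefl : Refl q S) (hu : algebraMap A F u = q) (hq1 : q ≠ 1)
    (hS : ∀ r, S r = Gser q B r + ((u : A) - 1) • σ r) {I : Ideal A} (hI : (u : A) - 1 ∈ I)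
    (s : ℕ) : ∀ (r : ℕ) (i l j b : Fin (2 * n)), σ r i l * σ s j b - σ s j b * σ r i l ∈
      Zf A σ 1 (r + s) ⊔ I • Zf A σ 2 (r + s) := by
  induction s using Nat.strong_induction_on with
  | _ s ih =>
  intro r i l j b
  have p1 : IsRPair q q (wP (N := 2 * n) q) := by simp [IsRPair]
  have p2 : IsRPair q q⁻¹ (wM (N := 2 * n) q) := by simp [IsRPair]
  have step : ∀ {d d' : F} {w w' : Fin (2 * n) → Fin (2 * n) → F}, IsRPair q d w →
      IsRPair q d' w' → ∀ r' s' : ℤ, s' < s → r' + s' ≤ r + s →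
      ∃ y ∈ Zf A σ 1 (r + s) ⊔ I • Zf A σ 2 (r + s),
        refD d w d' w' (ez S r') (ez S s') i j l b =
          (((u : A) - 1) * ((u : A) - 1)) • y := by
    intro d d' w w' h h' r' s' hs hrs
    rcases lt_or_ge r' 0 with hr0 | hr0
    · exact ⟨0, zero_mem _, by rw [ez_of_neg _ hr0, refD_zero_left, smul_zero]⟩
    rcases lt_or_ge s' 0 with hs0 | hs0
    · exact ⟨0, zero_mem _, by rw [ez_of_neg _ hs0, refD_zero_right, smul_zero]⟩
    lift r' to ℕ using hr0
    lift s' to ℕ using hs0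
    obtain ⟨y, hy, e⟩ := refD_shift hu h h' hS hI r' s' i j l b
    have hle : Zf A σ 1 (r' + s') ⊔ I • Zf A σ 2 (r' + s') ≤
        Zf A σ 1 (r + s) ⊔ I • Zf A σ 2 (r + s) :=
      sup_le_sup (Zf_mono le_rfl (by omega)) (Submodule.smul_mono le_rfl
        (Zf_mono le_rfl (by omega)))
    exact ⟨_, Submodule.add_mem _ (hle (ih s' (by omega) r' i l j b)) (hle hy), by
      rw [ez_natCast, ez_natCast, e]⟩
  obtain ⟨y0, hy0, e0⟩ := refD_shift hu p1 p1 hS hI r s i j l b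
  obtain ⟨y1, hy1, e1⟩ := step p2 p1 (r + 1) (s - 1) (by omega) (by omega)
  obtain ⟨y2, hy2, e2⟩ := step p1 p2 (r - 1) (s - 1) (by omega) (by omega)
  obtain ⟨y3, hy3, e3⟩ := step p2 p2 r (s - 2) (by omega) (by omega)
  have key := hrefl.recursion r s i j l b
  rw [e1, e2, e3, ez_natCast, ez_natCast, e0, ← smul_add, ← smul_sub] at key
  have hne : algebraMap A F (((u : A) - 1) * ((u : A) - 1)) ≠ 0 := by
    simpa [hu, sub_eq_zero] using hq1
  rw [← algebraMap_smul F (((u : A) - 1) * ((u : A) - 1)),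
    ← algebraMap_smul F (((u : A) - 1) * ((u : A) - 1)) (y1 + y2 - y3)] at key
  have key' := smul_right_injective B hne key
  rw [← eq_sub_iff_add_eq] at key'
  rw [key']
  exact Submodule.sub_mem _ (Submodule.sub_mem _ (Submodule.add_mem _ hy1 hy2) hy3) hy0

end Commutators

section Straightening

variable {N : ℕ} {B : Type} [Ring B] {A : Type} [CommRing A] [Algebra A B]
variable {σ : ℕ → Matrix (Fin N) (Fin N) B} {I : Ideal A}

theorem mul_mem_Zf_sup {a d w w' : ℕ} {x y : B} (hx : x ∈ Zf A σ a w)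
    (hy : y ∈ Zf A σ d w' ⊔ I • Zf A σ (d + 1) w') :
    x * y ∈ Zf A σ (a + d) (w + w') ⊔ I • Zf A σ (a + d + 1) (w + w') := by
  obtain ⟨y1, h1, y2, h2, rfl⟩ := Submodule.mem_sup.1 hy
  rw [mul_add]
  refine Submodule.add_mem_sup (mul_mem_Zf hx h1) ?_
  have : (I • Zf A σ (d + 1) w').map (LinearMap.mulLeft A x) ≤
      I • Zf A σ (a + d + 1) (w + w') := by
    rw [Submodule.map_smul'']
    refine Submodule.smul_mono le_rfl ?_
    rintro _ ⟨z, hz, rfl⟩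
    rw [add_assoc]
    exact mul_mem_Zf hx hz
  exact this ⟨y2, h2, rfl⟩

theorem mul_mem_Zf_sup_right {a d w w' : ℕ} {x y : B} (hx : x ∈ Zf A σ a w)
    (hy : y ∈ Zf A σ d w' ⊔ I • Zf A σ (d + 1) w') :
    y * x ∈ Zf A σ (a + d) (w + w') ⊔ I • Zf A σ (a + d + 1) (w + w') := by
  obtain ⟨y1, h1, y2, h2, rfl⟩ := Submodule.mem_sup.1 hy
  rw [add_mul, add_comm a, add_comm w]
  refine Submodule.add_mem_sup (mul_mem_Zf h1 hx) ?_
  have : (I • Zf A σ (d + 1) w').map (LinearMap.mulRight A x) ≤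
      I • Zf A σ (d + a + 1) (w' + w) := by
    rw [Submodule.map_smul'']
    refine Submodule.smul_mono le_rfl ?_
    rintro _ ⟨z, hz, rfl⟩
    rw [add_right_comm]
    exact mul_mem_Zf hz hx
  exact this ⟨y2, h2, rfl⟩

theorem Zf_sup_mono {d w w' : ℕ} (hw : w ≤ w') :
    Zf A σ d w ⊔ I • Zf A σ (d + 1) w ≤ Zf A σ d w' ⊔ I • Zf A σ (d + 1) w' :=
  sup_le_sup (Zf_mono le_rfl hw) (Submodule.smul_mono le_rfl (Zf_mono le_rfl hw))

theorem Zf_sup_mono' {d d' w : ℕ} (hd : d ≤ d') :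
    Zf A σ d w ⊔ I • Zf A σ (d + 1) w ≤ Zf A σ d' w ⊔ I • Zf A σ (d' + 1) w :=
  sup_le_sup (Zf_mono hd le_rfl) (Submodule.smul_mono le_rfl (Zf_mono (by omega) le_rfl))

/-- Reordering a word changes it by shorter words, modulo `I`. -/
theorem wprod_sub_wprod_mem (hc : ∀ (r s : ℕ) (i l j b : Fin N),
      σ r i l * σ s j b - σ s j b * σ r i l ∈ Zf A σ 1 (r + s) ⊔ I • Zf A σ 2 (r + s))
    {l l' : List (ℕ × Fin N × Fin N)} (h : l.Perm l') :
    ∀ d, l.length ≤ d + 1 →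
      wprod σ l - wprod σ l' ∈ Zf A σ d (wt l) ⊔ I • Zf A σ (d + 1) (wt l) := by
  induction h with
  | nil => intro d _; simp
  | @cons g t t' h ih =>
    intro d hd
    rw [List.length_cons] at hd
    rcases d with _ | d
    · have ht : t = [] := List.eq_nil_of_length_eq_zero (by omega)
      subst ht
      rw [List.nil_perm.1 h]; simp
    · rw [wprod_cons, wprod_cons, ← mul_sub, wt_cons, add_comm d 1]
      exact mul_mem_Zf_sup (letter_mem_Zf _ _ _) (ih d (by omega))
  | swap g g' t =>
    intro d hd
    simp only [List.length_cons] at hd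
    simp only [wprod_cons, ← mul_assoc, ← sub_mul, wt_cons]
    have h1 := mul_mem_Zf_sup_right (wprod_mem_Zf (A := A) (σ := σ) t le_rfl le_rfl)
      (hc g'.1 g.1 g'.2.1 g'.2.2 g.2.1 g.2.2)
    rw [add_comm (wt t)] at h1
    have := Zf_sup_mono' (I := I) (by omega : t.length + 1 ≤ d) h1
    rwa [add_assoc] at this
  | @trans l₁ l₂ l₃ h₁ h₂ ih₁ ih₂ =>
    intro d hd
    have hw : wt l₁ = wt l₂ := (h₁.map Prod.fst).sum_eq
    have := Submodule.add_mem _ (ih₁ d hd) (hw ▸ ih₂ d (h₁.length_eq ▸ hd))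
    rwa [sub_add_sub_cancel] at this

theorem finite_words (d w : ℕ) :
    {l : List (ℕ × Fin N × Fin N) | l.length ≤ d ∧ wt l ≤ w}.Finite := by
  have h1 : {l : List (Fin (w + 1) × Fin N × Fin N) | l.length ≤ d}.Finite :=
    List.finite_length_le _ d
  refine (h1.image (List.map fun g => ((g.1 : ℕ), g.2))).subset ?_
  rintro l ⟨hl, hw⟩
  refine ⟨l.map fun g => (Fin.ofNat (w + 1) g.1, g.2), by simpa using hl, ?_⟩
  rw [List.map_map]
  conv_rhs => rw [← List.map_id l]
  refine List.map_congr_left fun g hg => ?_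
  have : g.1 ≤ wt l := List.single_le_sum (by simp) _ (List.mem_map_of_mem hg)
  have h2 : g.1 < w + 1 := by omega
  simp [Function.comp, Nat.mod_eq_of_lt h2]

theorem Zf_fg (d w : ℕ) : (Zf A σ d w).FG := by
  refine Submodule.fg_span (((finite_words (N := N) d w).image (wprod σ)).subset ?_)
  rintro _ ⟨l, h1, h2, rfl⟩
  exact ⟨l, ⟨h1, h2⟩, rfl⟩

/-- Words in any prescribed order span, by Nakayama's lemma. -/
theorem Zf_le_span_normal [IsLocalRing A] (hI : I ≤ IsLocalRing.maximalIdeal A)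
    (hc : ∀ (r s : ℕ) (i l j b : Fin N),
      σ r i l * σ s j b - σ s j b * σ r i l ∈ Zf A σ 1 (r + s) ⊔ I • Zf A σ 2 (r + s))
    (ν : List (ℕ × Fin N × Fin N) → List (ℕ × Fin N × Fin N))
    (hν : ∀ l : List (ℕ × Fin N × Fin N), l.Perm (ν l))
    (d w : ℕ) : Zf A σ d w ≤ Submodule.span A (Set.range fun l => wprod σ (ν l)) := by
  induction d with
  | zero =>
    refine Submodule.span_le.2 ?_
    rintro _ ⟨l, h1, -, rfl⟩
    have hl : l = [] := List.eq_nil_of_length_eq_zero (by omega)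
    subst hl
    refine Submodule.subset_span ⟨[], ?_⟩
    simp only [List.nil_perm.1 (hν [])]
  | succ d ih =>
    refine Submodule.le_of_le_smul_of_le_jacobson_bot (I := I) (Zf_fg _ _)
      (hI.trans (IsLocalRing.maximalIdeal_le_jacobson _)) ?_
    refine Submodule.span_le.2 ?_
    rintro _ ⟨l, h1, h2, rfl⟩
    have h3 := Zf_sup_mono (I := I) h2 (wprod_sub_wprod_mem hc (hν l) d h1)
    have h4 : wprod σ (ν l) ∈ Submodule.span A (Set.range fun l => wprod σ (ν l)) :=
      Submodule.subset_span ⟨l, rfl⟩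
    have h5 := sup_le_sup_right ih (I • Zf A σ (d + 1) w) h3
    have := Submodule.add_mem _ h5 (Submodule.mem_sup_left h4)
    rwa [sub_add_cancel] at this

end Straightening

section Relations

variable {F : Type} [Field F] {n : ℕ} {B : Type} [Ring B] [Algebra F B] {q : F}
variable {S : ℕ → Matrix (Fin (2 * n)) (Fin (2 * n)) B} {c : Fin n → B}

theorem SpRep.zero_of_lt (h : SpRep q S c) {i j : Fin (2 * n)} (hij : i < j) (hp : j ≠ pr i) :
    S 0 i j = 0 := by
  refine h.tri i j hij fun h2 => hp ?_
  rw [pr, dif_pos h2.1]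
  exact Fin.ext h2.2

theorem SpRep.zero_fe (h : SpRep q S c) {k : Fin n} {j : Fin (2 * n)} (hj : fo n k < j) :
    S 0 (fe n k) j = 0 :=
  h.zero_of_lt ((fe_lt_fo.2 le_rfl).trans hj) (by rw [pr_fe]; exact hj.ne')

theorem SpRep.zero_fo (h : SpRep q S c) {k : Fin n} {i : Fin (2 * n)} (hi : i < fe n k) :
    S 0 i (fo n k) = 0 :=
  h.zero_of_lt (hi.trans (fe_lt_fo.2 le_rfl)) (by
    rw [Ne, pr_eq_comm, pr_fo]; exact hi.ne)

theorem SpRep.weight (h : SpRep q S c) (k : Fin n) (r : ℕ) (i l : Fin (2 * n)) :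
    (dg q i (fe n k) * dg q l (fe n k)) • (S r i l * S 0 (fe n k) (fo n k)) =
      (dg q l (fo n k) * dg q i (fo n k)) • (S 0 (fe n k) (fo n k) * S r i l) := by
  have e := h.refl.zero r i (fe n k) l (fo n k)
  have h1 : ∀ x : B, wP q l (fe n k) • (x * S 0 l (fo n k)) = 0 := by
    intro x
    rw [wP]
    split_ifs with hl
    · rw [h.zero_fo hl, mul_zero, smul_zero]
    · rw [zero_smul]
  have h2 : ∀ x : B, wP q i (fe n k) • (x * S 0 i (fo n k)) = 0 := by
    intro x
    rw [wP]
    split_ifs with hl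
    · rw [h.zero_fo hl, mul_zero, smul_zero]
    · rw [zero_smul]
  have h3 : ∀ x : B, wP q i (fe n k) • wP q l i • (x * S 0 l (fo n k)) = 0 := by
    intro x
    simp only [wP]
    split_ifs with hl hl'
    · rw [h.zero_fo (hl'.trans hl), mul_zero, smul_zero, smul_zero]
    all_goals simp
  have h4 : ∀ x : B, wP q (fo n k) i • (S 0 (fe n k) i * x) = 0 := by
    intro x
    rw [wP]
    split_ifs with hl
    · rw [h.zero_fe hl, zero_mul, smul_zero]
    · rw [zero_smul]
  have h5 : ∀ x : B, wP q (fo n k) l • (S 0 (fe n k) l * x) = 0 := by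
    intro x
    rw [wP]
    split_ifs with hl
    · rw [h.zero_fe hl, zero_mul, smul_zero]
    · rw [zero_smul]
  have h6 : ∀ x : B, wP q (fo n k) l • wP q l i • (S 0 (fe n k) i * x) = 0 := by
    intro x
    simp only [wP]
    split_ifs with hl hl'
    · rw [h.zero_fe (hl.trans hl'), zero_mul, smul_zero, smul_zero]
    all_goals simp
  simp only [refD, smul_add] at e
  rw [h1, h3, h4, h6, smul_comm (wP q i (fe n k)), h2, smul_comm (wP q (fo n k) l), h5] at e
  simp only [smul_zero, add_zero, sub_eq_zero] at e
  rw [mul_smul, mul_smul]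
  exact e

theorem SpRep.cross (h : SpRep q S c) (k : Fin n) :
    S 0 (fe n k) (fe n k) * S 0 (fo n k) (fo n k) +
      ((q - q⁻¹) • (S 0 (fe n k) (fo n k) * S 0 (fe n k) (fo n k)) +
      ((q - q⁻¹) * q) • (S 0 (fo n k) (fe n k) * S 0 (fe n k) (fo n k))) =
      S 0 (fo n k) (fo n k) * S 0 (fe n k) (fe n k) := by
  have e := h.refl.zero 0 (fe n k) (fo n k) (fe n k) (fo n k)
  have l1 : fe n k < fo n k := fe_lt_fo.2 le_rfl
  simp only [refD, dg, wP, if_neg (fe_ne_fo k k), if_pos l1, if_neg l1.not_gt, lt_self_iff_false,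
    if_false, if_true, one_smul, zero_smul, zero_mul, add_zero, sub_eq_zero, smul_smul] at e
  rw [← add_assoc]
  exact e

/-- `S₀₁` commutes with the elements of weight zero. -/
theorem SpRep.comm_form (h : SpRep q S c) (hq : q ≠ 0) (k : Fin n) (i : Fin (2 * n)) :
    Commute (S 0 (fe n k) (fo n k)) (S 0 i (pr i)) := by
  have e := h.weight k 0 i (pr i)
  have h1 : ∀ a b : Fin (2 * n), dg q a b = dg q (pr a) (pr b) := by
    intro a b
    have : pr a = pr b ↔ a = b := by rw [pr_eq_comm, pr_pr, eq_comm]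
    simp only [dg, this]
  rw [h1 i (fo n k), h1 i (fe n k), pr_fe, pr_fo] at e
  have h2 : dg q (pr i) (fo n k) * dg q (pr i) (fe n k) ≠ 0 := by
    simp only [dg]
    split_ifs <;> simp [hq]
  exact ((smul_right_injective B h2) e).symm

end Relations

section QCommute

variable {F : Type} [Field F] {B : Type} [Ring B] [Algebra F B]

variable (F) in
/-- Commutation up to a nonzero scalar. -/
def QComm (a x : B) : Prop := ∃ μ : F, μ ≠ 0 ∧ a * x = μ • (x * a)

theorem QComm.of_commute {a x : B} (h : Commute a x) : QComm F a x :=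
  ⟨1, one_ne_zero, by rw [one_smul, h.eq]⟩

theorem QComm.mul {a x y : B} (hx : QComm F a x) (hy : QComm F a y) : QComm F a (x * y) := by
  obtain ⟨μ, h0, h⟩ := hx
  obtain ⟨μ', h0', h'⟩ := hy
  refine ⟨μ * μ', mul_ne_zero h0 h0', ?_⟩
  rw [← mul_assoc, h, smul_mul_assoc, mul_assoc x a y, h', mul_smul_comm, smul_smul, mul_assoc]

theorem QComm.one (a : B) : QComm F a 1 := .of_commute (.one_right a)

theorem QComm.pow {a x : B} (hx : QComm F a x) (m : ℕ) : QComm F a (x ^ m) := by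
  induction m with
  | zero => rw [pow_zero]; exact .one a
  | succ m ih => rw [pow_succ]; exact ih.mul hx

theorem QComm.smul {a x : B} (hx : QComm F a x) (t : F) : QComm F a (t • x) := by
  obtain ⟨μ, h0, h⟩ := hx
  exact ⟨μ, h0, by rw [mul_smul_comm, smul_mul_assoc, h, smul_comm]⟩

theorem QComm.list_prod {a : B} {l : List B} (h : ∀ x ∈ l, QComm F a x) : QComm F a l.prod := by
  induction l with
  | nil => exact .one a
  | cons x l ih =>
    rw [List.prod_cons]
    exact (h x (by simp)).mul (ih fun y hy => h y (by simp [hy]))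

theorem QComm.inv {a a' x : B} (h1 : a * a' = 1) (h2 : a' * a = 1) (hx : QComm F a x) :
    QComm F a' x := by
  obtain ⟨μ, h0, h⟩ := hx
  refine ⟨μ⁻¹, inv_ne_zero h0, ?_⟩
  rw [eq_inv_smul_iff₀ h0]
  calc μ • (a' * x) = a' * (μ • (x * a)) * a' := by
        rw [mul_smul_comm, smul_mul_assoc, ← mul_assoc, mul_assoc _ a a', h1, mul_one]
    _ = x * a' := by rw [← h, ← mul_assoc, h2, one_mul]

variable {n : ℕ} {q : F} {S : ℕ → Matrix (Fin (2 * n)) (Fin (2 * n)) B} {c : Fin n → B}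

theorem SpRep.qComm (h : SpRep q S c) (hq : q ≠ 0) (k : Fin n) (r : ℕ) (i l : Fin (2 * n)) :
    QComm F (S 0 (fe n k) (fo n k)) (S r i l) := by
  have h1 : ∀ a b : Fin (2 * n), dg q a b ≠ 0 := by
    intro a b
    simp only [dg]
    split_ifs <;> simp [hq]
  have h2 := mul_ne_zero (h1 l (fo n k)) (h1 i (fo n k))
  refine ⟨(dg q l (fo n k) * dg q i (fo n k))⁻¹ * (dg q i (fe n k) * dg q l (fe n k)),
    mul_ne_zero (inv_ne_zero h2) (mul_ne_zero (h1 _ _) (h1 _ _)), ?_⟩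
  rw [mul_smul, h.weight, inv_smul_smul₀ h2]

/-- The rescaled deviation of `S` from the constant form. -/
def sg (q : F) (S : ℕ → Matrix (Fin (2 * n)) (Fin (2 * n)) B) (r : ℕ) :
    Matrix (Fin (2 * n)) (Fin (2 * n)) B := (q - 1)⁻¹ • (S r - Gser q B r)

theorem Gser_eq_zero {r : ℕ} {i j : Fin (2 * n)} (h : ¬(r = 0 ∧ j = pr i)) :
    Gser q B r i j = 0 := by
  rw [Gser]
  split_ifs with hr
  · rw [GA, Matrix.map_apply, Gm_apply, if_neg fun hj => h ⟨hr, hj⟩, map_zero]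
  · rfl

theorem Gser_eq_algebraMap (r : ℕ) (i j : Fin (2 * n)) :
    ∃ t : F, Gser q B r i j = algebraMap F B t := by
  rw [Gser]
  split_ifs with hr
  · exact ⟨Gm q i j, rfl⟩
  · exact ⟨0, by simp⟩

theorem eq_Gser_add_smul_sg (hq1 : q ≠ 1) (r : ℕ) :
    S r = Gser q B r + (q - 1) • sg q S r := by
  rw [sg, smul_inv_smul₀ (sub_ne_zero.2 hq1), add_sub_cancel]

theorem sg_of_Gser_eq_zero {r : ℕ} {i j : Fin (2 * n)} (h : ¬(r = 0 ∧ j = pr i)) :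
    sg q S r i j = (q - 1)⁻¹ • S r i j := by
  rw [sg, Matrix.smul_apply, Matrix.sub_apply, Gser_eq_zero h, sub_zero]

theorem SpRep.commute_sg (h : SpRep q S c) (hq : q ≠ 0) (k : Fin n) (i : Fin (2 * n)) :
    Commute (S 0 (fe n k) (fo n k)) (sg q S 0 i (pr i)) := by
  rw [sg, Matrix.smul_apply, Matrix.sub_apply]
  obtain ⟨t, ht⟩ := Gser_eq_algebraMap (B := B) (q := q) 0 i (pr i)
  rw [ht]
  exact ((h.comm_form hq k i).sub_right (Algebra.commutes t _).symm).smul_right _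

theorem SpRep.qComm_sg (h : SpRep q S c) (hq : q ≠ 0) (k : Fin n) (r : ℕ) (i l : Fin (2 * n)) :
    QComm F (S 0 (fe n k) (fo n k)) (sg q S r i l) := by
  by_cases h0 : r = 0 ∧ l = pr i
  · obtain ⟨rfl, rfl⟩ := h0
    exact .of_commute (h.commute_sg hq k i)
  · rw [sg_of_Gser_eq_zero h0]
    exact (h.qComm hq k r i l).smul _

theorem SpRep.qComm_inv_sg (h : SpRep q S c) (hq : q ≠ 0) (k : Fin n) (r : ℕ)
    (i l : Fin (2 * n)) : QComm F (c k) (sg q S r i l) :=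
  (h.qComm_sg hq k r i l).inv (h.invR k) (h.invL k)

end QCommute

section Letters

variable {n : ℕ}

/-- The position of a letter in the normal ordering: the index of its block for the letters of a
diagonal block, `n + 1` for the letters `s₀₁` of a block, and `n` for all others. -/
def bk (g : ℕ × Fin (2 * n) × Fin (2 * n)) : ℕ :=
  if g.1 = 0 ∧ g.2.1.val / 2 = g.2.2.val / 2 then
    if g.2.1 < g.2.2 then n + 1 else g.2.1.val / 2
  else n

theorem fe_div_two (k : Fin n) : (fe n k).val / 2 = k := by simp [fe]

theorem fo_div_two (k : Fin n) : (fo n k).val / 2 = k := by simp only [fo]; omega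

theorem bk_fe_fe (k : Fin n) : bk (0, fe n k, fe n k) = k := by
  simp [bk, fe_div_two]

theorem bk_fo_fo (k : Fin n) : bk (0, fo n k, fo n k) = k := by
  simp [bk, fo_div_two]

theorem bk_fe_fo (k : Fin n) : bk (0, fe n k, fo n k) = n + 1 := by
  simp [bk, fe_div_two, fo_div_two, fe_lt_fo]

theorem bk_fo_fe (k : Fin n) : bk (0, fo n k, fe n k) = k := by
  simp [bk, fe_div_two, fo_div_two, fo_lt_fe]

theorem bk_cases (g : ℕ × Fin (2 * n) × Fin (2 * n)) :
    (bk g = n ∧ ¬(g.1 = 0 ∧ g.2.2 = pr g.2.1) ∧ ¬(g.1 = 0 ∧ g.2.2 = g.2.1)) ∨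
      (∃ k, g = (0, fe n k, fo n k)) ∨
      ∃ k, g = (0, fe n k, fe n k) ∨ g = (0, fo n k, fo n k) ∨ g = (0, fo n k, fe n k) := by
  obtain ⟨r, i, j⟩ := g
  by_cases h : r = 0 ∧ i.val / 2 = j.val / 2
  · right
    obtain ⟨rfl, h⟩ := h
    obtain ⟨k, rfl⟩ | ⟨k, rfl⟩ := fe_or_fo i <;> obtain ⟨m, rfl⟩ | ⟨m, rfl⟩ := fe_or_fo j <;>
    · rw [Fin.ext (by simpa [fe_div_two, fo_div_two] using h : k.val = m.val)]
      first | exact .inl ⟨m, rfl⟩ | exact .inr ⟨m, by simp⟩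
  · left
    refine ⟨by simp only [bk, if_neg h], fun h1 => h ⟨h1.1, ?_⟩, fun h1 => h ⟨h1.1, ?_⟩⟩
    · have h2 : j = pr i := h1.2
      subst h2
      obtain ⟨k, rfl⟩ | ⟨k, rfl⟩ := fe_or_fo i <;>
        simp only [pr_fe, pr_fo, fe_div_two, fo_div_two]
    · have h2 : j = i := h1.2
      rw [h2]

theorem exists_of_bk_lt {g : ℕ × Fin (2 * n) × Fin (2 * n)} {k : Fin n} (h : bk g = k) :
    g = (0, fe n k, fe n k) ∨ g = (0, fo n k, fo n k) ∨ g = (0, fo n k, fe n k) := by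
  have hk := k.isLt
  rcases bk_cases g with h1 | ⟨m, rfl⟩ | ⟨m, h1⟩
  · omega
  · rw [bk_fe_fo] at h; omega
  · have : m = k := by
      rcases h1 with rfl | rfl | rfl
      · rw [bk_fe_fe] at h; exact Fin.ext h
      · rw [bk_fo_fo] at h; exact Fin.ext h
      · rw [bk_fo_fe] at h; exact Fin.ext h
    rwa [this] at h1

theorem exists_of_bk_eq {g : ℕ × Fin (2 * n) × Fin (2 * n)} (h : bk g = n + 1) :
    ∃ k, g = (0, fe n k, fo n k) := by
  rcases bk_cases g with h1 | h1 | ⟨m, h1⟩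
  · omega
  · exact h1
  · have := m.isLt
    rcases h1 with rfl | rfl | rfl <;> simp only [bk_fe_fe, bk_fo_fo, bk_fo_fe] at h <;> omega

/-- The letters of the normal words. -/
def Good (g : ℕ × Fin (2 * n) × Fin (2 * n)) : Prop :=
  g.1 ≠ 0 ∨ g.2.1 = g.2.2 ∨ (g.2.2 < g.2.1 ∧ g.2.2 ≠ pr g.2.1) ∨
    (g.2.1 < g.2.2 ∧ g.2.2 = pr g.2.1)

/-- The normal ordering of letters. -/
def rk (g : ℕ × Fin (2 * n) × Fin (2 * n)) : ℕ ×ₗ ℕ := toLex (bk g, Encodable.encode g)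

theorem rk_injective : Function.Injective (rk (n := n)) := fun _ _ h =>
  Encodable.encode_injective (congrArg (fun x => (ofLex x).2) h)

theorem bk_le_of_rk_le {g g' : ℕ × Fin (2 * n) × Fin (2 * n)} (h : rk g ≤ rk g') :
    bk g ≤ bk g' := by
  rcases Prod.Lex.toLex_le_toLex.1 h with h | h
  · exact h.le
  · exact h.1.le

theorem rk_le_of_bk_lt {g g' : ℕ × Fin (2 * n) × Fin (2 * n)} (h : bk g < bk g') :
    rk g ≤ rk g' := Prod.Lex.toLex_le_toLex.2 (.inl h)

theorem rk_fe_le_rk_fo (k : Fin n) : rk (0, fe n k, fe n k) ≤ rk (0, fo n k, fo n k) := by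
  refine Prod.Lex.toLex_le_toLex.2 (.inr ⟨by simp [bk_fe_fe, bk_fo_fo], ?_⟩)
  have h : (fe n k).val < (fo n k).val := fe_lt_fo.2 le_rfl
  simp only [Encodable.encode_prod_val]
  refine (Nat.pair_lt_pair_right _ ?_).le
  exact (Nat.pair_lt_pair_left _ h).trans (Nat.pair_lt_pair_right _ h)

/-- A word in normal order. -/
def NSorted (l : List (ℕ × Fin (2 * n) × Fin (2 * n))) : Prop := l.Pairwise fun a b => rk a ≤ rk b

theorem NSorted.eq_of_perm {l l' : List (ℕ × Fin (2 * n) × Fin (2 * n))} (h : NSorted l)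
    (hl : NSorted l') (hp : l.Perm l') : l = l' :=
  List.Perm.eq_of_pairwise (fun _ _ _ _ h1 h2 => rk_injective (le_antisymm h1 h2)) h hl hp

/-- Sorting a word. -/
def nsort (l : List (ℕ × Fin (2 * n) × Fin (2 * n))) : List (ℕ × Fin (2 * n) × Fin (2 * n)) :=
  haveI : Std.Total fun a b : ℕ × Fin (2 * n) × Fin (2 * n) => rk a ≤ rk b :=
    ⟨fun a b => le_total (rk a) (rk b)⟩
  haveI : IsTrans (ℕ × Fin (2 * n) × Fin (2 * n)) fun a b => rk a ≤ rk b :=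
    ⟨fun _ _ _ => le_trans⟩
  l.insertionSort fun a b => rk a ≤ rk b

theorem nsort_perm (l : List (ℕ × Fin (2 * n) × Fin (2 * n))) : (nsort l).Perm l :=
  List.perm_insertionSort _ _

theorem nsorted_nsort (l : List (ℕ × Fin (2 * n) × Fin (2 * n))) : NSorted (nsort l) := by
  have : Std.Total fun a b : ℕ × Fin (2 * n) × Fin (2 * n) => rk a ≤ rk b :=
    ⟨fun a b => le_total (rk a) (rk b)⟩
  have : IsTrans (ℕ × Fin (2 * n) × Fin (2 * n)) fun a b => rk a ≤ rk b :=
    ⟨fun _ _ _ => le_trans⟩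
  exact List.pairwise_insertionSort _ _

end Letters

section Elimination

variable {F : Type} [Field F] {n : ℕ} {B : Type} [Ring B] [Algebra F B] {q : F}
variable {S : ℕ → Matrix (Fin (2 * n)) (Fin (2 * n)) B} {c : Fin n → B}

theorem mul_left_mem_of_span {s : Set B} {p : Submodule F B} {a : B} (h : ∀ x ∈ s, a * x ∈ p)
    {x : B} (hx : x ∈ Submodule.span F s) : a * x ∈ p :=
  (Submodule.span_le (p := p.comap (LinearMap.mulLeft F a))).2 h hx

theorem mul_right_mem_of_span {s : Set B} {p : Submodule F B} {a : B} (h : ∀ x ∈ s, x * a ∈ p)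
    {x : B} (hx : x ∈ Submodule.span F s) : x * a ∈ p :=
  (Submodule.span_le (p := p.comap (LinearMap.mulRight F a))).2 h hx

variable (F S c) in
/-- The algebra generated by the `s₀₁` of the blocks and their inverses. -/
def Cart : Subalgebra F B :=
  Algebra.adjoin F (Set.range (fun k => S 0 (fe n k) (fo n k)) ∪ Set.range c)

variable (q S c) in
/-- Products of normally ordered monomials in the blocks from a list, normal words in the
off-block letters, and elements of `Cart`. -/
def Esub : List (Fin n) → Submodule F B
  | [] => Submodule.span F {x | ∃ l y, NSorted l ∧ (∀ g ∈ l, bk g = n) ∧ y ∈ Cart F S c ∧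
      wprod (sg q S) l * y = x}
  | k :: ks => Submodule.span F {x | ∃ (i j : ℕ) (e : B), e ∈ Esub ks ∧
      S 0 (fe n k) (fe n k) ^ i * (S 0 (fo n k) (fo n k) ^ j * e) = x}

theorem Esub_mul_right {y : B} (hy : y ∈ Cart F S c) (ks : List (Fin n)) :
    ∀ {x : B}, x ∈ Esub q S c ks → x * y ∈ Esub q S c ks := by
  induction ks with
  | nil =>
    intro x hx
    refine mul_right_mem_of_span ?_ hx
    rintro _ ⟨l, z, h1, h2, h3, rfl⟩
    exact Submodule.subset_span ⟨l, z * y, h1, h2, mul_mem h3 hy, (mul_assoc _ _ _).symm⟩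
  | cons k ks ih =>
    intro x hx
    refine mul_right_mem_of_span ?_ hx
    rintro _ ⟨i, j, e, he, rfl⟩
    exact Submodule.subset_span ⟨i, j, e * y, ih he, by simp only [mul_assoc]⟩

theorem Esub_le_cons (k : Fin n) (ks : List (Fin n)) : Esub q S c ks ≤ Esub q S c (k :: ks) :=
  fun e he => Submodule.subset_span ⟨0, 0, e, he, by simp⟩

theorem Esub_mul_qComm {a : B} (ha : a ∈ Cart F S c) (h1 : ∀ r i j, QComm F a (S r i j))
    (h2 : ∀ r i j, QComm F a (sg q S r i j)) (ks : List (Fin n)) :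
    ∀ {x : B}, x ∈ Esub q S c ks → a * x ∈ Esub q S c ks := by
  induction ks with
  | nil =>
    intro x hx
    refine mul_left_mem_of_span ?_ hx
    rintro _ ⟨l, z, h3, h4, h5, rfl⟩
    obtain ⟨μ, -, hμ⟩ : QComm F a (wprod (sg q S) l) := by
      refine QComm.list_prod fun x hx => ?_
      obtain ⟨g, -, rfl⟩ := List.mem_map.1 hx
      exact h2 _ _ _
    rw [← mul_assoc, hμ, smul_mul_assoc, mul_assoc]
    exact Submodule.smul_mem _ _ (Submodule.subset_span ⟨l, a * z, h3, h4, mul_mem ha h5, rfl⟩)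
  | cons k ks ih =>
    intro x hx
    refine mul_left_mem_of_span ?_ hx
    rintro _ ⟨i, j, e, he, rfl⟩
    obtain ⟨μ, -, hμ⟩ : QComm F a (S 0 (fe n k) (fe n k) ^ i * S 0 (fo n k) (fo n k) ^ j) :=
      ((h1 _ _ _).pow i).mul ((h1 _ _ _).pow j)
    rw [← mul_assoc (_ ^ i), ← mul_assoc a, hμ, smul_mul_assoc]
    exact Submodule.smul_mem _ _ (Submodule.subset_span ⟨i, j, a * e, ih he,
      by simp only [mul_assoc]⟩)

theorem Cart.c_mem (k : Fin n) : S 0 (fe n k) (fo n k) ∈ Cart F S c :=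
  Algebra.subset_adjoin (.inl ⟨k, rfl⟩)

theorem Cart.inv_mem (k : Fin n) : c k ∈ Cart F S c :=
  Algebra.subset_adjoin (.inr ⟨k, rfl⟩)

theorem SpRep.Esub_c (h : SpRep q S c) (hq : q ≠ 0) (k : Fin n) {ks : List (Fin n)} {x : B}
    (hx : x ∈ Esub q S c ks) : S 0 (fe n k) (fo n k) * x ∈ Esub q S c ks :=
  Esub_mul_qComm (Cart.c_mem k) (h.qComm hq k) (h.qComm_sg hq k) ks hx

theorem SpRep.Esub_inv (h : SpRep q S c) (hq : q ≠ 0) (k : Fin n) {ks : List (Fin n)} {x : B}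
    (hx : x ∈ Esub q S c ks) : c k * x ∈ Esub q S c ks :=
  Esub_mul_qComm (Cart.inv_mem k) (fun r i j => (h.qComm hq k r i j).inv (h.invR k) (h.invL k))
    (h.qComm_inv_sg hq k) ks hx

theorem Esub_fe (k : Fin n) {ks : List (Fin n)} {x : B} (hx : x ∈ Esub q S c (k :: ks)) :
    S 0 (fe n k) (fe n k) * x ∈ Esub q S c (k :: ks) := by
  refine mul_left_mem_of_span ?_ hx
  rintro _ ⟨i, j, e, he, rfl⟩
  exact Submodule.subset_span ⟨i + 1, j, e, he, by rw [pow_succ', mul_assoc]⟩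

theorem SpRep.fo_fe_eq (h : SpRep q S c) (hq : q ≠ 0) (k : Fin n) :
    S 0 (fo n k) (fe n k) = (q ^ 2)⁻¹ • ((S 0 (fo n k) (fo n k) * S 0 (fe n k) (fe n k) -
      algebraMap F B (q ^ 3)) * c k) := by
  rw [h.quad, add_sub_cancel_right, smul_mul_assoc, inv_smul_smul₀ (pow_ne_zero 2 hq), mul_assoc,
    h.invR, mul_one]

theorem SpRep.fo_mul_fe (h : SpRep q S c) (hq : q ≠ 0) (k : Fin n) :
    S 0 (fo n k) (fo n k) * S 0 (fe n k) (fe n k) =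
      q ^ 2 • (S 0 (fe n k) (fe n k) * S 0 (fo n k) (fo n k)) +
      ((q ^ 2 * (q - q⁻¹)) • (S 0 (fe n k) (fo n k) * S 0 (fe n k) (fo n k)) -
        ((q - q⁻¹) * q ^ 4) • 1) := by
  have h1 := h.cross k
  have h2 := h.quad k
  rw [Algebra.algebraMap_eq_smul_one] at h2
  have h3 : S 0 (fo n k) (fe n k) * S 0 (fe n k) (fo n k) =
      (q ^ 2)⁻¹ • (S 0 (fo n k) (fo n k) * S 0 (fe n k) (fe n k) - q ^ 3 • 1) := by
    rw [h2, add_sub_cancel_right, inv_smul_smul₀ (pow_ne_zero 2 hq)]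
  rw [h3] at h1
  set X := S 0 (fo n k) (fo n k) * S 0 (fe n k) (fe n k)
  have h4 : X = q ^ 2 • (X - ((q - q⁻¹) * q) • (q ^ 2)⁻¹ • X) := by
    have : q ^ 2 - q ^ 2 * ((q - q⁻¹) * q * (q ^ 2)⁻¹) = 1 := by field_simp; ring
    conv_lhs => rw [← one_smul F X, ← this]
    module
  have h5 : X - ((q - q⁻¹) * q) • (q ^ 2)⁻¹ • X =
      S 0 (fe n k) (fe n k) * S 0 (fo n k) (fo n k) +
      (q - q⁻¹) • (S 0 (fe n k) (fo n k) * S 0 (fe n k) (fo n k)) -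
      ((q - q⁻¹) * q * (q ^ 2)⁻¹ * q ^ 3) • (1 : B) := by
    conv_lhs => enter [1]; rw [← h1]
    module
  rw [h4, h5, smul_sub, smul_add, smul_smul, smul_smul]
  have : q ^ 2 * ((q - q⁻¹) * q * (q ^ 2)⁻¹ * q ^ 3) = (q - q⁻¹) * q ^ 4 := by field_simp
  rw [this, add_sub_assoc]

theorem SpRep.Esub_fo (h : SpRep q S c) (hq : q ≠ 0) (k : Fin n) {ks : List (Fin n)} {x : B}
    (hx : x ∈ Esub q S c (k :: ks)) : S 0 (fo n k) (fo n k) * x ∈ Esub q S c (k :: ks) := by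
  refine mul_left_mem_of_span ?_ hx
  rintro _ ⟨i, j, e, he, rfl⟩
  have hmem : ∀ m : ℕ, S 0 (fe n k) (fe n k) ^ m * (S 0 (fo n k) (fo n k) ^ j * e) ∈
      Esub q S c (k :: ks) := fun m => Submodule.subset_span ⟨m, j, e, he, rfl⟩
  induction i with
  | zero =>
    refine Submodule.subset_span ⟨0, j + 1, e, he, ?_⟩
    rw [pow_zero, one_mul, one_mul, pow_succ', mul_assoc]
  | succ i ih =>
    rw [pow_succ', mul_assoc, ← mul_assoc, h.fo_mul_fe hq, add_mul, sub_mul]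
    simp only [smul_mul_assoc, mul_assoc, one_mul]
    exact add_mem (Submodule.smul_mem _ _ (Esub_fe k ih)) (sub_mem
      (Submodule.smul_mem _ _ (h.Esub_c hq k (h.Esub_c hq k (hmem i))))
      (Submodule.smul_mem _ _ (hmem i)))

theorem SpRep.Esub_fo_fe (h : SpRep q S c) (hq : q ≠ 0) (k : Fin n) {ks : List (Fin n)} {x : B}
    (hx : x ∈ Esub q S c (k :: ks)) : S 0 (fo n k) (fe n k) * x ∈ Esub q S c (k :: ks) := by
  rw [h.fo_fe_eq hq, smul_mul_assoc, mul_assoc, sub_mul, mul_assoc, algebraMap_mul_eq_smul]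
  have h1 := h.Esub_inv hq k hx
  exact Submodule.smul_mem _ _ (sub_mem (h.Esub_fo hq k (Esub_fe k h1))
    (Submodule.smul_mem _ _ h1))

theorem Esub_sg {ks : List (Fin n)} {r : ℕ} {i j : Fin (2 * n)}
    (hS : ∀ {x : B}, x ∈ Esub q S c ks → S r i j * x ∈ Esub q S c ks) {x : B}
    (hx : x ∈ Esub q S c ks) : sg q S r i j * x ∈ Esub q S c ks := by
  obtain ⟨t, ht⟩ := Gser_eq_algebraMap (B := B) (q := q) r i j
  rw [sg, Matrix.smul_apply, Matrix.sub_apply, ht, smul_mul_assoc, sub_mul,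
    algebraMap_mul_eq_smul]
  exact Submodule.smul_mem _ _ (sub_mem (hS hx) (Submodule.smul_mem _ _ hx))

theorem SpRep.Esub_letter (h : SpRep q S c) (hq : q ≠ 0) {k : Fin n} {ks : List (Fin n)} {x : B}
    (hx : x ∈ Esub q S c (k :: ks)) {g : ℕ × Fin (2 * n) × Fin (2 * n)} (hg : bk g = k) :
    sg q S g.1 g.2.1 g.2.2 * x ∈ Esub q S c (k :: ks) := by
  rcases exists_of_bk_lt hg with rfl | rfl | rfl
  · exact Esub_sg (Esub_fe k) hx
  · exact Esub_sg (h.Esub_fo hq k) hx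
  · exact Esub_sg (h.Esub_fo_fe hq k) hx

theorem sg_c_mem_Cart (k : Fin n) : sg q S 0 (fe n k) (fo n k) ∈ Cart F S c := by
  obtain ⟨t, ht⟩ := Gser_eq_algebraMap (B := B) (q := q) 0 (fe n k) (fo n k)
  rw [sg, Matrix.smul_apply, Matrix.sub_apply, ht]
  exact Subalgebra.smul_mem _ (sub_mem (Cart.c_mem k) (Subalgebra.algebraMap_mem _ _)) _

theorem wprod_mem_Esub_nil {l : List (ℕ × Fin (2 * n) × Fin (2 * n))} (hl : NSorted l)
    (hb : ∀ g ∈ l, n ≤ bk g) : wprod (sg q S) l ∈ Esub q S c [] := by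
  suffices ∃ l₁ l₂, l = l₁ ++ l₂ ∧ (∀ g ∈ l₁, bk g = n) ∧ ∀ g ∈ l₂, bk g = n + 1 by
    obtain ⟨l₁, l₂, rfl, h1, h2⟩ := this
    refine Submodule.subset_span ⟨l₁, wprod (sg q S) l₂, (List.pairwise_append.1 hl).1, h1, ?_,
      (wprod_append _ _ _).symm⟩
    refine list_prod_mem fun x hx => ?_
    obtain ⟨g, hg, rfl⟩ := List.mem_map.1 hx
    obtain ⟨k, rfl⟩ := exists_of_bk_eq (h2 g hg)
    exact sg_c_mem_Cart k
  induction l with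
  | nil => exact ⟨[], [], rfl, by simp, by simp⟩
  | cons g t ih =>
    have hg := hb g (by simp)
    rcases bk_cases g with h | ⟨k, rfl⟩ | ⟨k, h⟩
    · obtain ⟨l₁, l₂, rfl, h1, h2⟩ := ih (List.pairwise_cons.1 hl).2 fun g hg => hb g (by simp [hg])
      exact ⟨g :: l₁, l₂, rfl, by simpa [h.1] using h1, h2⟩
    · refine ⟨[], _, rfl, by simp, ?_⟩
      have h1 : ∀ g ∈ t, n + 1 ≤ bk g := fun g hg => by
        have := bk_le_of_rk_le ((List.pairwise_cons.1 hl).1 g hg)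
        rwa [bk_fe_fo] at this
      have h2 : ∀ g : ℕ × Fin (2 * n) × Fin (2 * n), bk g ≤ n + 1 := by
        intro g
        have := g.2.1.isLt
        rw [bk]
        split_ifs <;> omega
      simp only [List.mem_cons, forall_eq_or_imp, bk_fe_fo, true_and]
      exact fun g hg => le_antisymm (h2 g) (h1 g hg)
    · have := k.isLt
      rcases h with rfl | rfl | rfl <;> simp only [bk_fe_fe, bk_fo_fo, bk_fo_fe] at hg <;> omega

theorem SpRep.wprod_mem_Esub (h : SpRep q S c) (hq : q ≠ 0) (ks : List (Fin n))
    (hks : ks.Pairwise (· < ·)) : ∀ l : List (ℕ × Fin (2 * n) × Fin (2 * n)), NSorted l →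
    (∀ g ∈ l, n ≤ bk g ∨ ∃ k ∈ ks, bk g = k) → wprod (sg q S) l ∈ Esub q S c ks := by
  induction ks with
  | nil => exact fun l hl hb => wprod_mem_Esub_nil hl (by simpa using hb)
  | cons k ks ih =>
    intro l
    have hks' := List.pairwise_cons.1 hks
    induction l with
    | nil => exact fun _ _ => Esub_le_cons k ks (ih hks'.2 _ List.Pairwise.nil (by simp))
    | cons g t iht =>
      intro hl hb
      have hl' := List.pairwise_cons.1 hl
      by_cases hg : bk g = k
      · rw [wprod_cons]
        exact h.Esub_letter hq (iht hl'.2 fun g' hg' => hb g' (by simp [hg'])) hg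
      · refine Esub_le_cons k ks (ih hks'.2 _ hl ?_)
        have hgk : (k : ℕ) < bk g := by
          rcases hb g (by simp) with h1 | ⟨m, hm, h1⟩
          · exact k.isLt.trans_le h1
          · rcases List.mem_cons.1 hm with rfl | hm
            · exact absurd h1 hg
            · rw [h1]; exact hks'.1 m hm
        intro g' hg'
        have h2 : bk g ≤ bk g' := by
          rcases List.mem_cons.1 hg' with rfl | h3
          · exact le_rfl
          · exact bk_le_of_rk_le (hl'.1 g' h3)
        rcases hb g' hg' with h3 | ⟨m, hm, h3⟩
        · exact .inl h3
        · rcases List.mem_cons.1 hm with rfl | hm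
          · omega
          · exact .inr ⟨m, hm, h3⟩

end Elimination

section Spanning

variable {F : Type} [Field F] {n : ℕ} {B : Type} [Ring B] [Algebra F B] {q : F}
variable {S : ℕ → Matrix (Fin (2 * n)) (Fin (2 * n)) B} {c : Fin n → B}

theorem SpRep.commute_c (h : SpRep q S c) (hq : q ≠ 0) (k m : Fin n) :
    Commute (S 0 (fe n k) (fo n k)) (S 0 (fe n m) (fo n m)) := by
  have := h.comm_form hq k (fe n m)
  rwa [pr_fe] at this

theorem commute_of_inverse {a x x' : B} (h : Commute a x) (h1 : x * x' = 1) (h2 : x' * x = 1) :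
    Commute a x' :=
  calc a * x' = x' * (x * a) * x' := by rw [← mul_assoc, h2, one_mul]
    _ = x' * a := by rw [← h.eq, mul_assoc, mul_assoc, h1, mul_one]

theorem SpRep.commute_Cart (h : SpRep q S c) (hq : q ≠ 0) {x y : B} (hx : x ∈ Cart F S c)
    (hy : y ∈ Cart F S c) : Commute x y := by
  refine Algebra.commute_of_mem_adjoin_of_forall_mem_commute hy fun b hb => ?_
  refine (Algebra.commute_of_mem_adjoin_of_forall_mem_commute hx fun a ha => ?_).symm
  have key : ∀ k m, Commute (S 0 (fe n k) (fo n k)) (c m) := fun k m =>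
    commute_of_inverse (h.commute_c hq k m) (h.invR m) (h.invL m)
  rcases ha with ⟨k, rfl⟩ | ⟨k, rfl⟩ <;> rcases hb with ⟨m, rfl⟩ | ⟨m, rfl⟩
  · exact h.commute_c hq m k
  · exact (key k m).symm
  · exact key m k
  · exact commute_of_inverse (key k m).symm (h.invR k) (h.invL k)

theorem SpRep.clear_denominators (h : SpRep q S c) (hq : q ≠ 0) {y : B} (hy : y ∈ Cart F S c) :
    ∃ v ∈ Submonoid.closure (Set.range fun k => S 0 (fe n k) (fo n k)),
      y * v ∈ Algebra.adjoin F (Set.range fun k => S 0 (fe n k) (fo n k)) := by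
  have hsub : ∀ v ∈ Submonoid.closure (Set.range fun k => S 0 (fe n k) (fo n k)),
      v ∈ Algebra.adjoin F (Set.range fun k => S 0 (fe n k) (fo n k)) := fun v hv =>
    (Submonoid.closure_le (S := (Algebra.adjoin F _).toSubmonoid)).2 Algebra.subset_adjoin hv
  have hle : Algebra.adjoin F (Set.range fun k => S 0 (fe n k) (fo n k)) ≤ Cart F S c :=
    Algebra.adjoin_mono Set.subset_union_left
  induction hy using Algebra.adjoin_induction with
  | mem x hx =>
    rcases hx with ⟨k, rfl⟩ | ⟨k, rfl⟩
    · exact ⟨1, one_mem _, by rw [mul_one]; exact Algebra.subset_adjoin ⟨k, rfl⟩⟩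
    · exact ⟨_, Submonoid.subset_closure ⟨k, rfl⟩, by
        simp only [h.invL]; exact one_mem _⟩
  | algebraMap r => exact ⟨1, one_mem _, by rw [mul_one]; exact Subalgebra.algebraMap_mem _ _⟩
  | add x y hx hy ihx ihy =>
    obtain ⟨v, hv, hxv⟩ := ihx
    obtain ⟨w, hw, hyw⟩ := ihy
    refine ⟨v * w, mul_mem hv hw, ?_⟩
    have : (x + y) * (v * w) = x * v * w + y * w * v := by
      rw [add_mul, mul_assoc x, mul_assoc y,
        (h.commute_Cart hq (hle (hsub v hv)) (hle (hsub w hw))).eq]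
    rw [this]
    exact add_mem (mul_mem hxv (hsub w hw)) (mul_mem hyw (hsub v hv))
  | mul x y hx hy ihx ihy =>
    obtain ⟨v, hv, hxv⟩ := ihx
    obtain ⟨w, hw, hyw⟩ := ihy
    refine ⟨v * w, mul_mem hv hw, ?_⟩
    have : x * y * (v * w) = x * v * (y * w) := by
      rw [mul_assoc, ← mul_assoc y, (h.commute_Cart hq hy (hle (hsub v hv))).eq, mul_assoc v,
        mul_assoc]
    rw [this]
    exact mul_mem hxv hyw

theorem SpRep.adjoin_le_span (h : SpRep q S c) (hq : q ≠ 0) (hq1 : q ≠ 1) {y : B}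
    (hy : y ∈ Algebra.adjoin F (Set.range fun k => S 0 (fe n k) (fo n k))) :
    y ∈ Submodule.span F {x | ∃ l, NSorted l ∧ (∀ g ∈ l, bk g = n + 1) ∧
      wprod (sg q S) l = x} := by
  have hle : Algebra.adjoin F (Set.range fun k => S 0 (fe n k) (fo n k)) ≤
      Algebra.adjoin F (Set.range fun k => sg q S 0 (fe n k) (fo n k)) := by
    refine Algebra.adjoin_le ?_
    rintro _ ⟨k, rfl⟩
    obtain ⟨t, ht⟩ := Gser_eq_algebraMap (B := B) (q := q) 0 (fe n k) (fo n k)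
    change S 0 (fe n k) (fo n k) ∈
      Algebra.adjoin F (Set.range fun k => sg q S 0 (fe n k) (fo n k))
    rw [eq_Gser_add_smul_sg (S := S) hq1, Matrix.add_apply, ht, Matrix.smul_apply]
    exact add_mem (Subalgebra.algebraMap_mem _ _)
      (Subalgebra.smul_mem _ (Algebra.subset_adjoin (Set.mem_range_self k)) _)
  have h1 : y ∈ Subalgebra.toSubmodule
      (Algebra.adjoin F (Set.range fun k => sg q S 0 (fe n k) (fo n k))) := hle hy
  rw [Algebra.adjoin_eq_span] at h1
  refine Submodule.span_mono ?_ h1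
  intro x hx
  obtain ⟨l, hl, rfl⟩ := Submonoid.exists_list_of_mem_closure hx
  have h2 : ∃ l' : List (ℕ × Fin (2 * n) × Fin (2 * n)), (∀ g ∈ l', bk g = n + 1) ∧
      wprod (sg q S) l' = l.prod := by
    clear hx
    induction l with
    | nil => exact ⟨[], by simp, rfl⟩
    | cons x l ih =>
      obtain ⟨l', h3, h4⟩ := ih fun y hy => hl y (by simp [hy])
      obtain ⟨k, rfl⟩ := hl x (by simp)
      exact ⟨(0, fe n k, fo n k) :: l', by simpa [bk_fe_fo] using h3, by
        rw [wprod_cons, h4, List.prod_cons]⟩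
  obtain ⟨l', h3, h4⟩ := h2
  refine ⟨nsort l', nsorted_nsort l', fun g hg => h3 g ((nsort_perm l').mem_iff.1 hg), ?_⟩
  rw [← h4]
  refine (((nsort_perm l').symm.map _).prod_eq' ?_).symm
  refine List.Pairwise.map _ (fun _ _ h => h) (List.pairwise_of_forall_mem_list ?_)
  intro a ha b hb
  obtain ⟨k, rfl⟩ := exists_of_bk_eq (h3 a ha)
  obtain ⟨m, rfl⟩ := exists_of_bk_eq (h3 b hb)
  exact h.commute_Cart hq (sg_c_mem_Cart k) (sg_c_mem_Cart m)

theorem SpRep.Esub_le_span (h : SpRep q S c) (hq1 : q ≠ 1) (ks : List (Fin n))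
    (hks : ks.Pairwise (· < ·)) : Esub q S c ks ≤ Submodule.span F {x | ∃ l y, NSorted l ∧
      (∀ g ∈ l, Good g ∧ (bk g = n ∨ ∃ k ∈ ks, bk g = k)) ∧ y ∈ Cart F S c ∧
      wprod (sg q S) l * y = x} := by
  induction ks with
  | nil =>
    refine Submodule.span_le.2 ?_
    rintro _ ⟨l, y, h1, h2, h3, rfl⟩
    by_cases hg : ∀ g ∈ l, Good g
    · exact Submodule.subset_span ⟨l, y, h1, fun g hg' => ⟨hg g hg', .inl (h2 g hg')⟩, h3, rfl⟩
    · push Not at hg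
      obtain ⟨⟨r, i, j⟩, hgl, hg⟩ := hg
      simp only [Good, not_or, not_not] at hg
      obtain ⟨rfl, h4, h5, h6⟩ := hg
      have h7 : j ≠ pr i := by
        rcases bk_cases (0, i, j) with h8 | ⟨k, h8⟩ | ⟨k, h8⟩
        · exact fun h9 => h8.2.1 ⟨rfl, h9⟩
        · have := h2 _ hgl; rw [h8, bk_fe_fo] at this; omega
        · have h9 := h2 _ hgl
          have := k.isLt
          rcases h8 with h8 | h8 | h8 <;> rw [h8] at h9 <;>
            simp only [bk_fe_fe, bk_fo_fo, bk_fo_fe] at h9 <;> omega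
      have h8 : i < j := lt_of_le_of_ne (not_lt.1 fun h9 => h5 ⟨h9, h7⟩) h4
      have h9 : wprod (sg q S) l = 0 := by
        refine List.prod_eq_zero (List.mem_map.2 ⟨_, hgl, ?_⟩)
        dsimp only
        rw [sg_of_Gser_eq_zero fun h10 => h7 h10.2, h.zero_of_lt h8 h7, smul_zero]
      change _ ∈ Submodule.span F _
      rw [h9, zero_mul]
      exact zero_mem _
  | cons k ks ih =>
    have hks' := List.pairwise_cons.1 hks
    refine Submodule.span_le.2 ?_
    rintro _ ⟨i, j, e, he, rfl⟩
    rw [← mul_assoc]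
    refine mul_left_mem_of_span ?_ (ih hks'.2 he)
    rintro _ ⟨l, y, h1, h2, h3, rfl⟩
    have hfe : S 0 (fe n k) (fe n k) = (q - 1) • sg q S 0 (fe n k) (fe n k) := by
      rw [sg_of_Gser_eq_zero fun h => pr_ne _ h.2.symm, smul_inv_smul₀ (sub_ne_zero.2 hq1)]
    have hfo : S 0 (fo n k) (fo n k) = (q - 1) • sg q S 0 (fo n k) (fo n k) := by
      rw [sg_of_Gser_eq_zero fun h => pr_ne _ h.2.symm, smul_inv_smul₀ (sub_ne_zero.2 hq1)]
    rw [hfe, hfo, smul_pow, smul_pow, smul_mul_smul_comm, smul_mul_assoc, ← mul_assoc]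
    refine Submodule.smul_mem _ _ (Submodule.subset_span
      ⟨List.replicate i (0, fe n k, fe n k) ++ (List.replicate j (0, fo n k, fo n k) ++ l), y,
        ?_, ?_, h3, ?_⟩)
    · have hlt : ∀ g ∈ l, (k : ℕ) < bk g := by
        intro g hg
        rcases (h2 g hg).2 with h4 | ⟨m, hm, h4⟩
        · rw [h4]; exact k.isLt
        · rw [h4]; exact hks'.1 m hm
      refine List.pairwise_append.2 ⟨List.pairwise_replicate.2 (.inr le_rfl),
        List.pairwise_append.2 ⟨List.pairwise_replicate.2 (.inr le_rfl), h1, ?_⟩, ?_⟩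
      · intro a ha b hb
        rw [List.eq_of_mem_replicate ha]
        exact rk_le_of_bk_lt (by rw [bk_fo_fo]; exact hlt b hb)
      · intro a ha b hb
        rw [List.eq_of_mem_replicate ha]
        rcases List.mem_append.1 hb with hb | hb
        · rw [List.eq_of_mem_replicate hb]
          exact rk_fe_le_rk_fo k
        · exact rk_le_of_bk_lt (by rw [bk_fe_fe]; exact hlt b hb)
    · intro g hg
      rcases List.mem_append.1 hg with hg | hg
      · rw [List.eq_of_mem_replicate hg]
        exact ⟨.inr (.inl rfl), .inr ⟨k, by simp, bk_fe_fe k⟩⟩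
      rcases List.mem_append.1 hg with hg | hg
      · rw [List.eq_of_mem_replicate hg]
        exact ⟨.inr (.inl rfl), .inr ⟨k, by simp, bk_fo_fo k⟩⟩
      · obtain ⟨h4, h5⟩ := h2 g hg
        refine ⟨h4, h5.imp_right ?_⟩
        rintro ⟨m, hm, h6⟩
        exact ⟨m, by simp [hm], h6⟩
    · rw [wprod_append, wprod_append]
      simp [wprod, mul_assoc]

theorem SpRep.mem_span_words (h : SpRep q S c) (hq : q ≠ 0) (hq1 : q ≠ 1)
    (hgen : Algebra.adjoin F ({x | ∃ r i j, x = S r i j} ∪ Set.range c) = ⊤) (x : B) :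
    x ∈ Submodule.span F {x | ∃ l y, y ∈ Cart F S c ∧ wprod (sg q S) l * y = x} := by
  set V := Submodule.span F {x | ∃ l y, y ∈ Cart F S c ∧ wprod (sg q S) l * y = x} with hV
  have h1 : (1 : B) ∈ V := Submodule.subset_span ⟨[], 1, one_mem _, by simp⟩
  suffices ∀ x ∈ Algebra.adjoin F ({x | ∃ r i j, x = S r i j} ∪ Set.range c), ∀ y ∈ V,
      x * y ∈ V by
    simpa using this x (by rw [hgen]; trivial) 1 h1
  intro x hx
  induction hx using Algebra.adjoin_induction with
  | mem x hx =>
    intro y hy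
    refine mul_left_mem_of_span ?_ hy
    rintro _ ⟨l, z, hz, rfl⟩
    rcases hx with ⟨r, i, j, rfl⟩ | ⟨k, rfl⟩
    · obtain ⟨t, ht⟩ := Gser_eq_algebraMap (B := B) (q := q) r i j
      rw [eq_Gser_add_smul_sg (S := S) hq1, Matrix.add_apply, ht, Matrix.smul_apply, add_mul,
        algebraMap_mul_eq_smul, smul_mul_assoc]
      refine add_mem (Submodule.smul_mem _ _ (Submodule.subset_span ⟨l, z, hz, rfl⟩))
        (Submodule.smul_mem _ _ (Submodule.subset_span ⟨(r, i, j) :: l, z, hz, ?_⟩))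
      rw [wprod_cons, mul_assoc]
    · obtain ⟨μ, -, hμ⟩ : QComm F (c k) (wprod (sg q S) l) := by
        refine QComm.list_prod fun x hx => ?_
        obtain ⟨g, -, rfl⟩ := List.mem_map.1 hx
        exact h.qComm_inv_sg hq _ _ _ _
      rw [← mul_assoc, hμ, smul_mul_assoc, mul_assoc]
      exact Submodule.smul_mem _ _
        (Submodule.subset_span ⟨l, c k * z, mul_mem (Cart.inv_mem k) hz, rfl⟩)
  | algebraMap r =>
    intro y hy
    rw [algebraMap_mul_eq_smul]
    exact Submodule.smul_mem _ _ hy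
  | add a b _ _ iha ihb =>
    intro y hy
    rw [add_mul]
    exact add_mem (iha y hy) (ihb y hy)
  | mul a b _ _ iha ihb =>
    intro y hy
    rw [mul_assoc]
    exact iha _ (ihb y hy)

variable {A : Type} [CommRing A] [Algebra A F] [Algebra A B] [IsScalarTower A F B] {u : Aˣ}

theorem smul_sg_eq (hu : algebraMap A F u = q) (hq1 : q ≠ 1) (r : ℕ) :
    S r = Gser q B r + ((u : A) - 1) • sg q S r := by
  rw [← IsScalarTower.algebraMap_smul F ((u : A) - 1) (sg q S r), map_sub, hu, map_one]
  exact eq_Gser_add_smul_sg hq1 r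

/-- Every element becomes a combination of normal words after multiplication by a monomial in the
`s₀₁` of the blocks. -/
theorem SpRep.exists_mul_mem_span [IsLocalRing A] (h : SpRep q S c) (hq : q ≠ 0) (hq1 : q ≠ 1)
    (hu : algebraMap A F u = q) (hm : (u : A) - 1 ∈ IsLocalRing.maximalIdeal A)
    (hgen : Algebra.adjoin F ({x | ∃ r i j, x = S r i j} ∪ Set.range c) = ⊤) (x : B) :
    ∃ v ∈ Submonoid.closure (Set.range fun k => S 0 (fe n k) (fo n k)),
      x * v ∈ Submodule.span F {x | ∃ l, NSorted l ∧ (∀ g ∈ l, Good g) ∧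
        wprod (sg q S) l = x} := by
  have hcomm := h.refl.commutator_mem hu hq1 (smul_sg_eq hu hq1) hm
  have hword : ∀ l, wprod (sg q S) l ∈ Esub q S c (List.finRange n) := by
    intro l
    have h1 := Zf_le_span_normal le_rfl (fun r s i l j b => hcomm s r i l j b) nsort
      (fun l => (nsort_perm l).symm) l.length (wt l) (wprod_mem_Zf l le_rfl le_rfl)
    refine (Submodule.span_le (p := (Esub q S c (List.finRange n)).restrictScalars A)).2 ?_ h1
    rintro _ ⟨l, rfl⟩
    refine h.wprod_mem_Esub hq _ (List.pairwise_lt_finRange n) _ (nsorted_nsort l) fun g _ => ?_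
    rcases lt_or_ge (bk g) n with h2 | h2
    · exact .inr ⟨⟨_, h2⟩, List.mem_finRange _, rfl⟩
    · exact .inl h2
  have hx : x ∈ Submodule.span F {x | ∃ l y, NSorted l ∧ (∀ g ∈ l, Good g ∧ bk g ≤ n) ∧
      y ∈ Cart F S c ∧ wprod (sg q S) l * y = x} := by
    refine (Submodule.span_le.2 ?_) (h.mem_span_words hq hq1 hgen x)
    rintro _ ⟨l, y, hy, rfl⟩
    refine Submodule.span_mono ?_ (h.Esub_le_span hq1 _ (List.pairwise_lt_finRange n)
      (Esub_mul_right hy _ (hword l)))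
    rintro _ ⟨l, y, h1, h2, h3, rfl⟩
    refine ⟨l, y, h1, fun g hg => ⟨(h2 g hg).1, ?_⟩, h3, rfl⟩
    rcases (h2 g hg).2 with h4 | ⟨k, -, h4⟩
    · exact h4.le
    · rw [h4]; exact k.isLt.le
  have hcl : ∀ v ∈ Submonoid.closure (Set.range fun k => S 0 (fe n k) (fo n k)),
      v ∈ Algebra.adjoin F (Set.range fun k => S 0 (fe n k) (fo n k)) := fun v hv =>
    (Submonoid.closure_le (S := (Algebra.adjoin F _).toSubmonoid)).2 Algebra.subset_adjoin hv
  have hle : Algebra.adjoin F (Set.range fun k => S 0 (fe n k) (fo n k)) ≤ Cart F S c :=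
    Algebra.adjoin_mono Set.subset_union_left
  set V := Submodule.span F {x | ∃ l y, NSorted l ∧ (∀ g ∈ l, Good g ∧ bk g ≤ n) ∧
    y ∈ Algebra.adjoin F (Set.range fun k => S 0 (fe n k) (fo n k)) ∧
    wprod (sg q S) l * y = x} with hV
  have hVr : ∀ z ∈ V, ∀ v ∈ Submonoid.closure (Set.range fun k => S 0 (fe n k) (fo n k)),
      z * v ∈ V := by
    intro z hz v hv
    refine mul_right_mem_of_span ?_ hz
    rintro _ ⟨l, y, h1, h2, h3, rfl⟩
    exact Submodule.subset_span ⟨l, y * v, h1, h2, mul_mem h3 (hcl v hv), (mul_assoc _ _ _).symm⟩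
  have hx' : ∃ v ∈ Submonoid.closure (Set.range fun k => S 0 (fe n k) (fo n k)), x * v ∈ V := by
    induction hx using Submodule.span_induction with
    | mem x hx =>
      obtain ⟨l, y, h1, h2, h3, rfl⟩ := hx
      obtain ⟨v, hv, hyv⟩ := h.clear_denominators hq h3
      exact ⟨v, hv, Submodule.subset_span ⟨l, y * v, h1, h2, hyv, (mul_assoc _ _ _).symm⟩⟩
    | zero => exact ⟨1, one_mem _, by rw [zero_mul]; exact zero_mem _⟩
    | add a b _ _ iha ihb =>
      obtain ⟨v, hv, hav⟩ := iha
      obtain ⟨w, hw, hbw⟩ := ihb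
      refine ⟨v * w, mul_mem hv hw, ?_⟩
      have : (a + b) * (v * w) = a * v * w + b * w * v := by
        rw [add_mul, mul_assoc a, mul_assoc b,
          (h.commute_Cart hq (hle (hcl v hv)) (hle (hcl w hw))).eq]
      rw [this]
      exact add_mem (hVr _ hav w hw) (hVr _ hbw v hv)
    | smul t a _ iha =>
      obtain ⟨v, hv, hav⟩ := iha
      exact ⟨v, hv, by rw [smul_mul_assoc]; exact Submodule.smul_mem _ _ hav⟩
  obtain ⟨v, hv, hxv⟩ := hx'
  refine ⟨v, hv, (Submodule.span_le.2 ?_) hxv⟩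
  rintro _ ⟨l, y, h1, h2, h3, rfl⟩
  refine mul_left_mem_of_span ?_ (h.adjoin_le_span hq hq1 h3)
  rintro _ ⟨l', h4, h5, rfl⟩
  refine Submodule.subset_span ⟨l ++ l', List.pairwise_append.2 ⟨h1, h4, ?_⟩, ?_,
    wprod_append _ _ _⟩
  · intro a ha b hb
    refine rk_le_of_bk_lt ?_
    rw [h5 b hb]
    exact Nat.lt_succ_of_le (h2 a ha).2
  · intro g hg
    rcases List.mem_append.1 hg with hg | hg
    · exact (h2 g hg).1
    · obtain ⟨k, rfl⟩ := exists_of_bk_eq (h5 g hg)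
      exact .inr (.inr (.inr ⟨fe_lt_fo.2 le_rfl, (pr_fe k).symm⟩))

end Spanning

section Probes

variable {N : ℕ} {A B : Type} [CommRing A] [Ring B] [Algebra A B]

/-- The span of all words. -/
def Wspan (A : Type) [CommRing A] [Algebra A B] (σ : ℕ → Matrix (Fin N) (Fin N) B) :
    Submodule A B := Submodule.span A (Set.range (wprod σ))

/-- The span of the words of length `< d`, modulo `I`. -/
def Jf (I : Ideal A) (σ : ℕ → Matrix (Fin N) (Fin N) B) (d : ℕ) : Submodule A B :=
  Submodule.span A {x | ∃ l, l.length < d ∧ wprod σ l = x} ⊔ I • Wspan A σ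

variable {I : Ideal A} {σ : ℕ → Matrix (Fin N) (Fin N) B}

theorem wprod_mem_Wspan (l : List (ℕ × Fin N × Fin N)) : wprod σ l ∈ Wspan A σ :=
  Submodule.subset_span (Set.mem_range_self l)

theorem wprod_mem_Jf {l : List (ℕ × Fin N × Fin N)} {d : ℕ} (h : l.length < d) :
    wprod σ l ∈ Jf I σ d :=
  Submodule.mem_sup_left (Submodule.subset_span ⟨l, h, rfl⟩)

theorem smul_Wspan_le_Jf (d : ℕ) : I • Wspan A σ ≤ Jf I σ d := le_sup_right

theorem smul_mem_Jf {a : A} (ha : a ∈ I) {x : B} (hx : x ∈ Wspan A σ) (d : ℕ) :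
    a • x ∈ Jf I σ d := smul_Wspan_le_Jf d (Submodule.smul_mem_smul ha hx)

theorem Jf_le_Wspan (d : ℕ) : Jf I σ d ≤ Wspan A σ := by
  refine sup_le (Submodule.span_le.2 ?_) Submodule.smul_le_right
  rintro _ ⟨l, -, rfl⟩
  exact wprod_mem_Wspan l

theorem Jf_mono {d d' : ℕ} (h : d ≤ d') : Jf I σ d ≤ Jf I σ d' := by
  refine sup_le_sup_right (Submodule.span_mono ?_) _
  rintro _ ⟨l, hl, rfl⟩
  exact ⟨l, hl.trans_le h, rfl⟩

/-- A linear map sending words to the span of words is controlled on `Jf` by its values on short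
words. -/
theorem map_Jf_le {f : B →ₗ[A] B} {d e : ℕ} (hW : ∀ l, f (wprod σ l) ∈ Wspan A σ)
    (h : ∀ l : List (ℕ × Fin N × Fin N), l.length < d → f (wprod σ l) ∈ Jf I σ e) :
    (Jf I σ d).map f ≤ Jf I σ e := by
  rw [Jf, Submodule.map_sup, Submodule.map_smul'']
  refine sup_le (Submodule.map_span_le _ _ _ |>.2 ?_)
    ((Submodule.smul_mono le_rfl (Submodule.map_span_le _ _ _ |>.2 ?_)).trans
      (smul_Wspan_le_Jf e))
  · rintro _ ⟨l, hl, rfl⟩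
    exact h l hl
  · rintro _ ⟨l, rfl⟩
    exact hW l

theorem mul_Wspan_le (g : ℕ × Fin N × Fin N) {x : B} (hx : x ∈ Wspan A σ) :
    σ g.1 g.2.1 g.2.2 * x ∈ Wspan A σ := by
  have : (Wspan A σ).map (LinearMap.mulLeft A (σ g.1 g.2.1 g.2.2)) ≤ Wspan A σ := by
    refine Submodule.map_span_le _ _ _ |>.2 ?_
    rintro _ ⟨l, rfl⟩
    rw [LinearMap.mulLeft_apply, ← wprod_cons]
    exact wprod_mem_Wspan _
  exact this (Submodule.mem_map_of_mem hx)

theorem Wspan_mul {x y : B} (hx : x ∈ Wspan A σ) (hy : y ∈ Wspan A σ) : x * y ∈ Wspan A σ := by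
  have : Wspan A σ * Wspan A σ ≤ Wspan A σ := by
    rw [Wspan, Submodule.span_mul_span]
    refine Submodule.span_mono ?_
    rintro _ ⟨_, ⟨l, rfl⟩, _, ⟨m, rfl⟩, rfl⟩
    exact ⟨l ++ m, wprod_append σ l m⟩
  exact this (Submodule.mul_mem_mul hx hy)

theorem mul_Jf_pred_mem (g : ℕ × Fin N × Fin N) {m : ℕ} {x : B} (hx : x ∈ Jf I σ (m - 1)) :
    σ g.1 g.2.1 g.2.2 * x ∈ Jf I σ m := by
  have : (Jf I σ (m - 1)).map (LinearMap.mulLeft A (σ g.1 g.2.1 g.2.2)) ≤ Jf I σ m := by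
    refine map_Jf_le (fun l => mul_Wspan_le g (wprod_mem_Wspan l)) fun l hl => ?_
    rw [LinearMap.mulLeft_apply, ← wprod_cons]
    exact wprod_mem_Jf (by simp only [List.length_cons]; omega)
  exact this (Submodule.mem_map_of_mem hx)

/-- The sum over letters of a word of the word without that letter, with coefficients. -/
def derW (σ : ℕ → Matrix (Fin N) (Fin N) B) (d : ℕ × Fin N × Fin N → A)
    (w : List (ℕ × Fin N × Fin N)) : B :=
  ∑ i : Fin w.length, d (w.get i) • wprod σ (w.eraseIdx i)

theorem derW_cons (d : ℕ × Fin N × Fin N → A) (g : ℕ × Fin N × Fin N)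
    (w : List (ℕ × Fin N × Fin N)) :
    derW σ d (g :: w) = d g • wprod σ w + σ g.1 g.2.1 g.2.2 * derW σ d w := by
  refine (Fin.sum_univ_succ (n := w.length) fun i =>
    d ((g :: w).get i) • wprod σ ((g :: w).eraseIdx i)).trans ?_
  simp [derW, wprod_cons, Finset.mul_sum]

theorem derW_mem (d : ℕ × Fin N × Fin N → A) (w : List (ℕ × Fin N × Fin N)) :
    derW σ d w ∈ Jf I σ w.length := by
  refine sum_mem fun i _ => Submodule.smul_mem _ _ (wprod_mem_Jf ?_)
  have := List.length_eraseIdx_add_one i.2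
  omega

/-- `D` acts on words as a derivation with values `d` on letters plus the scalar `e`, up to
shorter words and modulo `I`. -/
def IsDer (I : Ideal A) (σ : ℕ → Matrix (Fin N) (Fin N) B) (D : B →ₗ[A] B) (e : A)
    (d : ℕ × Fin N × Fin N → A) : Prop :=
  ∀ w, D (wprod σ w) - (e • wprod σ w + derW σ d w) ∈ Jf I σ (w.length - 1)

theorem IsDer.zero : IsDer I σ 0 0 0 := fun w => by simp [derW]

theorem IsDer.add {D D' : B →ₗ[A] B} {e e' : A} {d d' : ℕ × Fin N × Fin N → A}
    (h : IsDer I σ D e d) (h' : IsDer I σ D' e' d') : IsDer I σ (D + D') (e + e') (d + d') := by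
  intro w
  convert add_mem (h w) (h' w) using 1
  simp only [derW, LinearMap.add_apply, Pi.add_apply, add_smul, Finset.sum_add_distrib]
  abel

theorem IsDer.smul {D : B →ₗ[A] B} {e : A} {d : ℕ × Fin N × Fin N → A}
    (h : IsDer I σ D e d) (a : A) : IsDer I σ (a • D) (a * e) (a • d) := by
  intro w
  convert Submodule.smul_mem _ a (h w) using 1
  simp only [derW, LinearMap.smul_apply, Pi.smul_apply, smul_sub, smul_add, Finset.smul_sum,
    smul_smul, smul_eq_mul]

theorem IsDer.sum {ι : Type} (s : Finset ι) {D : ι → B →ₗ[A] B} {e : ι → A}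
    {d : ι → ℕ × Fin N × Fin N → A} (h : ∀ i ∈ s, IsDer I σ (D i) (e i) (d i)) :
    IsDer I σ (∑ i ∈ s, D i) (∑ i ∈ s, e i) (∑ i ∈ s, d i) := by
  classical
  induction s using Finset.induction_on with
  | empty => exact IsDer.zero
  | insert i s hi ih =>
    rw [Finset.sum_insert hi, Finset.sum_insert hi, Finset.sum_insert hi]
    exact (h i (Finset.mem_insert_self i s)).add (ih fun j hj => h j (Finset.mem_insert_of_mem hj))

theorem IsDer.map_mem {D : B →ₗ[A] B} {d : ℕ × Fin N × Fin N → A} (h : IsDer I σ D 0 d) {m : ℕ}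
    {x : B} (hx : x ∈ Jf I σ (m + 1)) : D x ∈ Jf I σ m := by
  have key : ∀ w, D (wprod σ w) ∈ Jf I σ w.length := fun w => by
    have := add_mem (Jf_mono (Nat.sub_le _ 1) (h w)) (derW_mem (I := I) (σ := σ) d w)
    simpa using this
  exact map_Jf_le (fun l => Jf_le_Wspan _ (key l))
    (fun l hl => Jf_mono (Nat.lt_succ_iff.1 hl) (key l)) (Submodule.mem_map_of_mem hx)

/-- Successive application of the maps attached to the letters of a word. -/
def iterD (P : ℕ × Fin N × Fin N → B →ₗ[A] B) : List (ℕ × Fin N × Fin N) → B →ₗ[A] B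
  | [] => LinearMap.id
  | g :: l => iterD P l ∘ₗ P g

/-- The number of bijections matching equal letters of two words. -/
def matchings : List (ℕ × Fin N × Fin N) → List (ℕ × Fin N × Fin N) → ℕ
  | [], _ => 1
  | g :: l, w => ∑ i : Fin w.length, if w.get i = g then matchings l (w.eraseIdx i) else 0

theorem perm_cons_of_matchings {l : List (ℕ × Fin N × Fin N)} :
    ∀ {w : List (ℕ × Fin N × Fin N)}, w.length = l.length → (matchings l w ≠ 0 ↔ l.Perm w) := by
  induction l with
  | nil =>
    intro w hw
    obtain rfl := List.length_eq_zero_iff.1 hw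
    simp [matchings]
  | cons g l ih =>
    intro w hw
    have hlen : ∀ i : Fin w.length, (w.eraseIdx i).length = l.length := fun i => by
      have := List.length_eraseIdx_add_one i.2
      simp only [List.length_cons] at hw
      omega
    have hp : ∀ i : Fin w.length, (w.get i :: w.eraseIdx i).Perm w := fun i =>
      List.getElem_cons_eraseIdx_perm i.2
    rw [matchings, ne_eq, Finset.sum_eq_zero_iff, not_forall]
    constructor
    · rintro ⟨i, hi⟩
      simp only [Finset.mem_univ, forall_const, ite_eq_right_iff, Classical.not_imp] at hi
      obtain ⟨h1, h2⟩ := hi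
      have := hp i
      rw [h1] at this
      exact (((ih (hlen i)).1 h2).cons g).trans this
    · intro h
      obtain ⟨i, hi⟩ := List.get_of_mem (h.subset (List.mem_cons_self))
      refine ⟨i, ?_⟩
      simp only [Finset.mem_univ, forall_const, ite_eq_right_iff, Classical.not_imp]
      refine ⟨hi, (ih (hlen i)).2 ?_⟩
      have := hp i
      rw [hi] at this
      exact (h.trans this.symm).cons_inv

variable {P : ℕ × Fin N × Fin N → B →ₗ[A] B} {d : ℕ × Fin N × Fin N → ℕ × Fin N × Fin N → A}

theorem iterD_mem {l : List (ℕ × Fin N × Fin N)} (hP : ∀ g ∈ l, IsDer I σ (P g) 0 (d g)) {m : ℕ} :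
    ∀ {x : B}, x ∈ Jf I σ (l.length + m) → iterD P l x ∈ Jf I σ m := by
  induction l with
  | nil => intro x hx; simpa [iterD] using hx
  | cons g l ih =>
    intro x hx
    refine ih (fun g' hg' => hP g' (List.mem_cons_of_mem _ hg')) ?_
    refine (hP g List.mem_cons_self).map_mem ?_
    rwa [List.length_cons, add_right_comm] at hx

theorem iterD_wprod {Q : ℕ × Fin N × Fin N → Prop} {v : ℕ × Fin N × Fin N → A}
    (hd : ∀ g g', Q g → Q g' → d g g' = if g' = g then v g else 0)
    {l : List (ℕ × Fin N × Fin N)} (hl : ∀ g ∈ l, Q g)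
    (hP : ∀ g ∈ l, IsDer I σ (P g) 0 (d g)) :
    ∀ {w : List (ℕ × Fin N × Fin N)}, (∀ g ∈ w, Q g) → w.length = l.length →
      iterD P l (wprod σ w) - ((matchings l w : A) * (l.map v).prod) • (1 : B) ∈ Jf I σ 0 := by
  induction l with
  | nil =>
    intro w _ hw
    obtain rfl := List.length_eq_zero_iff.1 hw
    simp [iterD, matchings]
  | cons g l ih =>
    intro w hwQ hw
    have hl' : ∀ g' ∈ l, Q g' := fun g' hg' => hl g' (List.mem_cons_of_mem _ hg')
    have hP' : ∀ g' ∈ l, IsDer I σ (P g') 0 (d g') := fun g' hg' =>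
      hP g' (List.mem_cons_of_mem _ hg')
    have h1 : P g (wprod σ w) - derW σ (d g) w ∈ Jf I σ (l.length + 0) := by
      have := hP g List.mem_cons_self w
      rw [hw] at this
      simpa using this
    have h2 := iterD_mem hP' h1
    have h3 : iterD P l (derW σ (d g) w) -
        ((matchings (g :: l) w : A) * ((g :: l).map v).prod) • (1 : B) ∈ Jf I σ 0 := by
      rw [derW, map_sum, matchings, Nat.cast_sum, Finset.sum_mul, Finset.sum_smul,
        ← Finset.sum_sub_distrib]
      refine sum_mem fun i _ => ?_
      rw [map_smul, hd g _ (hl g List.mem_cons_self) (hwQ _ (List.get_mem w i))]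
      split_ifs with h
      · have hlen : (w.eraseIdx i).length = l.length := by
          have := List.length_eraseIdx_add_one i.2
          simp only [List.length_cons] at hw
          omega
        have := Submodule.smul_mem _ (v g) (ih hl' hP'
          (fun g' hg' => hwQ g' (List.mem_of_mem_eraseIdx hg')) hlen)
        rw [smul_sub, smul_smul] at this
        rw [List.map_cons, List.prod_cons]
        convert this using 3
        ring
      · simp
    convert add_mem h2 h3 using 1
    rw [map_sub, iterD, LinearMap.comp_apply]
    abel

/-- Words distinguished by probes are independent modulo the maximal ideal. -/
theorem sum_smul_wprod_ne_zero [IsLocalRing A] [Algebra ℚ A] {Q : ℕ × Fin N × Fin N → Prop}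
    {v : ℕ × Fin N × Fin N → A}
    (hd : ∀ g g', Q g → Q g' → d g g' = if g' = g then v g else 0)
    (hv : ∀ g, Q g → IsUnit (v g))
    (hP : ∀ g, Q g → IsDer (IsLocalRing.maximalIdeal A) σ (P g) 0 (d g))
    (s : Finset (List (ℕ × Fin N × Fin N))) (hs : ∀ l ∈ s, ∀ g ∈ l, Q g)
    (hperm : ∀ l ∈ s, ∀ l' ∈ s, l.Perm l' → l = l')
    (h1 : ∀ t : A, IsUnit t → t • (1 : B) ∉ IsLocalRing.maximalIdeal A • Wspan A σ)
    (a : List (ℕ × Fin N × Fin N) → A) (ha : ∃ l ∈ s, IsUnit (a l)) :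
    ∑ l ∈ s, a l • wprod σ l ≠ 0 := by
  classical
  intro h0
  obtain ⟨l0, hl0, hmax⟩ := (s.filter fun l => IsUnit (a l)).exists_max_image List.length
    (by obtain ⟨l, hl, h⟩ := ha; exact ⟨l, Finset.mem_filter.2 ⟨hl, h⟩⟩)
  obtain ⟨hl0s, hl0u⟩ := Finset.mem_filter.1 hl0
  have hPl : ∀ g ∈ l0, IsDer (IsLocalRing.maximalIdeal A) σ (P g) 0 (d g) :=
    fun g hg => hP g (hs l0 hl0s g hg)
  have hother : ∀ l ∈ s, l ≠ l0 →
      a l • iterD P l0 (wprod σ l) ∈ Jf (IsLocalRing.maximalIdeal A) σ 0 := by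
    intro l hl hne
    by_cases hu : IsUnit (a l)
    · refine Submodule.smul_mem _ _ ?_
      rcases (hmax l (Finset.mem_filter.2 ⟨hl, hu⟩)).lt_or_eq with hlt | heq
      · exact iterD_mem hPl (wprod_mem_Jf (by simpa using hlt))
      · have := iterD_wprod hd (hs l0 hl0s) hPl (hs l hl) heq
        have hz : matchings l0 l = 0 := by
          by_contra hz
          exact hne (hperm l0 hl0s l hl ((perm_cons_of_matchings heq).1 hz)).symm
        simpa [hz] using this
    · rw [← map_smul]
      exact iterD_mem hPl (smul_mem_Jf ((IsLocalRing.mem_maximalIdeal _).2 hu)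
        (wprod_mem_Wspan l) _)
  have hself := iterD_wprod hd (hs l0 hl0s) hPl (hs l0 hl0s) rfl
  have hsum := congrArg (iterD P l0) h0
  rw [map_sum, map_zero, ← Finset.add_sum_erase s _ hl0s, map_smul] at hsum
  have hrest : ∑ l ∈ s.erase l0, iterD P l0 (a l • wprod σ l) ∈
      Jf (IsLocalRing.maximalIdeal A) σ 0 := sum_mem fun l hl => by
    rw [map_smul]
    exact hother l (Finset.mem_of_mem_erase hl) (Finset.ne_of_mem_erase hl)
  have hl0' : a l0 • iterD P l0 (wprod σ l0) ∈ Jf (IsLocalRing.maximalIdeal A) σ 0 := by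
    rw [eq_neg_of_add_eq_zero_left hsum]
    exact neg_mem hrest
  have hfin := sub_mem hl0' (Submodule.smul_mem _ (a l0) hself)
  rw [← smul_sub, sub_sub_cancel, smul_smul] at hfin
  refine h1 _ ?_ (by simpa [Jf] using hfin)
  refine hl0u.mul (IsUnit.mul ?_ ?_)
  · have hne : matchings l0 l0 ≠ 0 := (perm_cons_of_matchings rfl).2 (List.Perm.refl _)
    have : IsUnit (algebraMap ℚ A (matchings l0 l0 : ℚ)) :=
      (IsUnit.mk0 _ (Nat.cast_ne_zero.2 hne)).map _
    simpa using this
  · refine List.prod_induction IsUnit (fun _ _ => IsUnit.mul) isUnit_one ?_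
    intro x hx
    obtain ⟨g, hg, rfl⟩ := List.mem_map.1 hx
    exact hv g (hs l0 hl0s g hg)

end Probes

section Coideal

variable {F : Type} [Field F] {N n : ℕ} {B : Type} [Ring B] [Algebra F B] {q : F}

/-- The generating series of an entry of a matrix family. -/
def ps (f : ℕ → Matrix (Fin N) (Fin N) B) (i j : Fin N) : PowerSeries B :=
  PowerSeries.mk fun r => f r i j

theorem coeff_ps_mul_ps (f g : ℕ → Matrix (Fin N) (Fin N) B) (i j k l : Fin N) (r : ℕ) :
    PowerSeries.coeff r (ps f i j * ps g k l) =
      ∑ p ∈ Finset.range (r + 1), f p i j * g (r - p) k l := by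
  rw [PowerSeries.coeff_mul, Finset.Nat.sum_antidiagonal_eq_sum_range_succ_mk]
  simp [ps]

theorem ps_cauchy (f g : ℕ → Matrix (Fin N) (Fin N) B) (i j : Fin N) :
    ps (cauchy f g) i j = ∑ m, ps f i m * ps g m j := by
  ext r
  rw [map_sum]
  simp only [coeff_ps_mul_ps]
  rw [ps, PowerSeries.coeff_mk, cauchy, Matrix.sum_apply, Finset.sum_comm]
  simp only [Matrix.mul_apply]

theorem ps_Sfam (T Tb : ℕ → Matrix (Fin (2 * n)) (Fin (2 * n)) B) (i j : Fin (2 * n)) :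
    ps (Sfam q T Tb) i j = ∑ k, (q • (ps T i (fe n k) * ps Tb j (fo n k)) -
      ps T i (fo n k) * ps Tb j (fe n k)) := by
  ext r
  rw [ps, PowerSeries.coeff_mk, Sfam_apply, map_sum]
  simp only [bil]
  rw [Finset.sum_comm]
  refine Finset.sum_congr rfl fun k _ => ?_
  rw [map_sub, PowerSeries.coeff_smul, coeff_ps_mul_ps, coeff_ps_mul_ps, Finset.smul_sum,
    ← Finset.sum_sub_distrib]

theorem ps_commute {f g : ℕ → Matrix (Fin N) (Fin N) B} {i j k l : Fin N}
    (h : ∀ r s, Commute (f r i j) (g s k l)) : Commute (ps f i j) (ps g k l) := by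
  ext r
  rw [coeff_ps_mul_ps, coeff_ps_mul_ps, ← Finset.sum_range_reflect]
  refine Finset.sum_congr rfl fun p hp => ?_
  have hp := Finset.mem_range.1 hp
  rw [(h _ _).eq]
  congr 2
  omega

/-- The coideal property of the twisted `q`-Yangian. -/
theorem ps_Sfam_cauchy {T Tb T' Tb' : ℕ → Matrix (Fin (2 * n)) (Fin (2 * n)) B}
    (h : ∀ r s i j k l, Commute (Tb r i j) (T' s k l)) (i j : Fin (2 * n)) :
    ps (Sfam q (cauchy T T') (cauchy Tb Tb')) i j =
      ∑ m, ∑ m', ps T i m * ps Tb j m' * ps (Sfam q T' Tb') m m' := by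
  have hc : ∀ m m' k, ps T' m k * ps Tb j m' = ps Tb j m' * ps T' m k := fun m m' k =>
    (ps_commute fun r s => h r s j m' m k).eq.symm
  have key : ∀ k l, ps (cauchy T T') i k * ps (cauchy Tb Tb') j l =
      ∑ m, ∑ m', ps T i m * ps Tb j m' * (ps T' m k * ps Tb' m' l) := by
    intro k l
    rw [ps_cauchy, ps_cauchy, Finset.sum_mul_sum]
    refine Finset.sum_congr rfl fun m _ => Finset.sum_congr rfl fun m' _ => ?_
    rw [mul_assoc, ← mul_assoc (ps T' m k), hc]
    simp only [mul_assoc]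
  simp only [ps_Sfam, key, Finset.mul_sum, mul_sub, mul_smul_comm, Finset.smul_sum,
    Finset.sum_sub_distrib]
  congr 1
  · rw [Finset.sum_comm]
    refine Finset.sum_congr rfl fun m _ => ?_
    rw [Finset.sum_comm]
  · rw [Finset.sum_comm]
    refine Finset.sum_congr rfl fun m _ => ?_
    rw [Finset.sum_comm]

end Coideal

section EvalEntries

variable {F : Type} [Field F] {N : ℕ} {q : F}
variable {A : Type} [CommRing A] [Algebra A F]

/-- The constant `1 + q⁻¹`. -/
def kap (u : Aˣ) : A := 1 + (u⁻¹ : Aˣ)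

/-- Entries of the linear part of the evaluation of `T(u)`. -/
def ellA (u a : Aˣ) (r : ℕ) (i m p s : Fin N) : A :=
  if r = 0 then (if i = p ∧ i = m ∧ p = s then -((u⁻¹ : Aˣ) : A) else 0) +
    (if p < i ∧ p = m ∧ i = s then -kap u else 0)
  else if p = m ∧ i = s then -((a : A) ^ r * kap u) else 0

/-- Entries of the linear part of the evaluation of `T̄(u)`. -/
def ellbA (u a : Aˣ) (r : ℕ) (i m p s : Fin N) : A :=
  if r = 0 then (if i = p ∧ i = m ∧ p = s then 1 else 0) +
    (if i < p ∧ p = m ∧ i = s then kap u else 0)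
  else if p = m ∧ i = s then ((a⁻¹ : Aˣ) : A) ^ r * kap u else 0

variable {u a : Aˣ}

theorem algebraMap_units_inv (hu : algebraMap A F u = q) : algebraMap A F (u⁻¹ : Aˣ) = q⁻¹ := by
  rw [← hu]
  refine eq_inv_of_mul_eq_one_left ?_
  rw [← map_mul, Units.inv_mul, map_one]

theorem sub_one_mul_kap (hu : algebraMap A F u = q) (hq : q ≠ 0) :
    (q - 1) * algebraMap A F (kap u) = q - q⁻¹ := by
  rw [kap, map_add, map_one, algebraMap_units_inv hu]
  field_simp
  ring

theorem evT_apply (hu : algebraMap A F u = q) (hq : q ≠ 0) (r : ℕ) (i m p s : Fin N) :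
    evT q (algebraMap A F a) r i m p s = (if r = 0 ∧ i = m ∧ p = s then 1 else 0) +
      (q - 1) * algebraMap A F (ellA u a r i m p s) := by
  have hk := sub_one_mul_kap hu hq
  rw [evT, Matrix.of_apply, Matrix.smul_apply, blk_apply, smul_eq_mul, cT, ellA]
  by_cases hr : r = 0
  · simp only [hr, if_true, pow_zero, one_mul, coRt, dg, wM, dl, true_and, map_add]
    have e : (q - 1) * q⁻¹ = 1 - q⁻¹ := by field_simp
    rcases lt_trichotomy p i with h | rfl | h
    · simp only [h, h.ne', if_false, if_true, false_and, true_and, map_zero, zero_add]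
      split_ifs <;> simp_all [mul_neg]
    · simp only [lt_irrefl, if_false, if_true, false_and, true_and, map_zero, zero_mul, add_zero]
      split_ifs <;> simp_all [algebraMap_units_inv hu]
      grind
    · simp only [h.not_gt, h.ne, if_false, false_and, map_zero, zero_mul, add_zero]
      split_ifs <;> simp_all
  · simp only [hr, if_false, false_and, zero_add, Prod.fst_sub, Prod.snd_sub, Pi.sub_apply, coRt,
      coR, dg, wM, wP, dl]
    have e : (q - 1) * ((algebraMap A F a) ^ r * algebraMap A F (kap u)) =
        (algebraMap A F a) ^ r * (q - q⁻¹) := by rw [← hk]; ring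
    rcases lt_trichotomy p i with h | rfl | h
    · simp only [h, h.ne', h.not_gt, if_false, if_true]
      split_ifs <;> simp_all
      rw [← mul_neg, neg_sub]
    · simp only [lt_irrefl, if_false, if_true]
      split_ifs <;> simp_all
      all_goals grind
    · simp only [h, h.ne, h.not_gt, if_false, if_true]
      split_ifs <;> simp_all
      rw [← mul_neg, neg_sub]

theorem evTb_apply (hu : algebraMap A F u = q) (hq : q ≠ 0) (r : ℕ) (i m p s : Fin N) :
    evTb q (algebraMap A F a) r i m p s = (if r = 0 ∧ i = m ∧ p = s then 1 else 0) +
      (q - 1) * algebraMap A F (ellbA u a r i m p s) := by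
  have hk := sub_one_mul_kap hu hq
  have ha : algebraMap A F (a⁻¹ : Aˣ) = (algebraMap A F a)⁻¹ := algebraMap_units_inv rfl
  rw [evTb, Matrix.of_apply, Matrix.smul_apply, blk_apply, smul_eq_mul, cTb, ellbA]
  by_cases hr : r = 0
  · simp only [hr, if_true, pow_zero, one_mul, coR, dg, wP, dl, true_and, map_add]
    rcases lt_trichotomy p i with h | rfl | h
    · simp only [h.not_gt, h.ne', if_false, false_and, map_zero, zero_mul, add_zero]
      split_ifs <;> simp_all
    · simp only [lt_irrefl, if_false, if_true, false_and, true_and, map_zero, zero_mul, add_zero]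
      split_ifs <;> simp_all
      grind
    · simp only [h, h.ne, if_false, if_true, false_and, true_and, map_zero, zero_add]
      split_ifs <;> simp_all
  · simp only [hr, if_false, false_and, zero_add, Prod.fst_sub, Prod.snd_sub, Pi.sub_apply, coRt,
      coR, dg, wM, wP, dl]
    have e : (q - 1) * ((algebraMap A F a)⁻¹ ^ r * algebraMap A F (kap u)) =
        (algebraMap A F a)⁻¹ ^ r * (q - q⁻¹) := by rw [← hk]; ring
    rcases lt_trichotomy p i with h | rfl | h
    · simp only [h, h.ne', h.not_gt, if_false, if_true]
      split_ifs <;> simp_all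
    · simp only [lt_irrefl, if_false, if_true]
      split_ifs <;> simp_all
      grind
    · simp only [h, h.ne, h.not_gt, if_false, if_true]
      split_ifs <;> simp_all

end EvalEntries

section Coproduct

variable {F : Type} [Field F] {N n : ℕ} {B : Type} [Ring B] [Algebra F B] {q α : F}

/-- The evaluation matrices with coefficients extended to `B`. -/
def evB (B : Type) [Ring B] [Algebra F B]
    (T : ℕ → Matrix (Fin N) (Fin N) (Matrix (Fin N) (Fin N) F)) (r : ℕ) :
    Matrix (Fin N) (Fin N) (Matrix (Fin N) (Fin N) B) :=
  (T r).map (Algebra.ofId F B).mapMatrix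

/-- A matrix family with entries viewed as scalar matrices. -/
def scB (T : ℕ → Matrix (Fin N) (Fin N) B) (r : ℕ) :
    Matrix (Fin N) (Fin N) (Matrix (Fin N) (Fin N) B) :=
  (T r).map (Matrix.scalarAlgHom (Fin N) F)

theorem evB_commute_scB (T : ℕ → Matrix (Fin N) (Fin N) (Matrix (Fin N) (Fin N) F))
    (T' : ℕ → Matrix (Fin N) (Fin N) B) (r s : ℕ) (i j k l : Fin N) :
    Commute (evB B T r i j) (scB (F := F) T' s k l) := by
  ext p m
  simp only [evB, scB, Matrix.map_apply, AlgHom.mapMatrix_apply, Matrix.scalarAlgHom_apply,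
    Matrix.scalar_apply, Matrix.mul_diagonal, Matrix.diagonal_mul, Algebra.ofId_apply]
  exact Algebra.commutes _ _

theorem affRep_coproduct {T Tb : ℕ → Matrix (Fin N) (Fin N) B} (h : AffRep q T Tb) (hq : q ≠ 0)
    (hα : α ≠ 0) :
    AffRep q (cauchy (evB B (evT q α)) (scB (F := F) T))
      (cauchy (evB B (evTb q α)) (scB (F := F) Tb)) :=
  ((affRep_eval hq hα).map (Algebra.ofId F B).mapMatrix).mul
    (h.map (Matrix.scalarAlgHom (Fin N) F))
    (fun r s i j k l => evB_commute_scB _ _ r s i j k l)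
    (fun r s i j k l => evB_commute_scB _ _ r s i j k l)
    (fun r s i j k l => evB_commute_scB _ _ r s i j k l)
    (fun r s i j k l => evB_commute_scB _ _ r s i j k l)

/-- The coproduct with the evaluation representation in the first factor. -/
def coprod (hq : q ≠ 0) (hα : α ≠ 0) :
    UqAff F q N →ₐ[F] Matrix (Fin N) (Fin N) (UqAff F q N) :=
  (affRep_coproduct (affRep_univ F q N) hq hα).lift

theorem map_bil {C : Type} [Ring C] [Algebra F C] (f : B →ₐ[F] C)
    (X Y : Matrix (Fin (2 * n)) (Fin (2 * n)) B) (i j : Fin (2 * n)) :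
    f (bil q X Y i j) = bil q (X.map f) (Y.map f) i j := by
  simp [bil]

theorem map_Sfam {C : Type} [Ring C] [Algebra F C] (f : B →ₐ[F] C)
    (T Tb : ℕ → Matrix (Fin (2 * n)) (Fin (2 * n)) B) (r : ℕ) (i j : Fin (2 * n)) :
    f (Sfam q T Tb r i j) = Sfam q (fun r => (T r).map f) (fun r => (Tb r).map f) r i j := by
  simp only [Sfam_apply, map_sum, map_bil]

theorem map_Gser {C : Type} [Ring C] [Algebra F C] (f : B →ₐ[F] C) (r : ℕ)
    (i j : Fin (2 * n)) : f (Gser q B r i j) = Gser q C r i j := by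
  rw [Gser, Gser]
  split_ifs
  · simp [GA]
  · simp

theorem map_sg {C : Type} [Ring C] [Algebra F C] (f : B →ₐ[F] C)
    (S : ℕ → Matrix (Fin (2 * n)) (Fin (2 * n)) B) (r : ℕ) (i j : Fin (2 * n)) :
    f (sg q S r i j) = sg q (fun r => (S r).map f) r i j := by
  simp [sg, map_Gser]

/-- A homomorphism `B → Mat_N(B)` which is the coproduct on the given matrix families, with the
evaluation representation in the first factor. -/
structure IsCoprod (q α : F) (T Tb : ℕ → Matrix (Fin N) (Fin N) B)
    (Δ : B →ₐ[F] Matrix (Fin N) (Fin N) B) : Prop where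
  map_T : ∀ r i j, Δ (T r i j) = cauchy (evB B (evT q α)) (scB (F := F) T) r i j
  map_Tb : ∀ r i j, Δ (Tb r i j) = cauchy (evB B (evTb q α)) (scB (F := F) Tb) r i j

theorem isCoprod_coprod (hq : q ≠ 0) (hα : α ≠ 0) :
    IsCoprod q α (TU F q N) (TbU F q N) (coprod hq hα) :=
  ⟨(affRep_coproduct (affRep_univ F q N) hq hα).lift_tA,
    (affRep_coproduct (affRep_univ F q N) hq hα).lift_tbA⟩

theorem IsCoprod.map_ps_Sfam {T Tb : ℕ → Matrix (Fin (2 * n)) (Fin (2 * n)) B}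
    {Δ : B →ₐ[F] Matrix (Fin (2 * n)) (Fin (2 * n)) B} (h : IsCoprod q α T Tb Δ)
    (i j : Fin (2 * n)) :
    ps (fun r => (Sfam q T Tb r).map Δ) i j =
      ∑ m, ∑ m', ps (evB B (evT q α)) i m * ps (evB B (evTb q α)) j m' *
        ps (scB (F := F) (Sfam q T Tb)) m m' := by
  have e1 : (fun r => (Sfam q T Tb r).map Δ) =
      Sfam q (cauchy (evB B (evT q α)) (scB (F := F) T))
        (cauchy (evB B (evTb q α)) (scB (F := F) Tb)) := by
    funext r
    ext1 i j
    rw [Matrix.map_apply, map_Sfam]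
    congr 1
    · funext r
      ext1 i j
      exact h.map_T r i j
    · funext r
      ext1 i j
      exact h.map_Tb r i j
  have e2 : scB (F := F) (Sfam q T Tb) = Sfam q (scB (F := F) T) (scB (F := F) Tb) := by
    funext r
    ext1 i j
    rw [scB, Matrix.map_apply, map_Sfam]
    rfl
  rw [e1, e2]
  exact ps_Sfam_cauchy (fun r s i j k l => evB_commute_scB _ _ r s i j k l) i j

end Coproduct

section Expansion

theorem sum_perturbed_delta {A P : Type} [CommRing A] [Ring P] [Algebra A P] {N : ℕ} (h : A)
    (i j : Fin N) (l l' : Fin N → P) (G s : Fin N → Fin N → P) :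
    ∑ m, ∑ m', ((if i = m then 1 else 0) + h • l m) * ((if j = m' then 1 else 0) + h • l' m') *
        (G m m' + h • s m m') =
      G i j + h • (s i j + (∑ m, l m * G m j + ∑ m, l' m * G i m) +
        h • (∑ m, l m * s m j + ∑ m, l' m * s i m +
          ∑ m, ∑ m', l m * l' m' * (G m m' + h • s m m'))) := by
  have e : ∀ m m', ((if i = m then (1 : P) else 0) + h • l m) *
      ((if j = m' then 1 else 0) + h • l' m') * (G m m' + h • s m m') =
      (if i = m then if j = m' then G m m' + h • s m m' else 0 else 0) +
      (if i = m then h • (l' m' * G m m' + h • (l' m' * s m m')) else 0) +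
      (if j = m' then h • (l m * G m m' + h • (l m * s m m')) else 0) +
      (h * h) • (l m * l' m' * (G m m' + h • s m m')) := by
    intro m m'
    split_ifs <;>
    simp only [add_mul, mul_add, one_mul, smul_mul_assoc, mul_smul_comm, smul_add,
      smul_smul, zero_add, add_zero, mul_one] <;> module
  simp only [e, Finset.sum_add_distrib]
  simp only [← Finset.smul_sum]
  rw [Finset.sum_comm (f := fun m m' => if j = m' then _ else _)]
  have e1 : ∀ (c : Fin N) (f : Fin N → Fin N → P),
      ∑ x, ∑ x', (if c = x then f x x' else 0) = ∑ x', f c x' := fun c f => by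
    rw [Finset.sum_comm]
    simp
  rw [e1, e1, e1]
  simp only [Finset.sum_ite_eq, Finset.mem_univ, if_true, ← Finset.smul_sum,
    Finset.sum_add_distrib]
  module

variable {N n : ℕ} {A : Type} [CommRing A] {B : Type} [Ring B] [Algebra A B]

/-- The span of words as a subalgebra. -/
def Wsub (A : Type) [CommRing A] [Algebra A B] (σ : ℕ → Matrix (Fin N) (Fin N) B) :
    Subalgebra A B :=
  (Wspan A σ).toSubalgebra (wprod_mem_Wspan []) fun _ _ => Wspan_mul

theorem mem_Wsub {σ : ℕ → Matrix (Fin N) (Fin N) B} {x : B} :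
    x ∈ Wsub A σ ↔ x ∈ Wspan A σ := Iff.rfl

/-- Power series with coefficients in a subalgebra. -/
def PsSub (W : Subalgebra A B) : Subalgebra A (PowerSeries B) where
  carrier := {φ | ∀ r, PowerSeries.coeff r φ ∈ W}
  add_mem' h h' r := by
    rw [map_add]
    exact add_mem (h r) (h' r)
  mul_mem' h h' r := by
    rw [PowerSeries.coeff_mul]
    exact sum_mem fun p _ => mul_mem (h p.1) (h' p.2)
  algebraMap_mem' a r := by
    rw [PowerSeries.algebraMap_apply, PowerSeries.coeff_C]
    split_ifs
    · exact W.algebraMap_mem a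
    · exact zero_mem W

end Expansion

section CoproductExpansion

variable {F : Type} [Field F] {N n : ℕ} {q : F}
variable {A : Type} [CommRing A] [Algebra A F] {B : Type} [Ring B] [Algebra F B] [Algebra A B]
  [IsScalarTower A F B] {u a : Aˣ}

/-- The linear part of the evaluation of `T(u)`. -/
def ellM (B : Type) [Ring B] [Algebra A B] (u a : Aˣ) (r : ℕ) :
    Matrix (Fin N) (Fin N) (Matrix (Fin N) (Fin N) B) :=
  Matrix.of fun i m => Matrix.of fun p s => algebraMap A B (ellA u a r i m p s)

/-- The linear part of the evaluation of `T̄(u)`. -/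
def ellbM (B : Type) [Ring B] [Algebra A B] (u a : Aˣ) (r : ℕ) :
    Matrix (Fin N) (Fin N) (Matrix (Fin N) (Fin N) B) :=
  Matrix.of fun i m => Matrix.of fun p s => algebraMap A B (ellbA u a r i m p s)

theorem ps_eq_delta_add {T E : ℕ → Matrix (Fin N) (Fin N) (Matrix (Fin N) (Fin N) B)} {h : A}
    {i m : Fin N} (hT : ∀ r p s, T r i m p s = (if r = 0 ∧ i = m ∧ p = s then 1 else 0) +
      h • E r i m p s) : ps T i m = (if i = m then 1 else 0) + h • ps E i m := by
  ext r p s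
  rw [ps, PowerSeries.coeff_mk, hT, map_add, PowerSeries.coeff_smul, ps, PowerSeries.coeff_mk,
    Matrix.add_apply, Matrix.smul_apply]
  congr 1
  by_cases him : i = m
  · simp only [him, true_and, if_true, PowerSeries.coeff_one]
    split_ifs with h1 h2 h2
    · rw [h1.2, Matrix.one_apply_eq]
    · exact absurd h1.1 h2
    · rw [Matrix.one_apply_ne fun e => h1 ⟨h2, e⟩]
    · rfl
  · simp [him]

theorem algebraMap_eq_delta_add {h : A} {t : F} {e : A} {P : Prop} [Decidable P]
    (ht : t = (if P then 1 else 0) + algebraMap A F h * algebraMap A F e) :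
    algebraMap F B t = (if P then 1 else 0) + h • algebraMap A B e := by
  rw [ht, map_add, map_mul, ← IsScalarTower.algebraMap_apply, ← IsScalarTower.algebraMap_apply,
    Algebra.smul_def]
  split_ifs <;> simp

theorem ps_evT (hu : algebraMap A F u = q) (hq : q ≠ 0) (i m : Fin N) :
    ps (evB B (evT q (algebraMap A F a))) i m =
      (if i = m then 1 else 0) + ((u : A) - 1) • ps (ellM B u a) i m :=
  ps_eq_delta_add fun r p s => algebraMap_eq_delta_add (by
    rw [map_sub, hu, map_one]
    exact evT_apply hu hq r i m p s)

theorem ps_evTb (hu : algebraMap A F u = q) (hq : q ≠ 0) (i m : Fin N) :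
    ps (evB B (evTb q (algebraMap A F a))) i m =
      (if i = m then 1 else 0) + ((u : A) - 1) • ps (ellbM B u a) i m :=
  ps_eq_delta_add fun r p s => algebraMap_eq_delta_add (by
    rw [map_sub, hu, map_one]
    exact evTb_apply hu hq r i m p s)

omit [Algebra A B] [IsScalarTower A F B] in
theorem ps_map_sg {C : Type} [Ring C] [Algebra F C] [Algebra A C] [IsScalarTower A F C]
    (f : B →ₐ[F] C) (hu : algebraMap A F u = q) (hq1 : q ≠ 1)
    (S : ℕ → Matrix (Fin (2 * n)) (Fin (2 * n)) B) (i j : Fin (2 * n)) :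
    ps (fun r => (S r).map f) i j =
      ps (Gser q C) i j + ((u : A) - 1) • ps (fun r => (sg q S r).map f) i j := by
  ext r
  have e := congrFun (congrFun (smul_sg_eq (A := A) (S := fun r => (S r).map f) hu hq1 r) i) j
  have e2 : (sg q S r).map f i j = sg q (fun r => (S r).map f) r i j := map_sg f S r i j
  rw [Matrix.add_apply, Matrix.smul_apply] at e
  simp only [ps, map_add, PowerSeries.coeff_smul, PowerSeries.coeff_mk]
  rw [e2]
  exact e

theorem smul_sub_one_cancel {V : Type} [AddCommGroup V] [Module F V] [Module A V]
    [IsScalarTower A F V] (hu : algebraMap A F u = q) (hq1 : q ≠ 1) {x y : V}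
    (h : ((u : A) - 1) • x = ((u : A) - 1) • y) : x = y := by
  rw [← IsScalarTower.algebraMap_smul F ((u : A) - 1) x,
    ← IsScalarTower.algebraMap_smul F ((u : A) - 1) y, map_sub, hu, map_one] at h
  exact smul_right_injective V (sub_ne_zero.2 hq1) h

end CoproductExpansion

section CoproductExpansion

variable {F : Type} [Field F] {n : ℕ} {q : F}
variable {A : Type} [CommRing A] [Algebra A F] {B : Type} [Ring B] [Algebra F B] [Algebra A B]
  [IsScalarTower A F B] {u a : Aˣ}
variable {T Tb : ℕ → Matrix (Fin (2 * n)) (Fin (2 * n)) B}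
  {Δ : B →ₐ[F] Matrix (Fin (2 * n)) (Fin (2 * n)) B}

/-- The coefficients of the bilinear form over `A`. -/
def geA (u : Aˣ) (i : Fin (2 * n)) : A := if i.val % 2 = 0 then u else -1

theorem GA_apply_geA (hu : algebraMap A F u = q) (i j : Fin (2 * n)) :
    GA q B i j = if j = pr i then algebraMap A B (geA u i) else 0 := by
  rw [IsScalarTower.algebraMap_apply A F B, GA, Matrix.map_apply, Gm_apply, ge, geA]
  split_ifs <;> simp [hu]

/-- The leading part of the coproduct of a letter. -/
def xA (u a : Aˣ) (p s : Fin (2 * n)) (g : ℕ × Fin (2 * n) × Fin (2 * n)) : A :=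
  ellA u a g.1 g.2.1 (pr g.2.2) p s * geA u (pr g.2.2) +
    ellbA u a g.1 g.2.2 (pr g.2.1) p s * geA u g.2.1

theorem IsCoprod.map_ps_sg (h : IsCoprod q (algebraMap A F a) T Tb Δ)
    (hu : algebraMap A F u = q) (hq : q ≠ 0) (hq1 : q ≠ 1) (i j : Fin (2 * n)) :
    let ℓ := ps (ellM (N := 2 * n) B u a)
    let ℓb := ps (ellbM (N := 2 * n) B u a)
    let g := ps (Gser (n := n) q (Matrix (Fin (2 * n)) (Fin (2 * n)) B))
    let s := ps (scB (F := F) (sg q (Sfam q T Tb)))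
    ps (fun r => (sg q (Sfam q T Tb) r).map Δ) i j =
      s i j + (∑ m, ℓ i m * g m j + ∑ m, ℓb j m * g i m) + ((u : A) - 1) •
        (∑ m, ℓ i m * s m j + ∑ m, ℓb j m * s i m +
          ∑ m, ∑ m', ℓ i m * ℓb j m' * (g m m' + ((u : A) - 1) • s m m')) := by
  intro ℓ ℓb g s
  have e := h.map_ps_Sfam i j
  rw [ps_map_sg (A := A) Δ hu hq1] at e
  simp only [ps_evT hu hq, ps_evTb hu hq] at e
  have e2 : ∀ m m', ps (scB (F := F) (Sfam q T Tb)) m m' = g m m' + ((u : A) - 1) • s m m' :=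
    fun m m' => ps_map_sg (A := A) (C := Matrix (Fin (2 * n)) (Fin (2 * n)) B)
      (Matrix.scalarAlgHom (Fin (2 * n)) F) hu hq1 (Sfam q T Tb) m m'
  simp only [e2, sum_perturbed_delta] at e
  exact smul_sub_one_cancel hu hq1 (add_left_cancel e)

theorem coeff_ps_mul_Gser {C : Type} [Ring C] [Algebra F C]
    (f : ℕ → Matrix (Fin (2 * n)) (Fin (2 * n)) C) (i k m l : Fin (2 * n)) (r : ℕ) :
    PowerSeries.coeff r (ps f i k * ps (Gser q C) m l) = f r i k * GA q C m l := by
  rw [coeff_ps_mul_ps, Finset.sum_range_succ, Finset.sum_eq_zero]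
  · simp [Gser]
  · intro p hp
    have : r - p ≠ 0 := Nat.sub_ne_zero_of_lt (Finset.mem_range.1 hp)
    simp [Gser, this]

theorem ps_mem_PsSub {W : Subalgebra A B} {f : ℕ → Matrix (Fin (2 * n)) (Fin (2 * n)) B}
    {i j : Fin (2 * n)} (h : ∀ r, f r i j ∈ W) : ps f i j ∈ PsSub W := fun r => by
  rw [ps, PowerSeries.coeff_mk]
  exact h r

/-- The coproduct of a letter up to small terms. -/
theorem IsCoprod.map_sg (h : IsCoprod q (algebraMap A F a) T Tb Δ)
    (hu : algebraMap A F u = q) (hq : q ≠ 0) (hq1 : q ≠ 1)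
    (g : ℕ × Fin (2 * n) × Fin (2 * n)) :
    ∃ Y : Matrix (Fin (2 * n)) (Fin (2 * n)) B,
      (∀ p s, Y p s ∈ Wspan A (sg q (Sfam q T Tb))) ∧
      ∀ p s, Δ (sg q (Sfam q T Tb) g.1 g.2.1 g.2.2) p s =
        (if p = s then sg q (Sfam q T Tb) g.1 g.2.1 g.2.2 else 0) +
          algebraMap A B (xA u a p s g) + ((u : A) - 1) • Y p s := by
  obtain ⟨r, i, j⟩ := g
  set W := (Wsub A (sg q (Sfam q T Tb))).matrix (n := Fin (2 * n))
  have m1 : ∀ i m, ps (ellM (N := 2 * n) B u a) i m ∈ PsSub W := fun i m =>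
    ps_mem_PsSub fun r p s => Subalgebra.algebraMap_mem _ _
  have m2 : ∀ i m, ps (ellbM (N := 2 * n) B u a) i m ∈ PsSub W := fun i m =>
    ps_mem_PsSub fun r p s => Subalgebra.algebraMap_mem _ _
  have m3 : ∀ i m, ps (scB (F := F) (sg q (Sfam q T Tb))) i m ∈ PsSub W := fun i m =>
    ps_mem_PsSub fun r p s => by
      rw [scB, Matrix.map_apply, Matrix.scalarAlgHom_apply, Matrix.scalar_apply,
        Matrix.diagonal_apply]
      split_ifs
      · have := wprod_mem_Wspan (A := A) (σ := sg q (Sfam q T Tb)) [(r, i, m)]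
        exact mem_Wsub.2 (by simpa [wprod_cons] using this)
      · exact zero_mem _
  have m4 : ∀ i m, ps (Gser (n := n) q (Matrix (Fin (2 * n)) (Fin (2 * n)) B)) i m ∈ PsSub W :=
    fun i m => ps_mem_PsSub fun r => by
      rw [Gser]
      split_ifs
      · rw [GA_apply_geA (A := A) hu]
        split_ifs
        · exact W.algebraMap_mem _
        · exact zero_mem W
      · exact zero_mem W
  have key : ∀ {X Y D Z : PowerSeries (Matrix (Fin (2 * n)) (Fin (2 * n)) B)},
      X = Y + D + ((u : A) - 1) • Z → Z ∈ PsSub W →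
      ∃ Z ∈ PsSub W, X = Y + D + ((u : A) - 1) • Z := fun e hZ => ⟨_, hZ, e⟩
  obtain ⟨Z, hZ, e⟩ := key (h.map_ps_sg hu hq hq1 i j)
    (add_mem (add_mem (sum_mem fun m _ => mul_mem (m1 _ _) (m3 _ _))
      (sum_mem fun m _ => mul_mem (m2 _ _) (m3 _ _)))
      (sum_mem fun m _ => sum_mem fun m' _ => mul_mem (mul_mem (m1 _ _) (m2 _ _))
        (add_mem (m4 _ _) ((PsSub W).smul_mem (m3 _ _) _))))
  refine ⟨PowerSeries.coeff r Z, fun p s => hZ r p s, fun p s => ?_⟩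
  replace e := congrArg (PowerSeries.coeff r) e
  simp only [map_add (PowerSeries.coeff r), PowerSeries.coeff_smul, map_sum, coeff_ps_mul_Gser,
    GA_apply_geA (A := A) hu, mul_ite, mul_zero, pr_eq_comm (j := j), Finset.sum_ite_eq',
    Finset.mem_univ, if_true] at e
  simp only [ps, PowerSeries.coeff_mk] at e
  replace e := congrFun (congrFun e p) s
  simp only [Matrix.add_apply, Matrix.smul_apply] at e
  have hM : ∀ (M : Matrix (Fin (2 * n)) (Fin (2 * n)) B) (x : A),
      (M * algebraMap A (Matrix (Fin (2 * n)) (Fin (2 * n)) B) x) p s =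
        M p s * algebraMap A B x := fun M x => by
    rw [Matrix.algebraMap_eq_diagonal, Matrix.mul_diagonal]
    rfl
  have hs : scB (F := F) (sg q (Sfam q T Tb)) r i j p s =
      if p = s then sg q (Sfam q T Tb) r i j else 0 := by
    rw [scB, Matrix.map_apply, Matrix.scalarAlgHom_apply, Matrix.scalar_apply,
      Matrix.diagonal_apply]
  rw [hM, hM, hs, ellM, ellbM] at e
  simp only [Matrix.of_apply, ← map_mul, ← map_add] at e
  exact e

end CoproductExpansion

section MatrixProbes

variable {N : ℕ} {A : Type} [CommRing A] {B : Type} [Ring B] [Algebra A B]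
  {I : Ideal A} {σ : ℕ → Matrix (Fin N) (Fin N) B}

/-- An entry of a matrix-valued homomorphism. -/
def entryMap (Δ : B →ₐ[A] Matrix (Fin N) (Fin N) B) (p s : Fin N) : B →ₗ[A] B :=
  Matrix.entryLinearMap A B p s ∘ₗ Δ.toLinearMap

theorem entryMap_apply (Δ : B →ₐ[A] Matrix (Fin N) (Fin N) B) (p s : Fin N) (y : B) :
    entryMap Δ p s y = Δ y p s := rfl

/-- The entries of a homomorphism close to the scalar embedding act as derivations. -/
theorem isDer_entryMap {Δ : B →ₐ[A] Matrix (Fin N) (Fin N) B}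
    {x : Fin N → Fin N → ℕ × Fin N × Fin N → A} {c : A} (hc : c ∈ I)
    (hx : ∀ g : ℕ × Fin N × Fin N, ∃ Y : Matrix (Fin N) (Fin N) B,
      (∀ p s, Y p s ∈ Wspan A σ) ∧ ∀ p s, Δ (σ g.1 g.2.1 g.2.2) p s =
        (if p = s then σ g.1 g.2.1 g.2.2 else 0) + algebraMap A B (x p s g) + c • Y p s)
    (p s : Fin N) : IsDer I σ (entryMap Δ p s) (if p = s then 1 else 0) (x p s) := by
  intro w
  induction w generalizing p with
  | nil =>
    rw [wprod_nil, entryMap_apply, map_one, Matrix.one_apply]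
    split_ifs <;> simp [derW]
  | cons g w ih =>
    obtain ⟨Y, hY, e⟩ := hx g
    have hD : ∀ k, Δ (wprod σ w) k s ∈ Wspan A σ := fun k => by
      have := add_mem (Jf_le_Wspan _ (ih k)) (add_mem
        ((Wspan A σ).smul_mem (if k = s then 1 else 0) (wprod_mem_Wspan w))
        (Jf_le_Wspan _ (derW_mem (I := I) (x k s) w)))
      rwa [sub_add_cancel] at this
    have hD' : ∀ k, Δ (wprod σ w) k s - (if k = s then (1 : A) else 0) • wprod σ w ∈
        Jf I σ w.length := fun k => by
      have := add_mem (Jf_mono (Nat.sub_le _ 1) (ih k)) (derW_mem (I := I) (x k s) w)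
      rwa [sub_add_eq_sub_sub, sub_add_cancel] at this
    have h1 := mul_Jf_pred_mem g (ih p)
    have h2 : ∑ k, x p k g • (Δ (wprod σ w) k s - (if k = s then (1 : A) else 0) • wprod σ w) ∈
        Jf I σ w.length := sum_mem fun k _ => Submodule.smul_mem _ _ (hD' k)
    have h3 : c • ∑ k, Y p k * Δ (wprod σ w) k s ∈ Jf I σ w.length :=
      smul_mem_Jf hc (sum_mem fun k _ => Wspan_mul (hY p k) (hD k)) _
    have key := add_mem (add_mem h1 h2) h3
    rw [List.length_cons, Nat.add_sub_cancel]
    convert key using 1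
    rw [wprod_cons, entryMap_apply, entryMap_apply, map_mul, Matrix.mul_apply, derW_cons]
    simp only [e, add_mul, ite_mul, zero_mul, Finset.sum_add_distrib, Finset.sum_ite_eq,
      Finset.mem_univ, if_true, ← Algebra.smul_def, smul_mul_assoc, smul_sub,
      Finset.sum_sub_distrib, ← Finset.smul_sum, ite_smul, one_smul, zero_smul, smul_ite, smul_zero, Finset.sum_ite_eq',
      mul_sub, mul_add, mul_ite, mul_zero]
    abel

end MatrixProbes

section Averaging

variable {A : Type} [CommRing A] [IsDomain A] [Algebra ℚ A] {M : ℕ} {ζ : Aˣ}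

omit [Algebra ℚ A] in
theorem sum_primitiveRoot_zpow (hζ : IsPrimitiveRoot ζ M) (z : ℤ) :
    ∑ t ∈ Finset.range M, ((((ζ ^ t) ^ z : Aˣ)) : A) = if (M : ℤ) ∣ z then (M : A) else 0 := by
  have e : ∀ t : ℕ, (((ζ ^ t) ^ z : Aˣ) : A) = (((ζ ^ z : Aˣ)) : A) ^ t := fun t => by
    rw [← Units.val_pow_eq_pow_val, ← zpow_natCast, ← zpow_natCast, ← zpow_mul, ← zpow_mul,
      mul_comm]
  simp only [e]
  split_ifs with h
  · rw [(hζ.zpow_eq_one_iff_dvd z).2 h]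
    simp
  · have h1 : (((ζ ^ z : Aˣ)) : A) - 1 ≠ 0 := fun h0 => h ((hζ.zpow_eq_one_iff_dvd z).1
      (Units.ext (by simpa using sub_eq_zero.1 h0)))
    refine (mul_eq_zero.1 ((mul_geom_sum _ _).trans ?_)).resolve_left h1
    rw [← Units.val_pow_eq_pow_val, ← zpow_natCast, ← zpow_mul, mul_comm, zpow_mul,
      zpow_natCast, hζ.pow_eq_one, one_zpow, Units.val_one, sub_self]

/-- The weights extracting a Fourier coefficient. -/
def fwt (M : ℕ) (ζ : Aˣ) (r t : ℕ) : A :=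
  algebraMap ℚ A (M : ℚ)⁻¹ * (((ζ ^ t) ^ (-(r : ℤ)) : Aˣ) : A)

theorem sum_fwt_mul_zpow (hζ : IsPrimitiveRoot ζ M) (hM : M ≠ 0) (r : ℕ) (z : ℤ) :
    ∑ t ∈ Finset.range M, fwt M ζ r t * (((ζ ^ t) ^ z : Aˣ) : A) =
      if (M : ℤ) ∣ z - r then 1 else 0 := by
  have e : ∀ t : ℕ, fwt M ζ r t * (((ζ ^ t) ^ z : Aˣ) : A) =
      algebraMap ℚ A (M : ℚ)⁻¹ * (((ζ ^ t) ^ (z - r) : Aˣ) : A) := fun t => by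
    rw [fwt, mul_assoc, ← Units.val_mul, ← zpow_add, neg_add_eq_sub]
  simp only [e, ← Finset.mul_sum, sum_primitiveRoot_zpow hζ]
  split_ifs
  · rw [← map_natCast (algebraMap ℚ A), ← map_mul, inv_mul_cancel₀ (by exact_mod_cast hM), map_one]
  · exact mul_zero _

theorem sum_fwt (hζ : IsPrimitiveRoot ζ M) (hM : M ≠ 0) {r : ℕ} (hr : r < M) :
    ∑ t ∈ Finset.range M, fwt M ζ r t = if r = 0 then 1 else 0 := by
  have := sum_fwt_mul_zpow hζ hM r 0
  simp only [zpow_zero, Units.val_one, mul_one] at this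
  rw [this]
  refine if_congr ?_ rfl rfl
  rw [zero_sub, dvd_neg, Int.natCast_dvd_natCast]
  exact ⟨fun h => Nat.eq_zero_of_dvd_of_lt h hr, fun h => h ▸ dvd_zero _⟩

theorem sum_fwt_mul_pow (hζ : IsPrimitiveRoot ζ M) {r s : ℕ} (hr : 2 * r < M) (hs : 2 * s < M) :
    ∑ t ∈ Finset.range M, fwt M ζ r t * ((ζ ^ t : Aˣ) : A) ^ s = if r = s then 1 else 0 := by
  have := sum_fwt_mul_zpow hζ (by omega) r s
  simp only [zpow_natCast, Units.val_pow_eq_pow_val] at this ⊢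
  rw [this]
  refine if_congr ⟨fun h => ?_, fun h => by simp [h]⟩ rfl rfl
  have := Int.eq_zero_of_abs_lt_dvd h (by rw [abs_lt]; omega)
  omega

theorem sum_fwt_mul_inv_pow (hζ : IsPrimitiveRoot ζ M) {r s : ℕ} (hr : 2 * r < M)
    (hs : 2 * s < M) (hs0 : s ≠ 0) :
    ∑ t ∈ Finset.range M, fwt M ζ r t * (((ζ ^ t)⁻¹ : Aˣ) : A) ^ s = 0 := by
  have := sum_fwt_mul_zpow hζ (by omega) r (-(s : ℤ))
  simp only [zpow_neg, zpow_natCast, ← inv_pow, Units.val_pow_eq_pow_val] at this ⊢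
  rw [this, if_neg]
  intro h
  have := Int.eq_zero_of_abs_lt_dvd h (by rw [abs_lt]; omega)
  omega

end Averaging

section Averaging

variable {A : Type} [CommRing A] [IsDomain A] [Algebra ℚ A] {M n : ℕ} {ζ u : Aˣ}

/-- The averaged leading part. -/
def avgA (M : ℕ) (ζ u : Aˣ) (r : ℕ) (p s : Fin (2 * n)) (g : ℕ × Fin (2 * n) × Fin (2 * n)) : A :=
  ∑ t ∈ Finset.range M, fwt M ζ r t * xA u (ζ ^ t) p s g

theorem avgA_zero (hζ : IsPrimitiveRoot ζ M) {r : ℕ} (hr : 2 * r < M) (p s k l : Fin (2 * n)) :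
    avgA M ζ u r p s (0, k, l) = if r = 0 then xA u 1 p s (0, k, l) else 0 := by
  have e : ∀ t : ℕ, xA u (ζ ^ t) p s (0, k, l) = xA u 1 p s (0, k, l) := fun t => by
    simp [xA, ellA, ellbA]
  simp only [avgA, e, ← Finset.sum_mul]
  rw [sum_fwt hζ (by omega) (by omega), ite_mul, one_mul, zero_mul]

theorem avgA_pos (hζ : IsPrimitiveRoot ζ M) {r r' : ℕ} (hr : 2 * r < M) (hr' : 2 * r' < M)
    (h0 : r' ≠ 0) (p s k l : Fin (2 * n)) :
    avgA M ζ u r p s (r', k, l) =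
      if r = r' ∧ p = pr l ∧ k = s then -(kap u * geA u (pr l)) else 0 := by
  have e : ∀ t : ℕ, fwt M ζ r t * xA u (ζ ^ t) p s (r', k, l) =
      (if p = pr l ∧ k = s then -(kap u * geA u (pr l)) else 0) *
        (fwt M ζ r t * ((ζ ^ t : Aˣ) : A) ^ r') +
      (if p = pr k ∧ l = s then kap u * geA u k else 0) *
        (fwt M ζ r t * (((ζ ^ t)⁻¹ : Aˣ) : A) ^ r') := fun t => by
    simp only [xA, ellA, ellbA, if_neg h0]
    split_ifs <;> ring
  simp only [avgA, e, Finset.sum_add_distrib, ← Finset.mul_sum, sum_fwt_mul_pow hζ hr hr',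
    sum_fwt_mul_inv_pow hζ hr hr' h0, mul_zero, add_zero]
  by_cases h : r = r' <;> simp [h]

end Averaging

section DualFunctionals

variable {A : Type} [CommRing A] [IsDomain A] [Algebra ℚ A] {M n : ℕ} {ζ u : Aˣ}

theorem pr_val_cases (i : Fin (2 * n)) :
    (i.val % 2 = 0 ∧ (pr i).val = i.val + 1) ∨ (i.val % 2 = 1 ∧ (pr i).val + 1 = i.val) := by
  rw [pr]
  split_ifs with h
  · exact .inl ⟨h, rfl⟩
  · exact .inr ⟨by omega, by simp only; omega⟩

/-- The functional dual to a letter. -/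
def dualA (M : ℕ) (ζ u : Aˣ) (g y : ℕ × Fin (2 * n) × Fin (2 * n)) : A :=
  if g.1 = 0 ∧ g.2.1 < g.2.2 then
    avgA M ζ u 0 g.2.2 g.2.2 y + (-1 : A) * avgA M ζ u 0 g.2.1 g.2.1 y
  else avgA M ζ u g.1 (pr g.2.2) g.2.1 y

/-- The value of the dual functional on its letter. -/
def dualV (u : Aˣ) (g : ℕ × Fin (2 * n) × Fin (2 * n)) : A :=
  if g.1 = 0 ∧ g.2.1 < g.2.2 then u + 1
  else if g.1 = 0 ∧ g.2.1 = g.2.2 ∧ g.2.1 < pr g.2.1 then kap u * geA u g.2.1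
  else -(kap u * geA u (pr g.2.2))

omit [IsDomain A] [Algebra ℚ A] in
theorem xA_zero (p s k l : Fin (2 * n)) : xA u 1 p s (0, k, l) =
    ((if k = p ∧ k = pr l ∧ p = s then -((u⁻¹ : Aˣ) : A) else 0) +
      (if p < k ∧ p = pr l ∧ k = s then -kap u else 0)) * geA u (pr l) +
    ((if l = p ∧ l = pr k ∧ p = s then 1 else 0) +
      (if l < p ∧ p = pr k ∧ l = s then kap u else 0)) * geA u k := by
  simp [xA, ellA, ellbA]

omit [IsDomain A] [Algebra ℚ A] in
theorem xA_zero_diag {p k l : Fin (2 * n)} (hg : Good (0, k, l)) :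
    xA u 1 p p (0, k, l) = (if p.val % 2 = 0 ∧ k = p ∧ l = pr p then -1 else 0) +
      (if p.val % 2 = 1 ∧ k = pr p ∧ l = p then (u : A) else 0) := by
  rw [xA_zero]
  have pp := pr_val_cases p
  have pk := pr_val_cases k
  have pl := pr_val_cases l
  simp only [Good, ne_eq, not_true, false_or, Fin.ext_iff, Fin.lt_def] at hg
  have c1 : (k = p ∧ k = pr l ∧ p = p) ↔ (p.val % 2 = 0 ∧ k = p ∧ l = pr p) := by
    simp only [Fin.ext_iff, and_true]
    omega
  have c2 : ¬(p < k ∧ p = pr l ∧ k = p) := by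
    simp only [Fin.ext_iff, Fin.lt_def]
    omega
  have c3 : (l = p ∧ l = pr k ∧ p = p) ↔ (p.val % 2 = 1 ∧ k = pr p ∧ l = p) := by
    simp only [Fin.ext_iff, and_true]
    omega
  have c4 : ¬(l < p ∧ p = pr k ∧ l = p) := by
    simp only [Fin.ext_iff, Fin.lt_def]
    omega
  rw [if_congr c1 rfl rfl, if_congr c3 rfl rfl, if_neg c2, if_neg c4, add_zero, add_zero]
  congr 1
  · split_ifs with h
    · obtain ⟨h, rfl, rfl⟩ := h
      rw [pr_pr, geA, if_pos h]
      simp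
    · rw [zero_mul]
  · split_ifs with h
    · obtain ⟨h, rfl, rfl⟩ := h
      rw [geA, if_pos (by omega), one_mul]
    · rw [zero_mul]

omit [IsDomain A] [Algebra ℚ A] in
theorem xA_zero_offdiag {i j k l : Fin (2 * n)} (hg : Good (0, k, l))
    (hij : i = j ∨ (j < i ∧ j ≠ pr i)) :
    xA u 1 (pr j) i (0, k, l) = if k = i ∧ l = j then
      (if i = j ∧ i < pr i then (kap u * geA u i : A) else -(kap u * geA u (pr j))) else 0 := by
  rw [xA_zero]
  have pi := pr_val_cases i
  have pj := pr_val_cases j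
  have inj : ∀ {x y : Fin (2 * n)}, pr x = pr y ↔ x = y := fun {x y} =>
    ⟨fun h => by rw [← pr_pr x, h, pr_pr], fun h => h ▸ rfl⟩
  simp only [Good, ne_eq, not_true, false_or, Fin.ext_iff, Fin.lt_def] at hg hij
  have c0 : pr j ≠ i := by
    rw [ne_eq, Fin.ext_iff]
    omega
  have c2 : (pr j < k ∧ pr j = pr l ∧ k = i) ↔ ((k = i ∧ l = j) ∧ ¬(i = j ∧ i < pr i)) := by
    rw [inj]
    have : pr j < i ↔ ¬(i = j ∧ i < pr i) := by
      simp only [Fin.ext_iff, Fin.lt_def]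
      omega
    constructor
    · rintro ⟨h, rfl, rfl⟩
      exact ⟨⟨rfl, rfl⟩, this.1 h⟩
    · rintro ⟨⟨rfl, rfl⟩, h⟩
      exact ⟨this.2 h, rfl, rfl⟩
  have c4 : (l < pr j ∧ pr j = pr k ∧ l = i) ↔ ((k = i ∧ l = j) ∧ (i = j ∧ i < pr i)) := by
    rw [inj]
    constructor
    · rintro ⟨h, rfl, rfl⟩
      have : l = j := by
        rw [Fin.ext_iff]
        omega
      subst this
      exact ⟨⟨rfl, rfl⟩, rfl, h⟩
    · rintro ⟨⟨rfl, rfl⟩, rfl, h⟩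
      exact ⟨h, rfl, rfl⟩
  rw [if_congr c2 rfl rfl, if_congr c4 rfl rfl]
  simp only [c0, and_false, if_false, zero_add]
  by_cases h : k = i ∧ l = j
  · obtain ⟨rfl, rfl⟩ := h
    by_cases h' : k = l ∧ k < pr k
    · obtain ⟨rfl, h'⟩ := h'
      simp [h']
    · simp [h']
  · simp [h]

theorem dualA_good (hζ : IsPrimitiveRoot ζ M) {g g' : ℕ × Fin (2 * n) × Fin (2 * n)}
    (hg : Good g) (hg' : Good g') (hr : 2 * g.1 < M) (hr' : 2 * g'.1 < M) :
    dualA M ζ u g g' = if g' = g then dualV u g else 0 := by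
  obtain ⟨r, i, j⟩ := g
  obtain ⟨r', k, l⟩ := g'
  simp only [dualA, dualV, Prod.mk.injEq] at *
  by_cases h0 : r' = 0
  · subst h0
    rw [avgA_zero hζ (by omega), avgA_zero hζ (by omega), avgA_zero hζ hr, if_pos rfl, if_pos rfl,
      xA_zero_diag hg', xA_zero_diag hg']
    by_cases hr0 : r = 0
    · subst hr0
      by_cases hij : i < j
      · have hpj : j = pr i := by
          have := hij.ne
          simp only [Good, ne_eq, not_true, false_or] at hg
          rcases hg with h | h | h
          · exact absurd h this
          · exact absurd h.1 hij.not_gt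
          · exact h.2
        subst hpj
        have pi := pr_val_cases i
        rw [Fin.lt_def] at hij
        have e1 : i.val % 2 = 0 := by omega
        have e2 : (pr i).val % 2 = 1 := by omega
        rw [← Fin.lt_def] at hij
        by_cases h : k = i ∧ l = pr i
        · simp [e1, e2, hij, h]
        · simp [e1, e2, hij, h]
      · rw [xA_zero_offdiag hg' (by
          simp only [Good, ne_eq, not_true, false_or] at hg
          rcases hg with h | h | h
          · exact .inl h
          · exact .inr h
          · exact absurd h.1 hij)]
        simp [hij]
    · rw [if_neg (fun h => hr0 h.1), if_neg hr0, if_neg fun h => hr0 h.1.symm]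
  · have h1 : avgA M ζ u 0 j j (r', k, l) = 0 := by
      rw [avgA_pos hζ (by omega) hr' h0, if_neg fun h => h0 h.1.symm]
    have h2 : avgA M ζ u 0 i i (r', k, l) = 0 := by
      rw [avgA_pos hζ (by omega) hr' h0, if_neg fun h => h0 h.1.symm]
    rw [h1, h2, avgA_pos hζ hr hr' h0]
    by_cases hr0 : r = r'
    · subst hr0
      have hj : pr j = pr l ↔ l = j := ⟨fun h => by rw [← pr_pr l, ← h, pr_pr], fun h => h ▸ rfl⟩
      by_cases h : k = i ∧ l = j
      · simp [h0, h]
      · simp only [h0, false_and, if_false, true_and, hj, h, and_comm (a := l = j)]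
    · simp [hr0, Ne.symm hr0]

omit [IsDomain A] [Algebra ℚ A] in
theorem isUnit_dualV (h : IsUnit ((u : A) + 1)) (g : ℕ × Fin (2 * n) × Fin (2 * n)) :
    IsUnit (dualV u g : A) := by
  have hk : IsUnit (kap u : A) := by
    have : (kap u : A) = (u⁻¹ : Aˣ) * ((u : A) + 1) := by
      rw [kap, mul_add, Units.inv_mul, mul_one]
    rw [this]
    exact (Units.isUnit _).mul h
  have hge : ∀ i : Fin (2 * n), IsUnit (geA u i : A) := fun i => by
    rw [geA]
    split_ifs
    · exact u.isUnit
    · exact isUnit_one.neg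
  rw [dualV]
  split_ifs
  · exact h
  · exact hk.mul (hge _)
  · exact (hk.mul (hge _)).neg

end DualFunctionals

section Independence

variable {A : Type} [CommRing A] [IsDomain A] [Algebra ℚ A] {M n : ℕ} {ζ u : Aˣ}
  {B : Type} [Ring B] [Algebra A B] {I : Ideal A}
  {σ : ℕ → Matrix (Fin (2 * n)) (Fin (2 * n)) B}

/-- The averaged entry. -/
def avgD (M : ℕ) (ζ : Aˣ) (D : ℕ → Fin (2 * n) → Fin (2 * n) → B →ₗ[A] B) (r : ℕ)
    (p s : Fin (2 * n)) : B →ₗ[A] B :=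
  ∑ t ∈ Finset.range M, fwt M ζ r t • D t p s

theorem isDer_avgD {D : ℕ → Fin (2 * n) → Fin (2 * n) → B →ₗ[A] B}
    (hζ : IsPrimitiveRoot ζ M)
    (hD : ∀ t p s, IsDer I σ (D t p s) (if p = s then 1 else 0) (xA u (ζ ^ t) p s)) {r : ℕ}
    (hr : 2 * r < M) (p s : Fin (2 * n)) :
    IsDer I σ (avgD M ζ D r p s) (if r = 0 ∧ p = s then 1 else 0) (avgA M ζ u r p s) := by
  convert IsDer.sum (Finset.range M) fun t _ => (hD t p s).smul (fwt M ζ r t) using 1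
  · rfl
  · rw [← Finset.sum_mul, sum_fwt hζ (by omega) (by omega)]
    split_ifs <;> simp_all
  · ext g
    simp [avgA, Finset.sum_apply]

/-- The operator dual to a letter. -/
def dualD (M : ℕ) (ζ : Aˣ) (D : ℕ → Fin (2 * n) → Fin (2 * n) → B →ₗ[A] B)
    (g : ℕ × Fin (2 * n) × Fin (2 * n)) : B →ₗ[A] B :=
  if g.1 = 0 ∧ g.2.1 < g.2.2 then avgD M ζ D 0 g.2.2 g.2.2 + (-1 : A) • avgD M ζ D 0 g.2.1 g.2.1
  else avgD M ζ D g.1 (pr g.2.2) g.2.1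

theorem isDer_dualD {D : ℕ → Fin (2 * n) → Fin (2 * n) → B →ₗ[A] B}
    (hζ : IsPrimitiveRoot ζ M)
    (hD : ∀ t p s, IsDer I σ (D t p s) (if p = s then 1 else 0) (xA u (ζ ^ t) p s))
    {g : ℕ × Fin (2 * n) × Fin (2 * n)} (hg : Good g) (hr : 2 * g.1 < M) :
    IsDer I σ (dualD M ζ D g) 0 (dualA M ζ u g) := by
  rw [dualD]
  split_ifs with h
  · have e : dualA M ζ u g = avgA M ζ u 0 g.2.2 g.2.2 + (-1 : A) • avgA M ζ u 0 g.2.1 g.2.1 := by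
      ext g'
      simp only [dualA, if_pos h, Pi.add_apply, Pi.smul_apply, smul_eq_mul]
    have := (isDer_avgD hζ hD (r := 0) (by omega) g.2.2 g.2.2).add
      ((isDer_avgD hζ hD (r := 0) (by omega) g.2.1 g.2.1).smul (-1))
    rw [e]
    convert this using 1
    simp
  · have e : dualA M ζ u g = avgA M ζ u g.1 (pr g.2.2) g.2.1 := by
      ext g'
      simp only [dualA, if_neg h]
    rw [e]
    convert isDer_avgD hζ hD hr (pr g.2.2) g.2.1 using 1
    rw [if_neg]
    rintro ⟨h0, h1⟩
    rcases hg with h' | h' | h' | h'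
    · exact h' h0
    · rw [← h'] at h1
      exact pr_ne _ h1
    · exact h'.2 (pr_eq_comm.2 h1.symm)
    · exact h ⟨h0, h'.1⟩

end Independence

section Independence

variable {F : Type} [Field F] {n : ℕ} {q : F}
variable {A : Type} [CommRing A] [IsDomain A] [IsLocalRing A] [Algebra ℚ A] [Algebra A F]
  {B : Type} [Ring B] [Algebra F B] [Algebra A B] [IsScalarTower A F B] {u : Aˣ}
variable {T Tb : ℕ → Matrix (Fin (2 * n)) (Fin (2 * n)) B}

omit [IsDomain A] in
theorem isUnit_add_one_of_sub_one_mem (hm : (u : A) - 1 ∈ IsLocalRing.maximalIdeal A) :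
    IsUnit ((u : A) + 1) := by
  by_contra h
  have h2 : IsUnit (2 : A) := by
    have := (isUnit_iff_ne_zero.2 (two_ne_zero (α := ℚ))).map (algebraMap ℚ A)
    rwa [map_ofNat] at this
  have h3 := sub_mem ((IsLocalRing.mem_maximalIdeal _).2 h) hm
  refine (IsLocalRing.mem_maximalIdeal _).1 h3 ?_
  convert h2 using 1
  ring

/-- Normal words are linearly independent modulo the maximal ideal. -/
theorem sum_smul_normal_ne_zero (hu : algebraMap A F u = q) (hq : q ≠ 0) (hq1 : q ≠ 1)
    (hm : (u : A) - 1 ∈ IsLocalRing.maximalIdeal A)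
    (hroots : ∀ m : ℕ, ∃ M > m, ∃ ζ : Aˣ, IsPrimitiveRoot ζ M)
    (hΔ : ∀ a : Aˣ, ∃ Δ : B →ₐ[F] Matrix (Fin (2 * n)) (Fin (2 * n)) B,
      IsCoprod q (algebraMap A F a) T Tb Δ)
    (h1 : ∀ t : A, IsUnit t →
      t • (1 : B) ∉ IsLocalRing.maximalIdeal A • Wspan A (sg q (Sfam q T Tb)))
    (s : Finset (List (ℕ × Fin (2 * n) × Fin (2 * n))))
    (hs : ∀ l ∈ s, NSorted l ∧ ∀ g ∈ l, Good g)
    (a : List (ℕ × Fin (2 * n) × Fin (2 * n)) → A) (ha : ∃ l ∈ s, IsUnit (a l)) :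
    ∑ l ∈ s, a l • wprod (sg q (Sfam q T Tb)) l ≠ 0 := by
  obtain ⟨M, hM, ζ, hζ⟩ := hroots (∑ l ∈ s, (l.map fun g => 2 * g.1).sum)
  have hlt : ∀ l ∈ s, ∀ g ∈ l, 2 * g.1 < M := fun l hl g hg =>
    ((List.single_le_sum (by simp) _ (List.mem_map_of_mem (f := fun g => 2 * g.1) hg)).trans
      (Finset.single_le_sum (f := fun l => (l.map fun g => 2 * g.1).sum)
        (fun _ _ => Nat.zero_le _) hl)).trans_lt hM
  choose Δ hΔ using fun t : ℕ => hΔ (ζ ^ t)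
  have hD : ∀ (t : ℕ) p s', IsDer (IsLocalRing.maximalIdeal A) (sg q (Sfam q T Tb))
      (entryMap ((Δ t).restrictScalars A) p s') (if p = s' then 1 else 0) (xA u (ζ ^ t) p s') :=
    fun t p s' => isDer_entryMap (c := (u : A) - 1) hm
      (fun g => (hΔ t).map_sg hu hq hq1 g) p s'
  refine sum_smul_wprod_ne_zero (Q := fun g => Good g ∧ 2 * g.1 < M) (v := dualV u)
    (d := dualA M ζ u) (P := dualD M ζ fun t => entryMap ((Δ t).restrictScalars A))
    (fun g g' hg hg' => dualA_good hζ hg.1 hg'.1 hg.2 hg'.2)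
    (fun g _ => isUnit_dualV (isUnit_add_one_of_sub_one_mem hm) g)
    (fun g hg => isDer_dualD hζ hD hg.1 hg.2) s
    (fun l hl g hg => ⟨(hs l hl).2 g hg, hlt l hl g hg⟩)
    (fun l hl l' hl' => (hs l hl).1.eq_of_perm (hs l' hl').1) h1 a ha

end Independence

section Counit

variable {F : Type} [Field F] {n : ℕ} {q : F} {B : Type} [Ring B] [Algebra F B]
  {T Tb : ℕ → Matrix (Fin (2 * n)) (Fin (2 * n)) B}

/-- A homomorphism trivial on the generators kills the normalized letters. -/
theorem counit_sg {ε : B →ₐ[F] F}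
    (hT : ∀ r i j, ε (T r i j) = if r = 0 then (1 : Matrix _ _ F) i j else 0)
    (hTb : ∀ r i j, ε (Tb r i j) = if r = 0 then (1 : Matrix _ _ F) i j else 0) (r : ℕ)
    (i j : Fin (2 * n)) : ε (sg q (Sfam q T Tb) r i j) = 0 := by
  have eT : (fun r => (T r).map ε) = fun r => if r = 0 then (1 : Matrix _ _ F) else 0 := by
    ext r i j
    rw [Matrix.map_apply, hT]
    split_ifs <;> rfl
  have eTb : (fun r => (Tb r).map ε) = fun r => if r = 0 then (1 : Matrix _ _ F) else 0 := by
    ext r i j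
    rw [Matrix.map_apply, hTb]
    split_ifs <;> rfl
  have eS : (fun r => (Sfam q T Tb r).map ε) = Gser q F := by
    ext r i j
    rw [Matrix.map_apply, map_Sfam, eT, eTb, Sfam, cauchy]
    rcases r with _ | r
    · simp [Gser]
    · rw [Finset.sum_eq_zero]
      · simp [Gser]
      · intro p hp
        rcases p with _ | p <;> simp
  rw [map_sg, eS]
  simp [sg]

variable {A : Type} [CommRing A] [IsLocalRing A] [Algebra A F] [Algebra A B] [IsScalarTower A F B]

/-- A homomorphism killing the letters separates units from small combinations of words. -/
theorem smul_one_notMem_of_counit (hinj : Function.Injective (algebraMap A F))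
    {σ : ℕ → Matrix (Fin (2 * n)) (Fin (2 * n)) B} {ε : B →ₐ[F] F}
    (hε : ∀ r i j, ε (σ r i j) = 0) (t : A) (ht : IsUnit t) :
    t • (1 : B) ∉ IsLocalRing.maximalIdeal A • Wspan A σ := by
  intro h
  have h2 := Submodule.mem_map_of_mem (f := (ε.restrictScalars A).toLinearMap) h
  have h3 : (Wspan A σ).map (ε.restrictScalars A).toLinearMap ≤
      LinearMap.range (Algebra.linearMap A F) := by
    refine Submodule.map_span_le _ _ _ |>.2 ?_
    rintro _ ⟨l, rfl⟩
    rcases l with _ | ⟨g, l⟩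
    · exact ⟨1, by simp [wprod_nil]⟩
    · exact ⟨0, by simp [wprod_cons, hε]⟩
  rw [Submodule.map_smul''] at h2
  have h4 := Submodule.smul_mono (le_refl (IsLocalRing.maximalIdeal A)) h3 h2
  rw [LinearMap.range_eq_map, ← Submodule.map_smul''] at h4
  obtain ⟨x, hx, e⟩ := h4
  have hx' : x ∈ IsLocalRing.maximalIdeal A := by
    simpa using hx
  have e' : algebraMap A F x = algebraMap A F t := by
    have : (ε.restrictScalars A).toLinearMap (t • 1) = algebraMap A F t := by
      simp [Algebra.smul_def]
    exact e.trans this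
  rw [hinj e'] at hx'
  exact (IsLocalRing.mem_maximalIdeal _).1 hx' ht

end Counit

section Valuation

variable {F : Type} [Field F] {n : ℕ} {q : F}
variable {A : Type} [CommRing A] [IsDomain A] [ValuationRing A] [Algebra ℚ A] [Algebra A F]
  [IsFractionRing A F]

/-- Normalization of a finite family of elements of the fraction field of a valuation ring. -/
theorem exists_normalized_family (A : Type) [CommRing A] [IsDomain A] [ValuationRing A]
    [Algebra A F] [IsFractionRing A F] {ι : Type} {s : Finset ι} {c : ι → F}
    (hc : ∃ l ∈ s, c l ≠ 0) :
    ∃ (a : ι → A) (t : F), (∀ l ∈ s, c l = t * algebraMap A F (a l)) ∧ ∃ l ∈ s, IsUnit (a l) := by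
  obtain ⟨l1, hl1, h1⟩ := hc
  obtain ⟨l0, hl0, hmax⟩ := s.exists_max_image (fun l => ValuationRing.valuation A F (c l))
    ⟨l1, hl1⟩
  have h0 : c l0 ≠ 0 := fun h => by
    have := hmax l1 hl1
    simp only [h, map_zero, le_zero_iff, map_eq_zero] at this
    exact h1 this
  have key : ∀ l, ∃ a : A, l ∈ s → algebraMap A F a = c l / c l0 := fun l => by
    by_cases hl : l ∈ s
    · have : c l / c l0 ∈ (ValuationRing.valuation A F).integer := by
        rw [Valuation.mem_integer_iff, map_div₀]
        exact div_le_one_of_le₀ (hmax l hl) zero_le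
      obtain ⟨a, ha⟩ := (ValuationRing.mem_integer_iff A F _).1 this
      exact ⟨a, fun _ => ha⟩
    · exact ⟨0, fun h => absurd h hl⟩
  choose a ha using key
  refine ⟨a, c l0, fun l hl => by rw [ha l hl, mul_div_cancel₀ _ h0], l0, hl0, ?_⟩
  have : a l0 = 1 := IsFractionRing.injective A F (by rw [ha l0 hl0, div_self h0, map_one])
  rw [this]
  exact isUnit_one

/-- Normal words are linearly independent. -/
theorem linearIndependent_normal {B : Type} [Ring B] [Algebra F B]
    {T Tb : ℕ → Matrix (Fin (2 * n)) (Fin (2 * n)) B} {u : Aˣ}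
    (hu : algebraMap A F u = q) (hq : q ≠ 0) (hq1 : q ≠ 1)
    (hm : (u : A) - 1 ∈ IsLocalRing.maximalIdeal A)
    (hroots : ∀ m : ℕ, ∃ M > m, ∃ ζ : Aˣ, IsPrimitiveRoot ζ M)
    (hΔ : ∀ α : F, α ≠ 0 → ∃ Δ : B →ₐ[F] Matrix (Fin (2 * n)) (Fin (2 * n)) B,
      IsCoprod q α T Tb Δ)
    (hε : ∃ ε : B →ₐ[F] F, ∀ r i j, ε (sg q (Sfam q T Tb) r i j) = 0)
    {s : Finset (List (ℕ × Fin (2 * n) × Fin (2 * n)))}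
    (hs : ∀ l ∈ s, NSorted l ∧ ∀ g ∈ l, Good g)
    {c : List (ℕ × Fin (2 * n) × Fin (2 * n)) → F}
    (h0 : ∑ l ∈ s, c l • wprod (sg q (Sfam q T Tb)) l = 0) : ∀ l ∈ s, c l = 0 := by
  let _ : Algebra A B := Algebra.compHom B (algebraMap A F)
  have : IsScalarTower A F B := IsScalarTower.of_algebraMap_eq fun _ => rfl
  by_contra! hc
  obtain ⟨a, t, hat, ha⟩ := exists_normalized_family A hc
  have ht : t ≠ 0 := by
    rintro rfl
    obtain ⟨l, hl, h⟩ := hc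
    exact h (by rw [hat l hl, zero_mul])
  obtain ⟨ε, hε⟩ := hε
  refine sum_smul_normal_ne_zero hu hq hq1 hm hroots (fun a => hΔ _ ?_)
    (smul_one_notMem_of_counit (IsFractionRing.injective A F) hε) s hs a ha ?_
  · exact fun h => a.ne_zero (IsFractionRing.injective A F (by rw [h, map_zero]))
  · refine (smul_right_injective B ht) ?_
    simp only [smul_zero, Finset.smul_sum]
    rw [← h0]
    refine Finset.sum_congr rfl fun l hl => ?_
    rw [hat l hl, mul_smul, algebraMap_smul]

/-- Injectivity of the map from the abstract algebra onto the algebra of the `s_ij(u)`. -/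
theorem injective_of_map_Sfam {B : Type} [Ring B] [Algebra F B]
    {T Tb : ℕ → Matrix (Fin (2 * n)) (Fin (2 * n)) B} {u : Aˣ}
    (hu : algebraMap A F u = q) (hq : q ≠ 0) (hq1 : q ≠ 1)
    (hm : (u : A) - 1 ∈ IsLocalRing.maximalIdeal A)
    (hroots : ∀ m : ℕ, ∃ M > m, ∃ ζ : Aˣ, IsPrimitiveRoot ζ M)
    (hΔ : ∀ α : F, α ≠ 0 → ∃ Δ : B →ₐ[F] Matrix (Fin (2 * n)) (Fin (2 * n)) B,
      IsCoprod q α T Tb Δ)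
    (hε : ∃ ε : B →ₐ[F] F, ∀ r i j, ε (sg q (Sfam q T Tb) r i j) = 0)
    {U : Type} [Ring U] [Algebra F U] {S : ℕ → Matrix (Fin (2 * n)) (Fin (2 * n)) U}
    {d : Fin n → U} (hU : SpRep q S d)
    (hgen : Algebra.adjoin F ({x | ∃ r i j, x = S r i j} ∪ Set.range d) = ⊤)
    (φ : U →ₐ[F] B) (hφ : ∀ r i j, φ (S r i j) = Sfam q T Tb r i j) : Function.Injective φ := by
  let _ : Algebra A U := Algebra.compHom U (algebraMap A F)
  have : IsScalarTower A F U := IsScalarTower.of_algebraMap_eq fun _ => rfl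
  rw [injective_iff_map_eq_zero]
  intro x hx
  obtain ⟨v, hv, hxv⟩ := hU.exists_mul_mem_span hq hq1 hu hm hgen x
  have hvu : IsUnit v := by
    refine (Submonoid.closure_le (S := IsUnit.submonoid U)).2 ?_ hv
    rintro _ ⟨k, rfl⟩
    exact ⟨⟨_, d k, hU.invR k, hU.invL k⟩, rfl⟩
  have hw : ∀ l, φ (wprod (sg q S) l) = wprod (sg q (Sfam q T Tb)) l := fun l => by
    have eS : (fun r => (S r).map φ) = Sfam q T Tb := by
      ext r i j
      exact hφ r i j
    induction l with
    | nil => rw [wprod_nil, wprod_nil, map_one]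
    | cons g l ih => rw [wprod_cons, wprod_cons, map_mul, ih, map_sg, eS]
  have h0 : x * v = 0 := by
    have hset : {x | ∃ l, NSorted l ∧ (∀ g ∈ l, Good g) ∧ wprod (sg q S) l = x} =
        wprod (sg q S) '' {l | NSorted l ∧ ∀ g ∈ l, Good g} := by
      ext y
      simp only [Set.mem_ofPred_eq, Set.mem_image, and_assoc]
    rw [hset] at hxv
    obtain ⟨f, hf, e⟩ := (Finsupp.mem_span_image_iff_linearCombination F).1 hxv
    rw [Finsupp.linearCombination_apply, Finsupp.sum] at e
    have h1 : ∑ l ∈ f.support, f l • wprod (sg q (Sfam q T Tb)) l = 0 := by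
      have := congrArg φ e
      simpa only [map_sum, map_smul, hw, map_mul, hx, zero_mul] using this
    have h2 := linearIndependent_normal hu hq hq1 hm hroots hΔ hε
      (fun l hl => (Finsupp.mem_supported F f).1 hf hl) h1
    rw [← e]
    exact Finset.sum_eq_zero fun l hl => by rw [h2 l hl, zero_smul]
  exact (hvu.mul_left_eq_zero).1 h0

end Valuation

section LocalRing

open Polynomial

/-- The place `q = 1` of `ℂ[q]`. -/
def placeOne : IsDedekindDomain.HeightOneSpectrum ℂ[X] where
  asIdeal := Ideal.span {X - C 1}
  isPrime := (Ideal.span_singleton_prime (X_sub_C_ne_zero 1)).2 (prime_X_sub_C 1)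
  ne_bot := by
    rw [ne_eq, Ideal.span_singleton_eq_bot]
    exact X_sub_C_ne_zero 1

/-- The local ring of rational functions regular at `q = 1`. -/
abbrev LocOne : ValuationSubring FF := (placeOne.valuation FF).valuationSubring

theorem algebraMap_mem_LocOne (p : ℂ[X]) : algebraMap ℂ[X] FF p ∈ LocOne :=
  placeOne.valuation_le_one p

/-- The constants in the local ring. -/
def constLoc : ℂ →+* LocOne :=
  ((algebraMap ℂ[X] FF).comp C).codRestrict LocOne.toSubring fun c => algebraMap_mem_LocOne (C c)

instance : Algebra ℚ LocOne := (constLoc.comp (algebraMap ℚ ℂ)).toAlgebra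

theorem exists_unit_LocOne : ∃ u : LocOneˣ, algebraMap LocOne FF u = qq ∧
    (u : LocOne) - 1 ∈ IsLocalRing.maximalIdeal LocOne := by
  let x : LocOne := ⟨qq, by simpa [qq] using algebraMap_mem_LocOne X⟩
  have hx : x - 1 ∈ IsLocalRing.maximalIdeal LocOne := by
    rw [IsLocalRing.mem_maximalIdeal, mem_nonunits_iff]
    intro h
    obtain ⟨y, hy⟩ := h.exists_right_inv
    have e : algebraMap ℂ[X] FF (X - C 1) * (y : FF) = 1 := by
      have := congrArg (Subtype.val) hy
      simpa [x, qq] using this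
    have h1 : placeOne.valuation FF (algebraMap ℂ[X] FF (X - C 1)) < 1 :=
      (placeOne.valuation_lt_one_iff_mem _).2 (Ideal.mem_span_singleton_self _)
    have h2 : placeOne.valuation FF (y : FF) ≤ 1 := y.2
    have h3 := congrArg (placeOne.valuation FF) e
    rw [map_mul, map_one (placeOne.valuation FF)] at h3
    exact absurd h3 (mul_lt_one_of_lt_of_le h1 h2).ne
  have hu : IsUnit x := by
    by_contra h
    have := sub_mem ((IsLocalRing.mem_maximalIdeal _).2 h) hx
    rw [sub_sub_cancel] at this
    exact (IsLocalRing.mem_maximalIdeal _).1 this isUnit_one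
  exact ⟨hu.unit, rfl, hx⟩

theorem exists_primitiveRoot_LocOne (m : ℕ) : ∃ M > m, ∃ ζ : LocOneˣ, IsPrimitiveRoot ζ M := by
  refine ⟨m + 1, Nat.lt_succ_self m, ?_⟩
  have h := (Complex.isPrimitiveRoot_exp (m + 1) (Nat.succ_ne_zero m)).map_of_injective
    constLoc.injective
  exact ⟨(h.isUnit (Nat.succ_ne_zero m)).unit, h.isUnit_unit (Nat.succ_ne_zero m)⟩

end LocalRing

theorem counit_univ (F : Type) [Field F] (q : F) (n : ℕ) :
    ∃ ε : UqAff F q (2 * n) →ₐ[F] F, ∀ r i j,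
      ε (sg q (Sfam q (TU F q (2 * n)) (TbU F q (2 * n))) r i j) = 0 := by
  refine ⟨(affRep_trivial (A := F) q).lift, counit_sg (fun r i j => ?_) fun r i j => ?_⟩
  · refine ((affRep_trivial (A := F) q).lift_tA r i j).trans ?_
    split_ifs <;> rfl
  · refine ((affRep_trivial (A := F) q).lift_tbA r i j).trans ?_
    split_ifs <;> rfl

theorem exists_algEquiv_YtwSp (n : ℕ) (inv : Fin n → UqAff FF qq (2 * n))
    (hinv : ∀ k : Fin n,
      ScoefSp FF qq n 0 (fe n k) (fo n k) * inv k = 1 ∧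
        inv k * ScoefSp FF qq n 0 (fe n k) (fo n k) = 1) :
    ∃ φ : AlgASp FF qq n ≃ₐ[FF] YtwSp FF qq n inv,
      (∀ (r : ℕ) (i j : Fin (2 * n)),
          (φ (sASp FF qq n r i j) : UqAff FF qq (2 * n)) = ScoefSp FF qq n r i j) ∧
        ∀ k : Fin n, (φ (sInvASp FF qq n k) : UqAff FF qq (2 * n)) = inv k := by
  have hq : qq ≠ 0 := RatFunc.X_ne_zero
  have hq1 : qq ≠ 1 := fun h => by
    have h' : algebraMap (Polynomial ℂ) FF Polynomial.X = algebraMap (Polynomial ℂ) FF 1 := by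
      rw [RatFunc.algebraMap_X, map_one]
      exact h
    exact Polynomial.X_sub_C_ne_zero (1 : ℂ)
      (by rw [RatFunc.algebraMap_injective ℂ h', Polynomial.C_1, sub_self])
  have hrep : SpRep qq (Sfam qq (TU FF qq (2 * n)) (TbU FF qq (2 * n))) inv :=
    (affRep_univ FF qq (2 * n)).spRep hq inv fun k => by
      rw [← ScoefSp_eq]
      exact hinv k
  obtain ⟨u, hu, hm⟩ := exists_unit_LocOne
  have hinj : Function.Injective hrep.lift :=
    injective_of_map_Sfam hu hq hq1 hm exists_primitiveRoot_LocOne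
      (fun α hα => ⟨_, isCoprod_coprod hq hα⟩) (counit_univ FF qq n) (spRep_univ FF qq n)
      (SUniv_adjoin FF qq n) hrep.lift hrep.lift_sASp
  have hrange : hrep.lift.range = YtwSp FF qq n inv := by
    rw [← Algebra.map_top, ← SUniv_adjoin, AlgHom.map_adjoin, YtwSp]
    congr 1
    rw [Set.image_union, ← Set.range_comp]
    congr 1
    · ext x
      constructor
      · rintro ⟨_, ⟨r, i, j, rfl⟩, rfl⟩
        exact ⟨r, i, j, by rw [hrep.lift_sASp, ScoefSp_eq]⟩
      · rintro ⟨r, i, j, rfl⟩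
        exact ⟨_, ⟨r, i, j, rfl⟩, by rw [hrep.lift_sASp, ScoefSp_eq]⟩
    · congr 1
      ext k
      exact hrep.lift_sInvASp k
  refine ⟨(AlgEquiv.ofInjective hrep.lift hinj).trans (Subalgebra.equivOfEq _ _ hrange),
    fun r i j => ?_, fun k => ?_⟩
  · exact (hrep.lift_sASp r i j).trans (ScoefSp_eq qq r i j).symm
  · exact hrep.lift_sInvASp k

end TwistedYangian

/-- The abstract algebra `𝒮` with generators `s_ij^{(r)}`,
`(s_{ii'}^{(0)})^{-1}` and the symplectic defining relations (triangularity, the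
quadratic relation, invertibility, and the affine reflection equation) is isomorphic
to the twisted q-Yangian `Y^tw_q(sp_2n)`. -/
theorem stmt15 (n : ℕ) (inv : Fin n → UqAff FF qq (2 * n))
    (hinv : ∀ k : Fin n,
      ScoefSp FF qq n 0 (fe n k) (fo n k) * inv k = 1 ∧
        inv k * ScoefSp FF qq n 0 (fe n k) (fo n k) = 1) :
    ∃ φ : AlgASp FF qq n ≃ₐ[FF] YtwSp FF qq n inv,
      (∀ (r : ℕ) (i j : Fin (2 * n)),
          (φ (sASp FF qq n r i j) : UqAff FF qq (2 * n)) = ScoefSp FF qq n r i j) ∧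
        ∀ k : Fin n, (φ (sInvASp FF qq n k) : UqAff FF qq (2 * n)) = inv k := by
  exact TwistedYangian.exists_algEquiv_YtwSp n inv hinv
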